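/- Let A be a homologically smooth and proper dg algebra over F₂ whose Hochschild homology HH_*(A) is supported in a single grading. Then every neutral dg (A,A)-bimodule is π-formal. -/

import Mathlib

noncomputable section
open TensorProduct

namespace LT

/-- A differential graded (dg) algebra over a commutative ring `k`: a chain complex with a
degree `-1` differential together with an associative unital multiplication satisfying the
(signed) Leibniz rule; over `𝔽₂` the signs are invisible. The grading is given by an internal
direct sum decomposition into submodules. -/
structure DGA (k : Type) [CommRing k] : Type 1 where
  V : Type
  [acg : AddCommGroup V]
  [mod : Module k V]
  gr : ℤ → Submodule k V
  internal : DirectSum.IsInternal gr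
  d : V →ₗ[k] V
  d_d : ∀ x, d (d x) = 0
  d_gr : ∀ i, ∀ x ∈ gr i, d x ∈ gr (i - 1)
  mul : V →ₗ[k] V →ₗ[k] V
  mul_assoc' : ∀ x y z, mul (mul x y) z = mul x (mul y z)
  one : V
  one_gr : one ∈ gr 0
  one_mul' : ∀ x, mul one x = x
  mul_one' : ∀ x, mul x one = x
  mul_gr : ∀ i j, ∀ x ∈ gr i, ∀ y ∈ gr j, mul x y ∈ gr (i + j)
  leibniz : ∀ i, ∀ x ∈ gr i, ∀ y, d (mul x y) = mul (d x) y + (Int.negOnePow i : ℤ) • mul x (d y)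

attribute [instance] DGA.acg
attribute [instance 2000] DGA.mod

variable {k : Type} [CommRing k]

/-- A dg `(A,A)`-bimodule over a dg algebra `A`. -/
structure DGBimod (A : DGA k) : Type 1 where
  V : Type
  [acg : AddCommGroup V]
  [mod : Module k V]
  gr : ℤ → Submodule k V
  internal : DirectSum.IsInternal gr
  d : V →ₗ[k] V
  d_d : ∀ x, d (d x) = 0
  d_gr : ∀ i, ∀ x ∈ gr i, d x ∈ gr (i - 1)
  actL : A.V →ₗ[k] V →ₗ[k] V
  actR : V →ₗ[k] A.V →ₗ[k] V
  actL_one : ∀ m, actL A.one m = m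
  actR_one : ∀ m, actR m A.one = m
  actL_mul : ∀ a b m, actL (A.mul a b) m = actL a (actL b m)
  actR_mul : ∀ m a b, actR (actR m a) b = actR m (A.mul a b)
  actLR : ∀ a m b, actR (actL a m) b = actL a (actR m b)
  actL_gr : ∀ i j, ∀ a ∈ A.gr i, ∀ m ∈ gr j, actL a m ∈ gr (i + j)
  actR_gr : ∀ i j, ∀ m ∈ gr i, ∀ a ∈ A.gr j, actR m a ∈ gr (i + j)
  leibnizL : ∀ i, ∀ a ∈ A.gr i, ∀ m, d (actL a m) = actL (A.d a) m + (Int.negOnePow i : ℤ) • actL a (d m)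
  leibnizR : ∀ j, ∀ m ∈ gr j, ∀ a, d (actR m a) = actR (d m) a + (Int.negOnePow j : ℤ) • actR m (A.d a)

attribute [instance] DGBimod.acg
attribute [instance 2000] DGBimod.mod

/-- The diagonal bimodule: `A` viewed as a bimodule over itself. -/
def DGA.diag (A : DGA k) : DGBimod A where
  V := A.V
  gr := A.gr
  internal := A.internal
  d := A.d
  d_d := A.d_d
  d_gr := A.d_gr
  actL := A.mul
  actR := A.mul
  actL_one := A.one_mul'
  actR_one := A.mul_one'
  actL_mul := fun a b m => A.mul_assoc' a b m
  actR_mul := fun m a b => A.mul_assoc' m a b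
  actLR := fun a m b => A.mul_assoc' a m b
  actL_gr := A.mul_gr
  actR_gr := A.mul_gr
  leibnizL := A.leibniz
  leibnizR := A.leibniz

variable {A : DGA k}

/-- A homomorphism of dg bimodules of degree `s`: a linear map raising degree by `s`,
commuting with the differentials and the two actions. -/
def IsBHom (M N : DGBimod A) (s : ℤ) (f : M.V →ₗ[k] N.V) : Prop :=
  (∀ i, ∀ x ∈ M.gr i, f x ∈ N.gr (i + s)) ∧
  (∀ x, f (M.d x) = N.d (f x)) ∧
  (∀ a m, f (M.actL a m) = N.actL a (f m)) ∧
  (∀ m a, f (M.actR m a) = N.actR (f m) a)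

/-- Graded maps of degree `s` compatible with the bimodule actions (no compatibility with the
differential required); these are used as homotopies. -/
def grHomSub (M N : DGBimod A) (s : ℤ) : Submodule k (M.V →ₗ[k] N.V) where
  carrier := {f | (∀ i, ∀ x ∈ M.gr i, f x ∈ N.gr (i + s)) ∧
    (∀ a m, f (M.actL a m) = N.actL a (f m)) ∧
    (∀ m a, f (M.actR m a) = N.actR (f m) a)}
  add_mem' := by
    rintro f g ⟨hf1, hf2, hf3⟩ ⟨hg1, hg2, hg3⟩
    refine ⟨fun i x hx => ?_, fun a m => ?_, fun m a => ?_⟩ <;>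
      simp [LinearMap.add_apply, hf2, hg2, hf3, hg3]
    exact Submodule.add_mem _ (hf1 i x hx) (hg1 i x hx)
  zero_mem' := by
    refine ⟨fun i x hx => ?_, fun a m => ?_, fun m a => ?_⟩ <;> simp
  smul_mem' := by
    rintro c f ⟨hf1, hf2, hf3⟩
    refine ⟨fun i x hx => ?_, fun a m => ?_, fun m a => ?_⟩ <;>
      simp [LinearMap.smul_apply, hf2, hf3]
    exact Submodule.smul_mem _ _ (hf1 i x hx)

/-- Bimodule chain maps of degree `s`, as a submodule of all linear maps. -/
def bcmSub (M N : DGBimod A) (s : ℤ) : Submodule k (M.V →ₗ[k] N.V) where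
  carrier := {f | IsBHom M N s f}
  add_mem' := by
    rintro f g ⟨hf1, hf0, hf2, hf3⟩ ⟨hg1, hg0, hg2, hg3⟩
    refine ⟨fun i x hx => ?_, fun x => ?_, fun a m => ?_, fun m a => ?_⟩ <;>
      simp [LinearMap.add_apply, hf0, hg0, hf2, hg2, hf3, hg3]
    exact Submodule.add_mem _ (hf1 i x hx) (hg1 i x hx)
  zero_mem' := by
    refine ⟨fun i x hx => ?_, fun x => ?_, fun a m => ?_, fun m a => ?_⟩ <;> simp
  smul_mem' := by
    rintro c f ⟨hf1, hf0, hf2, hf3⟩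
    refine ⟨fun i x hx => ?_, fun x => ?_, fun a m => ?_, fun m a => ?_⟩ <;>
      simp [LinearMap.smul_apply, hf0, hf2, hf3]
    exact Submodule.smul_mem _ _ (hf1 i x hx)

/-- The nullhomotopic degree-`s` maps `d ∘ h + h ∘ d` for `h` a degree `s+1` bimodule map. -/
def nullHtpSub (M N : DGBimod A) (s : ℤ) : Submodule k (M.V →ₗ[k] N.V) :=
  Submodule.map
    ((LinearMap.llcomp k M.V N.V N.V N.d) + (LinearMap.lcomp k N.V M.d))
    (grHomSub M N (s + 1))

/-- Homotopy classes of degree-`s` bimodule chain maps `M → N`; for `M` a cell retract this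
computes morphisms `Σ^s M → N` in the derived category of dg bimodules. -/
def HtpyHom (M N : DGBimod A) (s : ℤ) :=
  bcmSub M N s ⧸ Submodule.comap (bcmSub M N s).subtype (nullHtpSub M N s)

instance (M N : DGBimod A) (s : ℤ) : AddCommGroup (HtpyHom M N s) :=
  inferInstanceAs (AddCommGroup (_ ⧸ _))
instance (M N : DGBimod A) (s : ℤ) : Module k (HtpyHom M N s) :=
  inferInstanceAs (Module k (_ ⧸ _))


/-- Homology in degree `n` of a graded module with "relations": the degree-`n` part of the
homology of the quotient complex `(T/N, d)` where the grading of `T/N` is induced by `gr`.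
Taking `N = ⊥` gives ordinary graded homology. -/
def Hgr (T : Type) [AddCommGroup T] [Module k T] (gr : ℤ → Submodule k T)
    (N : Submodule k T) (d : T →ₗ[k] T) (n : ℤ) : Type :=
  ↥((gr n ⊔ N) ⊓ Submodule.comap d N) ⧸
    Submodule.comap ((gr n ⊔ N) ⊓ Submodule.comap d N).subtype
      (Submodule.map d (gr (n + 1) ⊔ N) ⊔ N)

instance (T : Type) [AddCommGroup T] [Module k T] (gr : ℤ → Submodule k T)
    (N : Submodule k T) (d : T →ₗ[k] T) (n : ℤ) : AddCommGroup (Hgr T gr N d n) :=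
  inferInstanceAs (AddCommGroup (_ ⧸ _))
instance (T : Type) [AddCommGroup T] [Module k T] (gr : ℤ → Submodule k T)
    (N : Submodule k T) (d : T →ₗ[k] T) (n : ℤ) : Module k (Hgr T gr N d n) :=
  inferInstanceAs (Module k (_ ⧸ _))

/-- `f` induces an isomorphism on (graded) homology, with a degree shift `s`; stated
elementarily: the induced map on homology classes is surjective and injective. -/
def IsQIsoDeg (T S : Type) [AddCommGroup T] [Module k T] [AddCommGroup S] [Module k S]
    (grT : ℤ → Submodule k T) (grS : ℤ → Submodule k S)
    (dT : T →ₗ[k] T) (dS : S →ₗ[k] S) (s : ℤ) (f : T →ₗ[k] S) : Prop :=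
  ∀ n : ℤ,
    (∀ y ∈ grS (n + s), dS y = 0 →
      ∃ x ∈ grT n, dT x = 0 ∧ f x - y ∈ Submodule.map dS (grS (n + s + 1))) ∧
    (∀ x ∈ grT n, dT x = 0 → f x ∈ Submodule.map dS (grS (n + s + 1)) →
      x ∈ Submodule.map dT (grT (n + 1)))

variable {A : DGA k}

/-- The bilinear "sandwich" map `(a, b) ↦ a · m · b` for a fixed element `m` of a bimodule. -/
def sandwich (M : DGBimod A) (m : M.V) : A.V →ₗ[k] A.V →ₗ[k] M.V :=
  LinearMap.mk₂ k (fun a b => M.actR (M.actL a m) b)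
    (fun a₁ a₂ b => by simp)
    (fun c a b => by simp)
    (fun a b₁ b₂ => by simp)
    (fun c a b => by simp)

/-- The bimodule map `A ⊗ A → M`, `a ⊗ b ↦ a · m · b`. -/
def sandwichT (M : DGBimod A) (m : M.V) : (A.V ⊗[k] A.V) →ₗ[k] M.V :=
  TensorProduct.lift (sandwich M m)

/-- `S'/S` is a free dg bimodule: there is a family of "generators" `g i` of degrees `deg i`,
closed cycles modulo `S`, which generate `S'` freely over `A ⊗ A` modulo `S`. -/
def IsFreeStep (M : DGBimod A) (S S' : Submodule k M.V) : Prop :=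
  ∃ (I : Type) (g : I → M.V) (deg : I → ℤ),
    (∀ i, g i ∈ S') ∧ (∀ i, M.d (g i) ∈ S) ∧
    (∀ i p q, ∀ a ∈ A.gr p, ∀ b ∈ A.gr q, M.actR (M.actL a (g i)) b ∈ M.gr (p + q + deg i)) ∧
    S' ≤ S ⊔ (⨆ i, LinearMap.range (sandwichT M (g i))) ∧
    (∀ (u : Finset I) (c : I → A.V ⊗[k] A.V),
      (∑ i ∈ u, sandwichT M (g i) (c i)) ∈ S → ∀ i ∈ u, c i = 0)

/-- As `IsFreeStep`, with a finite generating family. -/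
def IsFreeStepFin (M : DGBimod A) (S S' : Submodule k M.V) : Prop :=
  ∃ (I : Type) (_ : Finite I) (g : I → M.V) (deg : I → ℤ),
    (∀ i, g i ∈ S') ∧ (∀ i, M.d (g i) ∈ S) ∧
    (∀ i p q, ∀ a ∈ A.gr p, ∀ b ∈ A.gr q, M.actR (M.actL a (g i)) b ∈ M.gr (p + q + deg i)) ∧
    S' ≤ S ⊔ (⨆ i, LinearMap.range (sandwichT M (g i))) ∧
    (∀ (u : Finset I) (c : I → A.V ⊗[k] A.V),
      (∑ i ∈ u, sandwichT M (g i) (c i)) ∈ S → ∀ i ∈ u, c i = 0)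

/-- A filtration exhibiting `M` as a cell bimodule. -/
def IsCellFiltration (M : DGBimod A) (Fil : ℕ → Submodule k M.V) : Prop :=
  Fil 0 = ⊥ ∧ Monotone Fil ∧ (⨆ n, Fil n) = ⊤ ∧
  (∀ n, ∀ x ∈ Fil n, M.d x ∈ Fil n) ∧
  (∀ n a, ∀ x ∈ Fil n, M.actL a x ∈ Fil n) ∧
  (∀ n a, ∀ x ∈ Fil n, M.actR x a ∈ Fil n) ∧
  (∀ n, IsFreeStep M (Fil n) (Fil (n + 1)))

/-- A cell bimodule: admits a filtration with free subquotients. -/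
def IsCellBimod (M : DGBimod A) : Prop := ∃ Fil, IsCellFiltration M Fil

/-- A finite cell bimodule: a finite filtration with finite-rank free subquotients. -/
def IsFiniteCellBimod (M : DGBimod A) : Prop :=
  ∃ Fil, (Fil 0 = ⊥ ∧ Monotone Fil ∧ (⨆ n, Fil n) = ⊤ ∧
    (∀ n, ∀ x ∈ Fil n, M.d x ∈ Fil n) ∧
    (∀ n a, ∀ x ∈ Fil n, M.actL a x ∈ Fil n) ∧
    (∀ n a, ∀ x ∈ Fil n, M.actR x a ∈ Fil n) ∧
    (∀ n, IsFreeStepFin M (Fil n) (Fil (n + 1)))) ∧ (∃ n₀, Fil n₀ = ⊤)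

/-- A (finite) cell retract: a subcomplex of a (finite) cell bimodule whose inclusion admits
a bimodule retraction. -/
def IsCellRetract (P : DGBimod A) : Prop :=
  ∃ (C : DGBimod A), IsCellBimod C ∧
    ∃ (ι : P.V →ₗ[k] C.V) (r : C.V →ₗ[k] P.V),
      IsBHom P C 0 ι ∧ IsBHom C P 0 r ∧ Function.Injective ι ∧ r.comp ι = LinearMap.id

def IsFiniteCellRetract (P : DGBimod A) : Prop :=
  ∃ (C : DGBimod A), IsFiniteCellBimod C ∧
    ∃ (ι : P.V →ₗ[k] C.V) (r : C.V →ₗ[k] P.V),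
      IsBHom P C 0 ι ∧ IsBHom C P 0 r ∧ Function.Injective ι ∧ r.comp ι = LinearMap.id

/-- `ρ : R → M` is a resolution: a quasi-isomorphism of dg bimodules from a cell retract. -/
def IsResolution (R M : DGBimod A) (ρ : R.V →ₗ[k] M.V) : Prop :=
  IsCellRetract R ∧ IsBHom R M 0 ρ ∧ IsQIsoDeg R.V M.V R.gr M.gr R.d M.d 0 ρ

/-- A bimodule is perfect if it admits a resolution by a finite cell retract. -/
def IsPerfect (M : DGBimod A) : Prop :=
  ∃ (R : DGBimod A) (ρ : R.V →ₗ[k] M.V),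
    IsFiniteCellRetract R ∧ IsBHom R M 0 ρ ∧ IsQIsoDeg R.V M.V R.gr M.gr R.d M.d 0 ρ

/-- `A` is homologically smooth: perfect as a bimodule over itself. -/
def HomSmooth (A : DGA k) : Prop := IsPerfect A.diag

/-- The homology of the dg algebra `A` in degree `n`. -/
abbrev AlgH (A : DGA k) (n : ℤ) := Hgr A.V A.gr ⊥ A.d n

/-- `A` is homologically proper: its total homology is finitely generated. -/
def HomProper (A : DGA k) : Prop :=
  (∀ n, Module.Finite k (AlgH A n)) ∧ (Set.Finite {n : ℤ | Nontrivial (AlgH A n)})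

/-- A dg bimodule is bounded if it is supported in finitely many gradings. -/
def BoundedBimod (M : DGBimod A) : Prop := ∃ u : Finset ℤ, ∀ i ∉ u, M.gr i = ⊥

/-! ### Bicomplexes and the spectral sequences of their two filtrations -/

/-- A bicomplex of `k`-modules "with relations", presented as one ambient module with a
bigrading by submodules, a horizontal differential `dh` (of bidegree `(-1,0)`), a vertical
differential `dv` (of bidegree `(0,-1)`) and a submodule `N` of relations (so that the actual
bicomplex is the quotient by `N`; take `N = ⊥` for an honest bicomplex). -/
structure RelBicx (k : Type) [CommRing k] : Type 1 where
  T : Type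
  [acg : AddCommGroup T]
  [mod : Module k T]
  gr : ℤ → ℤ → Submodule k T
  N : Submodule k T
  dh : T →ₗ[k] T
  dv : T →ₗ[k] T

attribute [instance] RelBicx.acg RelBicx.mod

namespace RelBicx

variable {k : Type} [CommRing k] (B : RelBicx k)

/-- The total differential. -/
def D : B.T →ₗ[k] B.T := B.dh + B.dv

/-- The column filtration (by the first index `p`) of the total complex, in total degree `n`. -/
def Fcol (p n : ℤ) : Submodule k B.T := ⨆ (i : ℤ) (_ : i ≤ p), B.gr i (n - i)

/-- The row filtration (by the second index `q`) of the total complex, in total degree `n`. -/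
def Frow (q n : ℤ) : Submodule k B.T := ⨆ (j : ℤ) (_ : j ≤ q), B.gr (n - j) j

/-- Approximate cycles for the spectral sequence of the filtration `F`:
elements of filtration `p` (mod `N`) whose total differential drops filtration by `r`. -/
def Zpage (F : ℤ → ℤ → Submodule k B.T) (r p n : ℤ) : Submodule k B.T :=
  (F p n ⊔ B.N) ⊓ Submodule.comap B.D (F (p - r) (n - 1) ⊔ B.N)

/-- The boundaries subobject for the `r`-th page at filtration `p`, total degree `n`. -/
def Bpage (F : ℤ → ℤ → Submodule k B.T) (r p n : ℤ) : Submodule k B.T :=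
  Submodule.map B.D (B.Zpage F (r - 1) (p + r - 1) (n + 1)) ⊔ B.Zpage F (r - 1) (p - 1) n ⊔ B.N

/-- The `r`-th page of the spectral sequence of the filtration `F`, at filtration degree `p`
and total degree `n` (the classical subquotient description `Z^r/B^r`). -/
def Epage (F : ℤ → ℤ → Submodule k B.T) (r p n : ℤ) : Type :=
  ↥(B.Zpage F r p n) ⧸
    Submodule.comap (B.Zpage F r p n).subtype (B.Bpage F r p n)

instance (F : ℤ → ℤ → Submodule k B.T) (r p n : ℤ) : AddCommGroup (B.Epage F r p n) :=
  inferInstanceAs (AddCommGroup (_ ⧸ _))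
instance (F : ℤ → ℤ → Submodule k B.T) (r p n : ℤ) : Module k (B.Epage F r p n) :=
  inferInstanceAs (Module k (_ ⧸ _))

/-- The spectral sequence `ᵛʰE` (filtration by columns; one first takes homology with respect
to the vertical differential). Indexing: `vhE r p q` is `ᵛʰE^r_{p,q}`. -/
def vhE (r p q : ℤ) : Type := B.Epage B.Fcol r p (p + q)

/-- The spectral sequence `ʰᵛE` (filtration by rows; one first takes homology with respect to
the horizontal differential), in the transposed indexing of Lipshitz–Treumann:
`hvE r p q` is `ʰᵛE^r_{p,q}`, whose filtration index is the row `q`. -/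
def hvE (r p q : ℤ) : Type := B.Epage B.Frow r q (p + q)

instance (r p q : ℤ) : AddCommGroup (B.vhE r p q) := inferInstanceAs (AddCommGroup (Epage _ _ _ _ _))
instance (r p q : ℤ) : Module k (B.vhE r p q) := inferInstanceAs (Module k (Epage _ _ _ _ _))
instance (r p q : ℤ) : AddCommGroup (B.hvE r p q) := inferInstanceAs (AddCommGroup (Epage _ _ _ _ _))
instance (r p q : ℤ) : Module k (B.hvE r p q) := inferInstanceAs (Module k (Epage _ _ _ _ _))

/-- Vanishing of the differential leaving the `r`-th page at position `(p, n)`: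
the total differential of any approximate cycle is, up to boundaries of earlier pages and
relations, an approximate cycle of deeper filtration. -/
def zeroDiff (F : ℤ → ℤ → Submodule k B.T) (r p n : ℤ) : Prop :=
  Submodule.map B.D (B.Zpage F r p n) ≤
    Submodule.map B.D (B.Zpage F (r - 1) (p - 1) n) ⊔ B.Zpage F (r - 1) (p - r - 1) (n - 1) ⊔ B.N

/-- The spectral sequence of the filtration `F` collapses at the `r₀`-th page. -/
def collapsesAt (F : ℤ → ℤ → Submodule k B.T) (r₀ : ℤ) : Prop :=
  ∀ r : ℤ, r₀ ≤ r → ∀ p n : ℤ, B.zeroDiff F r p n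

/-- The part of total degree `n` of the bicomplex. -/
def totGr (n : ℤ) : Submodule k B.T := ⨆ p : ℤ, B.gr p (n - p)

/-- The degree-`n` homology of the total complex (of the quotient by `N`). -/
def Htot (n : ℤ) : Type :=
  ↥((B.totGr n ⊔ B.N) ⊓ Submodule.comap B.D B.N) ⧸
    Submodule.comap ((B.totGr n ⊔ B.N) ⊓ Submodule.comap B.D B.N).subtype
      (Submodule.map B.D (B.totGr (n + 1) ⊔ B.N) ⊔ B.N)

instance (n : ℤ) : AddCommGroup (B.Htot n) := inferInstanceAs (AddCommGroup (_ ⧸ _))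
instance (n : ℤ) : Module k (B.Htot n) := inferInstanceAs (Module k (_ ⧸ _))

/-- The graded piece `F_p H_n / F_{p-1} H_n` of the filtration induced by `F` on the homology
of the total complex. -/
def grHtot (F : ℤ → ℤ → Submodule k B.T) (p n : ℤ) : Type :=
  ↥((F p n ⊔ B.N) ⊓ Submodule.comap B.D B.N) ⧸
    Submodule.comap ((F p n ⊔ B.N) ⊓ Submodule.comap B.D B.N).subtype
      (((F (p - 1) n ⊔ B.N) ⊓ Submodule.comap B.D B.N) ⊔
        Submodule.map B.D (B.totGr (n + 1) ⊔ B.N) ⊔ B.N)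

instance (F : ℤ → ℤ → Submodule k B.T) (p n : ℤ) : AddCommGroup (B.grHtot F p n) :=
  inferInstanceAs (AddCommGroup (_ ⧸ _))
instance (F : ℤ → ℤ → Submodule k B.T) (p n : ℤ) : Module k (B.grHtot F p n) :=
  inferInstanceAs (Module k (_ ⧸ _))

/-- The spectral sequence of the filtration `F` converges to the homology of the total
complex: for every position the pages eventually stabilize and agree with the associated
graded of the induced filtration on the homology of the total complex. -/
def convergesTo (F : ℤ → ℤ → Submodule k B.T) : Prop :=
  ∀ p n : ℤ, ∃ r₀ : ℤ, ∀ r : ℤ, r₀ ≤ r →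
    Nonempty (B.Epage F r p n ≃ₗ[k] B.grHtot F p n)

end RelBicx
/-! ### Hochschild chains, the involution `τ`, and the Hochschild–Tate bicomplex (over `𝔽₂`) -/

section Hochschild

variable {A : DGA (ZMod 2)} (R M : DGBimod A)

/-- The ambient space `R ⊗ M` of the Hochschild chain complex `HC(A, M)` (with respect to the
resolution `R` of the diagonal bimodule): `HC(A,M) = (R ⊗ M)/rel2`. -/
abbrev T2 := R.V ⊗[ZMod 2] M.V

/-- The differential `∂(r ⊗ m) = ∂r ⊗ m + r ⊗ ∂m` (char. 2). -/
def d2 : T2 R M →ₗ[ZMod 2] T2 R M :=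
  TensorProduct.map R.d LinearMap.id + TensorProduct.map LinearMap.id M.d

/-- The grading of `R ⊗ M`. -/
def gr2 (n : ℤ) : Submodule (ZMod 2) (T2 R M) :=
  Submodule.span (ZMod 2)
    {z | ∃ i j, ∃ r ∈ R.gr i, ∃ m ∈ M.gr j, i + j = n ∧ z = r ⊗ₜ[ZMod 2] m}

/-- The Hochschild relations `ra ⊗ m ∼ r ⊗ am` and `ar ⊗ m ∼ r ⊗ ma` (char. 2). -/
def rel2 : Submodule (ZMod 2) (T2 R M) :=
  Submodule.span (ZMod 2)
    ({z | ∃ r a m, z = (R.actR r a) ⊗ₜ[ZMod 2] m + r ⊗ₜ[ZMod 2] (M.actL a m)} ∪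
     {z | ∃ r a m, z = (R.actL a r) ⊗ₜ[ZMod 2] m + r ⊗ₜ[ZMod 2] (M.actR m a)})

/-- The underlying space of the Hochschild chain complex `HC(A, M)`. -/
abbrev HCQ := T2 R M ⧸ rel2 R M

/-- The Hochschild homology `HH_n(A, M)` (computed from the chosen resolution `R → A`). -/
abbrev HH (n : ℤ) := Hgr (T2 R M) (gr2 R M) (rel2 R M) (d2 R M) n

/-- The ambient space `R ⊗ (M ⊗ (R ⊗ M))` of the Hochschild chain complex of the derived
tensor product: `HC(A, M ⊗̃_A M) = (R ⊗ (M ⊠ R ⊠ M))/∼ = (R ⊗ M ⊗ R ⊗ M)/rel4`. -/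
abbrev T4 := R.V ⊗[ZMod 2] (M.V ⊗[ZMod 2] (R.V ⊗[ZMod 2] M.V))

/-- The differential of `R ⊗ M ⊗ R ⊗ M` (char. 2; no signs). -/
def d4 : T4 R M →ₗ[ZMod 2] T4 R M :=
  TensorProduct.map R.d LinearMap.id +
  TensorProduct.map LinearMap.id (TensorProduct.map M.d LinearMap.id +
    TensorProduct.map LinearMap.id (TensorProduct.map R.d LinearMap.id +
      TensorProduct.map LinearMap.id M.d))

/-- The grading of `R ⊗ M ⊗ R ⊗ M`. -/
def gr4 (n : ℤ) : Submodule (ZMod 2) (T4 R M) :=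
  Submodule.span (ZMod 2)
    {z | ∃ i₁ j₁ i₂ j₂, ∃ r ∈ R.gr i₁, ∃ m ∈ M.gr j₁, ∃ r' ∈ R.gr i₂, ∃ m' ∈ M.gr j₂,
      i₁ + j₁ + i₂ + j₂ = n ∧ z = r ⊗ₜ[ZMod 2] (m ⊗ₜ[ZMod 2] (r' ⊗ₜ[ZMod 2] m'))}

/-- The combined relations presenting `HC(A, M ⊗̃_A M)` as a quotient of `R ⊗ M ⊗ R ⊗ M`:
the two relations of the naive tensor products `M ⊠_A R ⊠_A M` and the two outer Hochschild
relations (char. 2). -/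
def rel4 : Submodule (ZMod 2) (T4 R M) :=
  Submodule.span (ZMod 2)
    ({z | ∃ r a m r' m', z = (R.actR r a) ⊗ₜ[ZMod 2] (m ⊗ₜ[ZMod 2] (r' ⊗ₜ[ZMod 2] m')) +
        r ⊗ₜ[ZMod 2] ((M.actL a m) ⊗ₜ[ZMod 2] (r' ⊗ₜ[ZMod 2] m'))} ∪
     {z | ∃ r a m r' m', z = (R.actL a r) ⊗ₜ[ZMod 2] (m ⊗ₜ[ZMod 2] (r' ⊗ₜ[ZMod 2] m')) +
        r ⊗ₜ[ZMod 2] (m ⊗ₜ[ZMod 2] (r' ⊗ₜ[ZMod 2] (M.actR m' a)))} ∪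
     {z | ∃ r a m r' m', z = r ⊗ₜ[ZMod 2] ((M.actR m a) ⊗ₜ[ZMod 2] (r' ⊗ₜ[ZMod 2] m')) +
        r ⊗ₜ[ZMod 2] (m ⊗ₜ[ZMod 2] ((R.actL a r') ⊗ₜ[ZMod 2] m'))} ∪
     {z | ∃ r a m r' m', z = r ⊗ₜ[ZMod 2] (m ⊗ₜ[ZMod 2] ((R.actR r' a) ⊗ₜ[ZMod 2] m')) +
        r ⊗ₜ[ZMod 2] (m ⊗ₜ[ZMod 2] (r' ⊗ₜ[ZMod 2] (M.actL a m')))})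


instance {A : DGA (ZMod 2)} (R M : DGBimod A) :
    HasQuotient (T4 R M) (Submodule (ZMod 2) (T4 R M)) := Submodule.hasQuotient

/-- The underlying space of the Hochschild chain complex `HC(A, M ⊗̃_A M)`. -/
abbrev HCQ4 := T4 R M ⧸ rel4 R M

/-- The Hochschild homology `HH_n(A, M ⊗̃_A M)` of the derived tensor square. -/
abbrev HH4 (n : ℤ) := Hgr (T4 R M) (gr4 R M) (rel4 R M) (d4 R M) n

/-- The involution `τ` of `R ⊗ (M ⊗ (R ⊗ M))` exchanging the two halves:
`r ⊗ (m ⊗ (r' ⊗ m')) ↦ r' ⊗ (m' ⊗ (r ⊗ m))`. -/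
def tau4 : T4 R M →ₗ[ZMod 2] T4 R M :=
  ((TensorProduct.assoc (ZMod 2) R.V M.V (R.V ⊗[ZMod 2] M.V)).toLinearMap).comp
    (((TensorProduct.comm (ZMod 2) (R.V ⊗[ZMod 2] M.V) (R.V ⊗[ZMod 2] M.V)).toLinearMap).comp
      ((TensorProduct.assoc (ZMod 2) R.V M.V (R.V ⊗[ZMod 2] M.V)).symm.toLinearMap))

/-- The Hochschild–Tate bicomplex `HC^{Tate}(A, M ⊗̃_A M)`: the `ℤ`-periodic bicomplex whose
columns are the Hochschild complex of `M ⊗̃_A M` and whose horizontal differential is `1 + τ`. -/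
def TateBicx : RelBicx (ZMod 2) where
  T := ℤ →₀ T4 R M
  gr := fun p q => Submodule.map (Finsupp.lsingle p) (gr4 R M q)
  N := ⨅ p : ℤ, Submodule.comap (Finsupp.lapply p) (rel4 R M)
  dv := Finsupp.mapRange.linearMap (d4 R M)
  dh := (Finsupp.lmapDomain (T4 R M) (ZMod 2) (fun p => p - 1)).comp
    (Finsupp.mapRange.linearMap (LinearMap.id + tau4 R M))


/-- An element of the Hochschild–Tate bicomplex concentrated in column `p`. -/
def tateSingle (p : ℤ) (x : T4 R M) : (TateBicx R M).T := Finsupp.single p x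

/-- A dg bimodule `M` is `π`-formal (with respect to the resolution `R` of the diagonal
bimodule) if the spectral sequence `ʰᵛE` of the Hochschild–Tate bicomplex of `M ⊗̃_A M`
collapses at the `E³`-page; equivalently, all the induced operations
`d^{2i} : HH_k(A,M) → HH_{k-i}(A,M)`, `i ≥ 2`, vanish. -/
def PiFormalBimod : Prop := (TateBicx R M).collapsesAt (TateBicx R M).Frow 3

/-- A dg algebra is `π`-formal if every dg bimodule over it is `π`-formal. -/
def PiFormalAlg (R : DGBimod A) : Prop := ∀ M : DGBimod A, PiFormalBimod R M

end Hochschild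

/-- `M` is `d`-neutral: there is a class `f ∈ HH_d(A) = Hom(Σ^d A^!, A)` (represented by a
degree-`d` bimodule chain map `f : A^! → R`, with `R ≃ A` the chosen resolution of the
diagonal) such that precomposition with `f` induces an isomorphism
`f^* : HH^k(M) → HH_{d-k}(M)` for every `k`; here `HH^k(M) = Hom(Σ^{-k}A, M)` is modeled by
homotopy classes of degree-`(-k)` bimodule chain maps `R → M`, and `HH_{d-k}(M)` by homotopy
classes of degree-`(d-k)` bimodule chain maps `A^! → M`. -/
def IsDNeutral {A : DGA (ZMod 2)} (R Ab M : DGBimod A) (d : ℤ) : Prop :=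
  ∃ f : Ab.V →ₗ[ZMod 2] R.V, IsBHom Ab R d f ∧
    ∀ s : ℤ,
      (∀ g, IsBHom R M s g → (g.comp f) ∈ nullHtpSub Ab M (s + d) →
        g ∈ nullHtpSub R M s) ∧
      (∀ h, IsBHom Ab M (s + d) h →
        ∃ g, IsBHom R M s g ∧ h - g.comp f ∈ nullHtpSub Ab M (s + d))

/-- `M` is neutral if it is `d`-neutral for some `d`. -/
def IsNeutral {A : DGA (ZMod 2)} (R Ab M : DGBimod A) : Prop :=
  ∃ d : ℤ, IsDNeutral R Ab M d

section Part1
set_option linter.unusedVariables false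
set_option linter.unusedSimpArgs false
/-! ### Graded vector spaces over `𝔽₂` -/

section Graded

variable {V : Type} [AddCommGroup V] [Module (ZMod 2) V]
variable {W : Type} [AddCommGroup W] [Module (ZMod 2) W]

theorem neg_smul2 (i : ℤ) (x : V) : (Int.negOnePow i : ℤ) • x = x := by
  rcases Int.even_or_odd i with h | h
  · rw [Int.negOnePow_even i h]; simp
  · rw [Int.negOnePow_odd i h]; simp [ZModModule.neg_eq_self]

theorem add_add_self2 (x y : V) : x + (x + y) = y := by
  rw [← add_assoc, ZModModule.add_self, zero_add]

theorem eq_of_add_eq_zero2 {x y : V} (h : x + y = 0) : x = y := by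
  have := eq_neg_of_add_eq_zero_left h
  rwa [ZModModule.neg_eq_self] at this

/-- A linear map defined on the homogeneous pieces. -/
def homLift {gr : ℤ → Submodule (ZMod 2) V} (h : DirectSum.IsInternal gr)
    (u : ∀ i, gr i →ₗ[ZMod 2] W) : V →ₗ[ZMod 2] W :=
  (DirectSum.toModule (ZMod 2) ℤ W u).comp
    (LinearEquiv.ofBijective (DirectSum.coeLinearMap gr) h).symm.toLinearMap

theorem homLift_apply {gr : ℤ → Submodule (ZMod 2) V} (h : DirectSum.IsInternal gr)
    (u : ∀ i, gr i →ₗ[ZMod 2] W) (i : ℤ) (x : V) (hx : x ∈ gr i) :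
    homLift h u x = u i ⟨x, hx⟩ := by
  have : (LinearEquiv.ofBijective (DirectSum.coeLinearMap gr) h).symm x =
      DirectSum.lof (ZMod 2) ℤ (fun i => gr i) i ⟨x, hx⟩ := by
    rw [LinearEquiv.symm_apply_eq]
    exact (DirectSum.coeLinearMap_lof gr i ⟨x, hx⟩).symm
  simp only [homLift, LinearMap.comp_apply, LinearEquiv.coe_coe, this]
  simp

/-- Decomposition into homogeneous components. -/
def dec {gr : ℤ → Submodule (ZMod 2) V} (h : DirectSum.IsInternal gr) :
    V →ₗ[ZMod 2] (ℤ →₀ V) :=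
  homLift h (fun i => (Finsupp.lsingle i).comp (gr i).subtype)

theorem dec_apply {gr : ℤ → Submodule (ZMod 2) V} (h : DirectSum.IsInternal gr)
    (i : ℤ) (x : V) (hx : x ∈ gr i) : dec h x = Finsupp.single i x := by
  rw [dec, homLift_apply h _ i x hx]; simp

theorem gr_induction {gr : ℤ → Submodule (ZMod 2) V} (h : DirectSum.IsInternal gr)
    {p : V → Prop} (x : V) (h0 : p 0) (hadd : ∀ x y, p x → p y → p (x + y))
    (hom : ∀ i, ∀ x ∈ gr i, p x) : p x := by
  have hx : x ∈ ⨆ i, gr i := by rw [h.submodule_iSup_eq_top]; trivial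
  exact Submodule.iSup_induction gr (motive := p) hx hom h0 hadd

theorem gr_ext {gr : ℤ → Submodule (ZMod 2) V} (h : DirectSum.IsInternal gr)
    {f g : V →ₗ[ZMod 2] W} (hfg : ∀ i, ∀ x ∈ gr i, f x = g x) : f = g := by
  ext x
  refine gr_induction h (p := fun x => f x = g x) x (by simp) ?_ hfg
  intro x y hx hy; simp [hx, hy]

theorem dec_mem {gr : ℤ → Submodule (ZMod 2) V} (h : DirectSum.IsInternal gr)
    (x : V) (i : ℤ) : dec h x i ∈ gr i := by
  refine gr_induction h (p := fun x => dec h x i ∈ gr i) x (by simp) ?_ ?_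
  · intro x y hx hy
    simpa using Submodule.add_mem _ hx hy
  · intro j x hx
    rw [dec_apply h j x hx, Finsupp.single_apply]
    split_ifs with hij
    · exact hij ▸ hx
    · simp

theorem dec_sum {gr : ℤ → Submodule (ZMod 2) V} (h : DirectSum.IsInternal gr) (x : V) :
    Finsupp.lsum (ZMod 2) (fun _ : ℤ => (LinearMap.id : V →ₗ[ZMod 2] V)) (dec h x) = x := by
  have : (Finsupp.lsum (ZMod 2) (fun _ : ℤ => (LinearMap.id : V →ₗ[ZMod 2] V))).comp (dec h)
      = LinearMap.id := by
    apply gr_ext h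
    intro i x hx
    simp only [LinearMap.comp_apply, dec_apply h i x hx]
    simp
  exact LinearMap.congr_fun this x

theorem mem_of_dec {gr : ℤ → Submodule (ZMod 2) V} (h : DirectSum.IsInternal gr)
    (x y : V) (i : ℤ) (hx : dec h x = Finsupp.single i y) : x ∈ gr i := by
  have h1 := dec_sum h x
  have h2 := dec_mem h x i
  rw [hx] at h1 h2
  simp at h1 h2
  rwa [h1] at h2

theorem internal_of_dec {gr : ℤ → Submodule (ZMod 2) V} (D : V →ₗ[ZMod 2] (ℤ →₀ V))
    (hD : ∀ i, ∀ x ∈ gr i, D x = Finsupp.single i x) (htop : (⨆ i, gr i) = ⊤) :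
    DirectSum.IsInternal gr := by
  rw [DirectSum.isInternal_submodule_iff_iSupIndep_and_iSup_eq_top]
  refine ⟨?_, htop⟩
  rw [iSupIndep_def]
  intro i
  rw [Submodule.disjoint_def]
  intro x hx hx'
  have h1 : D x i = x := by rw [hD i x hx]; simp
  have h2 : (⨆ j, ⨆ (_ : j ≠ i), gr j) ≤ LinearMap.ker ((Finsupp.lapply i).comp D) := by
    refine iSup_le fun j => iSup_le fun hj => ?_
    intro y hy
    simp [hD j y hy, hj]
  have h3 := h2 hx'
  simp at h3
  rw [← h1, h3]

/-- Degree of a linear map may be checked on a homogeneous spanning set. -/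
theorem degree_of_span {gr : ℤ → Submodule (ZMod 2) V} (h : DirectSum.IsInternal gr)
    {gr' : ℤ → Submodule (ZMod 2) W} (h' : DirectSum.IsInternal gr') (s : ℤ)
    (f : V →ₗ[ZMod 2] W) (S : Set V) (hS : Submodule.span (ZMod 2) S = ⊤)
    (hf : ∀ v ∈ S, ∃ i, v ∈ gr i ∧ f v ∈ gr' (i + s)) (i : ℤ) (x : V) (hx : x ∈ gr i) :
    f x ∈ gr' (i + s) := by
  have key : (dec h').comp f =
      ((Finsupp.lmapDomain W (ZMod 2) (fun j : ℤ => j + s)).comp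
        (Finsupp.mapRange.linearMap f)).comp (dec h) := by
    apply LinearMap.ext_on hS
    intro v hv
    obtain ⟨j, hj, hj'⟩ := hf v hv
    simp only [LinearMap.comp_apply, dec_apply h j v hj, dec_apply h' _ _ hj']
    simp [Finsupp.mapDomain_single]
  have := LinearMap.congr_fun key x
  simp only [LinearMap.comp_apply, dec_apply h i x hx] at this
  refine mem_of_dec h' (f x) (f x) (i + s) ?_
  rw [this]
  simp [Finsupp.mapDomain_single]

/-- Tensor products of graded spaces: the decomposition map. -/
def tdec {gr : ℤ → Submodule (ZMod 2) V} (h : DirectSum.IsInternal gr)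
    {gr' : ℤ → Submodule (ZMod 2) W} (h' : DirectSum.IsInternal gr') :
    V ⊗[ZMod 2] W →ₗ[ZMod 2] (ℤ →₀ V ⊗[ZMod 2] W) :=
  TensorProduct.lift
    (homLift (W := W →ₗ[ZMod 2] (ℤ →₀ V ⊗[ZMod 2] W)) h fun i =>
      (((homLift (W := V →ₗ[ZMod 2] (ℤ →₀ V ⊗[ZMod 2] W)) h' fun j =>
        (((LinearMap.llcomp (ZMod 2) V (V ⊗[ZMod 2] W) (ℤ →₀ V ⊗[ZMod 2] W)
          (Finsupp.lsingle (i + j))).comp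
          (TensorProduct.mk (ZMod 2) V W).flip).comp (gr' j).subtype)).flip).comp
        (gr i).subtype))

theorem tdec_tmul {gr : ℤ → Submodule (ZMod 2) V} (h : DirectSum.IsInternal gr)
    {gr' : ℤ → Submodule (ZMod 2) W} (h' : DirectSum.IsInternal gr') (i j : ℤ)
    (x : V) (hx : x ∈ gr i) (y : W) (hy : y ∈ gr' j) :
    tdec h h' (x ⊗ₜ y) = Finsupp.single (i + j) (x ⊗ₜ y) := by
  simp only [tdec, TensorProduct.lift.tmul, homLift_apply h _ i x hx, LinearMap.comp_apply,
    LinearMap.flip_apply, homLift_apply h' _ j y hy]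
  simp

theorem tensor_span {gr : ℤ → Submodule (ZMod 2) V} (h : DirectSum.IsInternal gr)
    {gr' : ℤ → Submodule (ZMod 2) W} (h' : DirectSum.IsInternal gr')
    (P : Submodule (ZMod 2) (V ⊗[ZMod 2] W))
    (hP : ∀ i j, ∀ x ∈ gr i, ∀ y ∈ gr' j, x ⊗ₜ[ZMod 2] y ∈ P) : P = ⊤ := by
  rw [eq_top_iff]
  rintro z -
  induction z using TensorProduct.induction_on with
  | zero => simp
  | add x y hx hy => exact P.add_mem hx hy
  | tmul x y =>
    refine gr_induction h (p := fun x => x ⊗ₜ[ZMod 2] y ∈ P) x (by simp) ?_ ?_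
    · intro a b ha hb; rw [TensorProduct.add_tmul]; exact P.add_mem ha hb
    · intro i x hx
      refine gr_induction h' (p := fun y => x ⊗ₜ[ZMod 2] y ∈ P) y (by simp) ?_ ?_
      · intro a b ha hb; rw [TensorProduct.tmul_add]; exact P.add_mem ha hb
      · intro j y hy; exact hP i j x hx y hy

end Graded

/-! ### Unsigned Leibniz rules -/

section Leib

variable {A : DGA (ZMod 2)}

theorem DGA.leib (A : DGA (ZMod 2)) (x y : A.V) :
    A.d (A.mul x y) = A.mul (A.d x) y + A.mul x (A.d y) := by
  refine gr_induction A.internal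
    (p := fun x => A.d (A.mul x y) = A.mul (A.d x) y + A.mul x (A.d y)) x (by simp) ?_ ?_
  · intro a b ha hb
    simp only [map_add, LinearMap.add_apply, ha, hb]; abel
  · intro i x hx
    rw [A.leibniz i x hx y, neg_smul2]

theorem DGBimod.leibL (M : DGBimod A) (a : A.V) (m : M.V) :
    M.d (M.actL a m) = M.actL (A.d a) m + M.actL a (M.d m) := by
  refine gr_induction A.internal
    (p := fun a => M.d (M.actL a m) = M.actL (A.d a) m + M.actL a (M.d m)) a (by simp) ?_ ?_
  · intro a b ha hb
    simp only [map_add, LinearMap.add_apply, ha, hb]; abel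
  · intro i x hx
    rw [M.leibnizL i x hx m, neg_smul2]

theorem DGBimod.leibR (M : DGBimod A) (m : M.V) (a : A.V) :
    M.d (M.actR m a) = M.actR (M.d m) a + M.actR m (A.d a) := by
  refine gr_induction M.internal
    (p := fun m => M.d (M.actR m a) = M.actR (M.d m) a + M.actR m (A.d a)) m (by simp) ?_ ?_
  · intro a b ha hb
    simp only [map_add, LinearMap.add_apply, ha, hb]; abel
  · intro i x hx
    rw [M.leibnizR i x hx a, neg_smul2]

end Leib
end Part1

section Part2
set_option linter.unusedVariables false
set_option linter.unusedSimpArgs false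
section BHoms

variable {A : DGA (ZMod 2)}

theorem IsBHom.grHom {M N : DGBimod A} {s : ℤ} {f : M.V →ₗ[ZMod 2] N.V} (h : IsBHom M N s f) :
    f ∈ grHomSub M N s := ⟨h.1, h.2.2.1, h.2.2.2⟩

theorem IsBHom.of_gr {M N : DGBimod A} {s : ℤ} {f : M.V →ₗ[ZMod 2] N.V}
    (h : f ∈ grHomSub M N s) (hd : ∀ x, f (M.d x) = N.d (f x)) : IsBHom M N s f :=
  ⟨h.1, hd, h.2.1, h.2.2⟩

theorem grHom_comp {M N P : DGBimod A} {s t : ℤ} {f : M.V →ₗ[ZMod 2] N.V}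
    {g : N.V →ₗ[ZMod 2] P.V} (hf : f ∈ grHomSub M N s) (hg : g ∈ grHomSub N P t) :
    g.comp f ∈ grHomSub M P (s + t) := by
  refine ⟨fun i x hx => ?_, fun a m => ?_, fun m a => ?_⟩
  · have := hg.1 _ _ (hf.1 i x hx)
    rw [← add_assoc]; exact this
  · simp only [LinearMap.comp_apply, hf.2.1, hg.2.1]
  · simp only [LinearMap.comp_apply, hf.2.2, hg.2.2]

theorem IsBHom.comp {M N P : DGBimod A} {s t : ℤ} {f : M.V →ₗ[ZMod 2] N.V}
    {g : N.V →ₗ[ZMod 2] P.V} (hg : IsBHom N P t g) (hf : IsBHom M N s f) :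
    IsBHom M P (s + t) (g.comp f) := by
  refine IsBHom.of_gr (grHom_comp hf.grHom hg.grHom) fun x => ?_
  simp only [LinearMap.comp_apply, hf.2.1, hg.2.1]

theorem mem_nullHtp {M N : DGBimod A} {s : ℤ} {f : M.V →ₗ[ZMod 2] N.V} :
    f ∈ nullHtpSub M N s ↔ ∃ h ∈ grHomSub M N (s + 1), ∀ x, f x = N.d (h x) + h (M.d x) := by
  constructor
  · rintro ⟨h, hh, rfl⟩
    exact ⟨h, hh, fun x => rfl⟩
  · rintro ⟨h, hh, hx⟩
    exact ⟨h, hh, LinearMap.ext fun x => (hx x).symm⟩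

theorem null_comp_left {M N P : DGBimod A} {s t u : ℤ} {f : M.V →ₗ[ZMod 2] N.V}
    {g : N.V →ₗ[ZMod 2] P.V} (hf : f ∈ nullHtpSub M N s) (hg : IsBHom N P t g)
    (hu : s + t = u) : g.comp f ∈ nullHtpSub M P u := by
  subst hu
  rw [mem_nullHtp] at hf ⊢
  obtain ⟨h, hh, hx⟩ := hf
  refine ⟨g.comp h, ?_, fun x => ?_⟩
  · have := grHom_comp hh hg.grHom
    rwa [show s + 1 + t = s + t + 1 by ring] at this
  · simp only [LinearMap.comp_apply, hx, map_add, hg.2.1]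

theorem null_comp_right {M N P : DGBimod A} {s t u : ℤ} {f : M.V →ₗ[ZMod 2] N.V}
    {g : N.V →ₗ[ZMod 2] P.V} (hf : IsBHom M N s f) (hg : g ∈ nullHtpSub N P t)
    (hu : s + t = u) : g.comp f ∈ nullHtpSub M P u := by
  subst hu
  rw [mem_nullHtp] at hg ⊢
  obtain ⟨h, hh, hx⟩ := hg
  refine ⟨h.comp f, ?_, fun x => ?_⟩
  · have := grHom_comp hf.grHom hh
    rwa [← add_assoc] at this
  · simp only [LinearMap.comp_apply, hx, map_add, hf.2.1]

end BHoms

section T2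

variable {A : DGA (ZMod 2)} (R M : DGBimod A)

theorem d2_tmul (r : R.V) (m : M.V) :
    d2 R M (r ⊗ₜ m) = R.d r ⊗ₜ m + r ⊗ₜ M.d m := by
  simp [d2]

theorem tmul_mem_gr2 {i j n : ℤ} {r : R.V} {m : M.V} (hr : r ∈ R.gr i) (hm : m ∈ M.gr j)
    (h : i + j = n) : r ⊗ₜ[ZMod 2] m ∈ gr2 R M n :=
  Submodule.subset_span ⟨i, j, r, hr, m, hm, h, rfl⟩

theorem gr2_le {n : ℤ} {P : Submodule (ZMod 2) (T2 R M)}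
    (h : ∀ i j, i + j = n → ∀ r ∈ R.gr i, ∀ m ∈ M.gr j, r ⊗ₜ[ZMod 2] m ∈ P) : gr2 R M n ≤ P := by
  refine Submodule.span_le.2 ?_
  rintro z ⟨i, j, r, hr, m, hm, hij, rfl⟩
  exact h i j hij r hr m hm

theorem internal_gr2 : DirectSum.IsInternal (gr2 R M) := by
  refine internal_of_dec (tdec R.internal M.internal) ?_ ?_
  · intro n x hx
    have : gr2 R M n ≤ LinearMap.eqLocus (tdec R.internal M.internal) (Finsupp.lsingle n) := by
      refine gr2_le R M ?_
      rintro i j rfl r hr m hm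
      simp [LinearMap.mem_eqLocus, tdec_tmul R.internal M.internal i j r hr m hm]
    exact this hx
  · refine tensor_span R.internal M.internal _ ?_
    intro i j x hx y hy
    exact Submodule.mem_iSup_of_mem (i + j) (tmul_mem_gr2 R M hx hy rfl)

theorem T2_induction {p : T2 R M → Prop} (x : T2 R M) (h0 : p 0)
    (hadd : ∀ x y, p x → p y → p (x + y)) (ht : ∀ r m, p (r ⊗ₜ m)) : p x :=
  TensorProduct.induction_on x h0 ht hadd

theorem d2_d2 (x : T2 R M) : d2 R M (d2 R M x) = 0 := by
  refine T2_induction R M (p := fun x => d2 R M (d2 R M x) = 0) x (by simp) ?_ ?_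
  · intro x y hx hy; simp [hx, hy]
  · intro r m
    simp [d2_tmul, R.d_d, M.d_d, ZModModule.add_self]

theorem d2_gr {n : ℤ} {x : T2 R M} (hx : x ∈ gr2 R M n) : d2 R M x ∈ gr2 R M (n - 1) := by
  have : gr2 R M n ≤ (gr2 R M (n - 1)).comap (d2 R M) := by
    refine gr2_le R M ?_
    rintro i j rfl r hr m hm
    rw [Submodule.mem_comap, d2_tmul]
    exact Submodule.add_mem _
      (tmul_mem_gr2 R M (R.d_gr i r hr) hm (by ring))
      (tmul_mem_gr2 R M hr (M.d_gr j m hm) (by ring))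
  exact this hx

theorem rel2_right (r : R.V) (a : A.V) (m : M.V) :
    (R.actR r a) ⊗ₜ[ZMod 2] m + r ⊗ₜ[ZMod 2] (M.actL a m) ∈ rel2 R M :=
  Submodule.subset_span (Or.inl ⟨r, a, m, rfl⟩)

theorem rel2_left (r : R.V) (a : A.V) (m : M.V) :
    (R.actL a r) ⊗ₜ[ZMod 2] m + r ⊗ₜ[ZMod 2] (M.actR m a) ∈ rel2 R M :=
  Submodule.subset_span (Or.inr ⟨r, a, m, rfl⟩)

theorem rel2_le {P : Submodule (ZMod 2) (T2 R M)}
    (h1 : ∀ r a m, (R.actR r a) ⊗ₜ[ZMod 2] m + r ⊗ₜ[ZMod 2] (M.actL a m) ∈ P)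
    (h2 : ∀ r a m, (R.actL a r) ⊗ₜ[ZMod 2] m + r ⊗ₜ[ZMod 2] (M.actR m a) ∈ P) :
    rel2 R M ≤ P := by
  refine Submodule.span_le.2 ?_
  rintro z (⟨r, a, m, rfl⟩ | ⟨r, a, m, rfl⟩)
  · exact h1 r a m
  · exact h2 r a m

theorem rel2_le_hom {P : Submodule (ZMod 2) (T2 R M)}
    (h1 : ∀ i j l, ∀ r ∈ R.gr i, ∀ a ∈ A.gr j, ∀ m ∈ M.gr l,
      (R.actR r a) ⊗ₜ[ZMod 2] m + r ⊗ₜ[ZMod 2] (M.actL a m) ∈ P)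
    (h2 : ∀ i j l, ∀ r ∈ R.gr i, ∀ a ∈ A.gr j, ∀ m ∈ M.gr l,
      (R.actL a r) ⊗ₜ[ZMod 2] m + r ⊗ₜ[ZMod 2] (M.actR m a) ∈ P) :
    rel2 R M ≤ P := by
  refine rel2_le R M ?_ ?_
  · intro r a m
    refine gr_induction R.internal (p := fun r => (R.actR r a) ⊗ₜ[ZMod 2] m +
      r ⊗ₜ[ZMod 2] (M.actL a m) ∈ P) r (by simp) ?_ ?_
    · intro x y hx hy
      convert P.add_mem hx hy using 1
      simp only [map_add, LinearMap.add_apply, add_tmul, tmul_add]; abel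
    intro i r hr
    refine gr_induction A.internal (p := fun a => (R.actR r a) ⊗ₜ[ZMod 2] m +
      r ⊗ₜ[ZMod 2] (M.actL a m) ∈ P) a (by simp) ?_ ?_
    · intro x y hx hy
      convert P.add_mem hx hy using 1
      simp only [map_add, LinearMap.add_apply, add_tmul, tmul_add]; abel
    intro j a ha
    refine gr_induction M.internal (p := fun m => (R.actR r a) ⊗ₜ[ZMod 2] m +
      r ⊗ₜ[ZMod 2] (M.actL a m) ∈ P) m (by simp) ?_ ?_
    · intro x y hx hy
      convert P.add_mem hx hy using 1
      simp only [map_add, LinearMap.add_apply, add_tmul, tmul_add]; abel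
    intro l m hm
    exact h1 i j l r hr a ha m hm
  · intro r a m
    refine gr_induction R.internal (p := fun r => (R.actL a r) ⊗ₜ[ZMod 2] m +
      r ⊗ₜ[ZMod 2] (M.actR m a) ∈ P) r (by simp) ?_ ?_
    · intro x y hx hy
      convert P.add_mem hx hy using 1
      simp only [map_add, LinearMap.add_apply, add_tmul, tmul_add]; abel
    intro i r hr
    refine gr_induction A.internal (p := fun a => (R.actL a r) ⊗ₜ[ZMod 2] m +
      r ⊗ₜ[ZMod 2] (M.actR m a) ∈ P) a (by simp) ?_ ?_
    · intro x y hx hy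
      convert P.add_mem hx hy using 1
      simp only [map_add, LinearMap.add_apply, add_tmul, tmul_add]; abel
    intro j a ha
    refine gr_induction M.internal (p := fun m => (R.actL a r) ⊗ₜ[ZMod 2] m +
      r ⊗ₜ[ZMod 2] (M.actR m a) ∈ P) m (by simp) ?_ ?_
    · intro x y hx hy
      convert P.add_mem hx hy using 1
      simp only [map_add, LinearMap.add_apply, add_tmul, tmul_add]; abel
    intro l m hm
    exact h2 i j l r hr a ha m hm

theorem d2_rel {x : T2 R M} (hx : x ∈ rel2 R M) : d2 R M x ∈ rel2 R M := by
  have : rel2 R M ≤ (rel2 R M).comap (d2 R M) := by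
    refine rel2_le R M ?_ ?_
    · intro r a m
      have h1 := rel2_right R M (R.d r) a m
      have h2 := rel2_right R M r (A.d a) m
      have h3 := rel2_right R M r a (M.d m)
      rw [Submodule.mem_comap]
      convert Submodule.add_mem _ (Submodule.add_mem _ h1 h2) h3 using 1
      simp only [map_add, d2_tmul, R.leibR, M.leibL, add_tmul, tmul_add]; abel
    · intro r a m
      have h1 := rel2_left R M (R.d r) a m
      have h2 := rel2_left R M r (A.d a) m
      have h3 := rel2_left R M r a (M.d m)
      rw [Submodule.mem_comap]
      convert Submodule.add_mem _ (Submodule.add_mem _ h1 h2) h3 using 1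
      simp only [map_add, d2_tmul, R.leibL, M.leibR, add_tmul, tmul_add]; abel
  exact this hx

/-- Projection to the degree `n` part. -/
def pr2 (n : ℤ) : T2 R M →ₗ[ZMod 2] T2 R M :=
  (Finsupp.lapply n).comp (dec (internal_gr2 R M))

theorem pr2_same {n : ℤ} {x : T2 R M} (hx : x ∈ gr2 R M n) : pr2 R M n x = x := by
  simp [pr2, dec_apply _ n x hx]

theorem pr2_ne {n j : ℤ} (hj : j ≠ n) {x : T2 R M} (hx : x ∈ gr2 R M j) : pr2 R M n x = 0 := by
  simp [pr2, dec_apply _ j x hx, hj]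

theorem pr2_rel (n : ℤ) {x : T2 R M} (hx : x ∈ rel2 R M) : pr2 R M n x ∈ rel2 R M := by
  have key : ∀ j, ∀ y ∈ gr2 R M j, y ∈ rel2 R M → y ∈ (rel2 R M).comap (pr2 R M n) := by
    intro j y hy hy'
    rw [Submodule.mem_comap]
    by_cases hj : j = n
    · subst hj; rwa [pr2_same R M hy]
    · rw [pr2_ne R M hj hy]; exact Submodule.zero_mem _
  have : rel2 R M ≤ (rel2 R M).comap (pr2 R M n) := by
    refine rel2_le_hom R M ?_ ?_
    · intro i j l r hr a ha m hm
      refine key (i + j + l) _ ?_ (rel2_right R M r a m)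
      exact Submodule.add_mem _ (tmul_mem_gr2 R M (R.actR_gr i j r hr a ha) hm rfl)
        (tmul_mem_gr2 R M hr (M.actL_gr j l a ha m hm) (by ring))
    · intro i j l r hr a ha m hm
      refine key (i + j + l) _ ?_ (rel2_left R M r a m)
      exact Submodule.add_mem _ (tmul_mem_gr2 R M (R.actL_gr j i a ha r hr) hm (by ring))
        (tmul_mem_gr2 R M hr (M.actR_gr l j m hm a ha) (by ring))
  exact this hx

end T2

section Functor

variable {A : DGA (ZMod 2)}

/-- Functoriality of `R ⊗ M` in `M`. -/
def lT (R : DGBimod A) {X Y : DGBimod A} (G : X.V →ₗ[ZMod 2] Y.V) : T2 R X →ₗ[ZMod 2] T2 R Y :=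
  LinearMap.lTensor R.V G

/-- Functoriality of `R ⊗ M` in `R`. -/
def rT {R S : DGBimod A} (G : R.V →ₗ[ZMod 2] S.V) (X : DGBimod A) : T2 R X →ₗ[ZMod 2] T2 S X :=
  LinearMap.rTensor X.V G

variable {R S X Y : DGBimod A}

@[simp] theorem lT_tmul (G : X.V →ₗ[ZMod 2] Y.V) (r : R.V) (x : X.V) :
    lT R G (r ⊗ₜ x) = r ⊗ₜ G x := rfl

@[simp] theorem rT_tmul (G : R.V →ₗ[ZMod 2] S.V) (r : R.V) (x : X.V) :
    rT G X (r ⊗ₜ x) = G r ⊗ₜ x := rfl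

theorem lT_gr {G : X.V →ₗ[ZMod 2] Y.V} {s : ℤ} (hG : G ∈ grHomSub X Y s) {n n' : ℤ}
    (hn : n + s = n') {x : T2 R X} (hx : x ∈ gr2 R X n) : lT R G x ∈ gr2 R Y n' := by
  have : gr2 R X n ≤ (gr2 R Y n').comap (lT R G) := by
    refine gr2_le R X ?_
    rintro i j rfl r hr m hm
    rw [Submodule.mem_comap, lT_tmul]
    exact tmul_mem_gr2 R Y hr (hG.1 j m hm) (by rw [← hn]; ring)
  exact this hx

theorem rT_gr {G : R.V →ₗ[ZMod 2] S.V} {s : ℤ} (hG : G ∈ grHomSub R S s) {n n' : ℤ}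
    (hn : n + s = n') {x : T2 R X} (hx : x ∈ gr2 R X n) : rT G X x ∈ gr2 S X n' := by
  have : gr2 R X n ≤ (gr2 S X n').comap (rT G X) := by
    refine gr2_le R X ?_
    rintro i j rfl r hr m hm
    rw [Submodule.mem_comap, rT_tmul]
    exact tmul_mem_gr2 S X (hG.1 i r hr) hm (by rw [← hn]; ring)
  exact this hx

theorem lT_rel {G : X.V →ₗ[ZMod 2] Y.V} {s : ℤ} (hG : G ∈ grHomSub X Y s)
    {x : T2 R X} (hx : x ∈ rel2 R X) : lT R G x ∈ rel2 R Y := by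
  have : rel2 R X ≤ (rel2 R Y).comap (lT R G) := by
    refine rel2_le R X ?_ ?_
    · intro r a m
      simp only [Submodule.mem_comap, map_add, lT_tmul, hG.2.1]
      exact rel2_right R Y r a _
    · intro r a m
      simp only [Submodule.mem_comap, map_add, lT_tmul, hG.2.2]
      exact rel2_left R Y r a _
  exact this hx

theorem rT_rel {G : R.V →ₗ[ZMod 2] S.V} {s : ℤ} (hG : G ∈ grHomSub R S s)
    {x : T2 R X} (hx : x ∈ rel2 R X) : rT G X x ∈ rel2 S X := by
  have : rel2 R X ≤ (rel2 S X).comap (rT G X) := by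
    refine rel2_le R X ?_ ?_
    · intro r a m
      simp only [Submodule.mem_comap, map_add, rT_tmul, hG.2.2]
      exact rel2_right S X _ a _
    · intro r a m
      simp only [Submodule.mem_comap, map_add, rT_tmul, hG.2.1]
      exact rel2_left S X _ a _
  exact this hx

theorem lT_d {G : X.V →ₗ[ZMod 2] Y.V} (hG : ∀ x, G (X.d x) = Y.d (G x)) (x : T2 R X) :
    lT R G (d2 R X x) = d2 R Y (lT R G x) := by
  refine T2_induction R X (p := fun x => lT R G (d2 R X x) = d2 R Y (lT R G x)) x (by simp) ?_ ?_
  · intro x y hx hy; simp [hx, hy]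
  · intro r m; simp [d2_tmul, hG]

theorem rT_d {G : R.V →ₗ[ZMod 2] S.V} (hG : ∀ x, G (R.d x) = S.d (G x)) (x : T2 R X) :
    rT G X (d2 R X x) = d2 S X (rT G X x) := by
  refine T2_induction R X (p := fun x => rT G X (d2 R X x) = d2 S X (rT G X x)) x (by simp) ?_ ?_
  · intro x y hx hy; simp [hx, hy]
  · intro r m; simp [d2_tmul, hG]

/-- A homotopy in the second variable. -/
theorem lT_htpy {F H : X.V →ₗ[ZMod 2] Y.V} (hF : ∀ x, F x = Y.d (H x) + H (X.d x)) (x : T2 R X) :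
    lT R F x = d2 R Y (lT R H x) + lT R H (d2 R X x) := by
  refine T2_induction R X
    (p := fun x => lT R F x = d2 R Y (lT R H x) + lT R H (d2 R X x)) x (by simp) ?_ ?_
  · intro x y hx hy; simp only [map_add, hx, hy]; abel
  · intro r m
    simp only [lT_tmul, hF, d2_tmul, map_add, tmul_add]
    have := ZModModule.add_self (R.d r ⊗ₜ[ZMod 2] H m)
    rw [add_comm (R.d r ⊗ₜ[ZMod 2] H m), add_assoc, add_add_self2]

/-- A homotopy in the first variable. -/
theorem rT_htpy {F H : R.V →ₗ[ZMod 2] S.V} (hF : ∀ x, F x = S.d (H x) + H (R.d x)) (x : T2 R X) :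
    rT F X x = d2 S X (rT H X x) + rT H X (d2 R X x) := by
  refine T2_induction R X
    (p := fun x => rT F X x = d2 S X (rT H X x) + rT H X (d2 R X x)) x (by simp) ?_ ?_
  · intro x y hx hy; simp only [map_add, hx, hy]; abel
  · intro r m
    simp only [rT_tmul, hF, d2_tmul, map_add, add_tmul]
    have := ZModModule.add_self (H r ⊗ₜ[ZMod 2] X.d m)
    rw [add_assoc, add_comm (H (R.d r) ⊗ₜ[ZMod 2] m), ← add_assoc (H r ⊗ₜ[ZMod 2] X.d m), this,
      zero_add]

end Functor
end Part2

section Part3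
set_option linter.unusedVariables false
set_option linter.unusedSimpArgs false
section Char2
variable {V : Type} [AddCommGroup V] [Module (ZMod 2) V]

theorem nsmul2 (x : V) : (2:ℕ) • x = 0 := by
  rw [two_nsmul, ZModModule.add_self]
theorem zsmul2 (x : V) : (2:ℤ) • x = 0 := by
  rw [two_zsmul, ZModModule.add_self]
theorem zsmul4 (x : V) : (4:ℤ) • x = 0 := by
  rw [show (4:ℤ) = 2 * 2 by norm_num, mul_smul, zsmul2]
theorem zsmul3 (x : V) : (3:ℤ) • x = x := by
  rw [show (3:ℤ) = 2 + 1 by norm_num, add_smul, zsmul2, one_smul, zero_add]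

end Char2

section Builder

variable {A : DGA (ZMod 2)}

/-- Build a dg bimodule as the sum of the homogeneous parts of an ambient space. -/
def mkBimod (H : Type) [AddCommGroup H] [Module (ZMod 2) H] (gr : ℤ → Submodule (ZMod 2) H)
    (hind : iSupIndep gr) (d : H →ₗ[ZMod 2] H) (aL : A.V →ₗ[ZMod 2] H →ₗ[ZMod 2] H)
    (aR : H →ₗ[ZMod 2] A.V →ₗ[ZMod 2] H)
    (d_d : ∀ x, d (d x) = 0) (d_gr : ∀ i, ∀ x ∈ gr i, d x ∈ gr (i - 1))
    (actL_one : ∀ m, aL A.one m = m) (actR_one : ∀ m, aR m A.one = m)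
    (actL_mul : ∀ a b m, aL (A.mul a b) m = aL a (aL b m))
    (actR_mul : ∀ m a b, aR (aR m a) b = aR m (A.mul a b))
    (actLR : ∀ a m b, aR (aL a m) b = aL a (aR m b))
    (actL_gr : ∀ i j, ∀ a ∈ A.gr i, ∀ m ∈ gr j, aL a m ∈ gr (i + j))
    (actR_gr : ∀ i j, ∀ m ∈ gr i, ∀ a ∈ A.gr j, aR m a ∈ gr (i + j))
    (leibnizL : ∀ a m, d (aL a m) = aL (A.d a) m + aL a (d m))
    (leibnizR : ∀ m a, d (aR m a) = aR (d m) a + aR m (A.d a)) : DGBimod A :=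
  have hd : ∀ x ∈ ⨆ s, gr s, d x ∈ ⨆ s, gr s := fun x hx =>
    Submodule.iSup_induction gr (motive := fun x => d x ∈ ⨆ s, gr s) hx
      (fun i x hx => Submodule.mem_iSup_of_mem (i - 1) (d_gr i x hx)) (by simp)
      (fun x y hx hy => by rw [map_add]; exact Submodule.add_mem _ hx hy)
  have hL : ∀ a, ∀ x ∈ ⨆ s, gr s, aL a x ∈ ⨆ s, gr s := fun a x hx =>
    Submodule.iSup_induction gr (motive := fun x => aL a x ∈ ⨆ s, gr s) hx
      (fun i x hx => gr_induction A.internal (p := fun a => aL a x ∈ ⨆ s, gr s) a (by simp)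
        (fun a b ha hb => by simpa using Submodule.add_mem _ ha hb)
        (fun j a ha => Submodule.mem_iSup_of_mem _ (actL_gr j i a ha x hx))) (by simp)
      (fun x y hx hy => by rw [map_add]; exact Submodule.add_mem _ hx hy)
  have hR : ∀ a, ∀ x ∈ ⨆ s, gr s, aR x a ∈ ⨆ s, gr s := fun a x hx =>
    Submodule.iSup_induction gr (motive := fun x => aR x a ∈ ⨆ s, gr s) hx
      (fun i x hx => gr_induction A.internal (p := fun a => aR x a ∈ ⨆ s, gr s) a (by simp)
        (fun a b ha hb => by simpa using Submodule.add_mem _ ha hb)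
        (fun j a ha => Submodule.mem_iSup_of_mem _ (actR_gr i j x hx a ha))) (by simp)
      (fun x y hx hy => by simpa using Submodule.add_mem _ hx hy)
  { V := ↥(⨆ s, gr s)
    gr := fun s => (gr s).comap (⨆ s, gr s).subtype
    internal := by
      rw [DirectSum.isInternal_submodule_iff_iSupIndep_and_iSup_eq_top]
      constructor
      · rw [iSupIndep_def]
        intro i
        rw [Submodule.disjoint_def]
        intro x hx hx'
        have h1 := (Submodule.disjoint_def.1 (iSupIndep_def.1 hind i)) x.1 hx
        apply Subtype.ext
        apply h1
        have h2 : (⨆ j, ⨆ (_ : j ≠ i), (gr j).comap (⨆ s, gr s).subtype) ≤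
            (⨆ j, ⨆ (_ : j ≠ i), gr j).comap (⨆ s, gr s).subtype := by
          refine iSup_le fun j => iSup_le fun hj => ?_
          exact Submodule.comap_mono (le_iSup₂_of_le j hj le_rfl)
        exact h2 hx'
      · rw [eq_top_iff]
        rintro ⟨x, hx⟩ -
        refine Submodule.iSup_induction' gr (motive := fun x hx =>
          (⟨x, hx⟩ : ↥(⨆ s, gr s)) ∈ ⨆ j, (gr j).comap (⨆ s, gr s).subtype) ?_ ?_ ?_ hx
        · intro i x hx
          exact Submodule.mem_iSup_of_mem i (by simpa using hx)
        · exact Submodule.zero_mem _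
        · intro x y hx hy h1 h2
          exact Submodule.add_mem _ h1 h2
    d := d.restrict hd
    d_d := fun x => Subtype.ext (d_d x.1)
    d_gr := fun i x hx => d_gr i x.1 hx
    actL := LinearMap.mk₂ (ZMod 2) (fun a m => ⟨aL a m.1, hL a m.1 m.2⟩)
      (fun a b m => Subtype.ext (by simp)) (fun c a m => Subtype.ext (by simp))
      (fun a b m => Subtype.ext (by simp)) (fun c a m => Subtype.ext (by simp))
    actR := LinearMap.mk₂ (ZMod 2) (fun m a => ⟨aR m.1 a, hR a m.1 m.2⟩)
      (fun a b m => Subtype.ext (by simp)) (fun c a m => Subtype.ext (by simp))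
      (fun a b m => Subtype.ext (by simp)) (fun c a m => Subtype.ext (by simp))
    actL_one := fun m => Subtype.ext (actL_one m.1)
    actR_one := fun m => Subtype.ext (actR_one m.1)
    actL_mul := fun a b m => Subtype.ext (actL_mul a b m.1)
    actR_mul := fun m a b => Subtype.ext (actR_mul m.1 a b)
    actLR := fun a m b => Subtype.ext (actLR a m.1 b)
    actL_gr := fun i j a ha m hm => actL_gr i j a ha m.1 hm
    actR_gr := fun i j m hm a ha => actR_gr i j m.1 hm a ha
    leibnizL := fun i a ha m => by
      rw [neg_smul2]; exact Subtype.ext (leibnizL a m.1)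
    leibnizR := fun i m hm a => by
      rw [neg_smul2]; exact Subtype.ext (leibnizR m.1 a) }

/-- Homogeneous maps of different degrees are independent. -/
theorem indep_of_degree {V W : Type} [AddCommGroup V] [Module (ZMod 2) V]
    [AddCommGroup W] [Module (ZMod 2) W]
    {gv : ℤ → Submodule (ZMod 2) V} (hv : DirectSum.IsInternal gv)
    {gw : ℤ → Submodule (ZMod 2) W} (hw : iSupIndep gw)
    (G : ℤ → Submodule (ZMod 2) (V →ₗ[ZMod 2] W))
    (hG : ∀ s, ∀ f ∈ G s, ∀ i, ∀ x ∈ gv i, f x ∈ gw (i + s)) : iSupIndep G := by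
  rw [iSupIndep_def]
  intro s
  rw [Submodule.disjoint_def]
  intro f hf hf'
  apply gr_ext hv
  intro i x hx
  have h1 := (Submodule.disjoint_def.1 (iSupIndep_def.1 hw (i + s))) (f x) (hG s f hf i x hx)
  rw [LinearMap.zero_apply]
  apply h1
  have h2 : (⨆ j, ⨆ (_ : j ≠ s), G j) ≤
      (⨆ j, ⨆ (_ : j ≠ i + s), gw j).comap (LinearMap.applyₗ x) := by
    refine iSup_le fun j => iSup_le fun hj => ?_
    intro g hg
    rw [Submodule.mem_comap]
    have : i + j ≠ i + s := by intro h; exact hj (by linarith)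
    exact Submodule.mem_iSup_of_mem _ (Submodule.mem_iSup_of_mem this (hG j g hg i x hx))
  exact h2 hf'

end Builder

section Dual

variable {A : DGA (ZMod 2)}

/-- The trivial grading on the ground field. -/
def gr0 (n : ℤ) : Submodule (ZMod 2) (ZMod 2) := if n = 0 then ⊤ else ⊥

theorem gr0_indep : iSupIndep gr0 := by
  rw [iSupIndep_def]
  intro i
  by_cases hi : i = 0
  · rw [disjoint_iff]
    have : (⨆ j, ⨆ (_ : j ≠ i), gr0 j) = ⊥ := by
      rw [eq_bot_iff]
      refine iSup_le fun j => iSup_le fun hj => ?_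
      rw [gr0, if_neg (by rw [← hi]; exact hj)]
    rw [this, inf_bot_eq]
  · rw [gr0, if_neg hi]; exact disjoint_bot_left

/-- Functionals of degree `s`: vanish on `X_i` for `i ≠ -s`. -/
def grD (X : DGBimod A) (s : ℤ) : Submodule (ZMod 2) (X.V →ₗ[ZMod 2] ZMod 2) where
  carrier := {f | ∀ i, i + s ≠ 0 → ∀ x ∈ X.gr i, f x = 0}
  add_mem' := fun {f g} hf hg i hi x hx => by simp [hf i hi x hx, hg i hi x hx]
  zero_mem' := fun i hi x hx => rfl
  smul_mem' := fun c f hf i hi x hx => by simp [hf i hi x hx]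

theorem mem_grD {X : DGBimod A} {s : ℤ} {f : X.V →ₗ[ZMod 2] ZMod 2} :
    f ∈ grD X s ↔ ∀ i, i + s ≠ 0 → ∀ x ∈ X.gr i, f x = 0 := Iff.rfl

/-- The linear dual of a dg bimodule. -/
def dual (X : DGBimod A) : DGBimod A :=
  mkBimod (A := A) (X.V →ₗ[ZMod 2] ZMod 2) (grD X)
    (indep_of_degree X.internal gr0_indep (grD X) (by
      intro s f hf i x hx
      unfold gr0
      split_ifs with h
      · trivial
      · rw [hf i h x hx]; simp))
    (LinearMap.lcomp (ZMod 2) (ZMod 2) X.d)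
    (LinearMap.mk₂ (ZMod 2) (fun a f => f.comp (X.actR.flip a))
      (fun a b f => by ext x; simp) (fun c a f => by ext x; simp)
      (fun a b f => by ext x; simp) (fun c a f => by ext x; simp))
    (LinearMap.mk₂ (ZMod 2) (fun f a => f.comp (X.actL a))
      (fun a b f => by ext x; simp) (fun c a f => by ext x; simp)
      (fun a b f => by ext x; simp) (fun c a f => by ext x; simp))
    (fun f => by ext x; simp [X.d_d])
    (fun s f hf i hi x hx => hf (i - 1) (by intro h; apply hi; linarith) _ (X.d_gr i x hx))
    (fun f => by ext x; simp [X.actR_one])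
    (fun f => by ext x; simp [X.actL_one])
    (fun a b f => by ext x; simp [X.actR_mul])
    (fun f a b => by ext x; simp [X.actL_mul])
    (fun a f b => by ext x; simp [X.actLR])
    (fun p q a ha f hf i hi x hx =>
      hf (i + p) (by intro h; apply hi; linarith) _ (X.actR_gr i p x hx a ha))
    (fun p q f hf a ha i hi x hx =>
      hf (q + i) (by intro h; apply hi; linarith) _ (X.actL_gr q i a ha x hx))
    (fun a f => by
      ext x
      simp only [LinearMap.lcomp_apply, LinearMap.mk₂_apply, LinearMap.comp_apply,
        LinearMap.flip_apply, LinearMap.add_apply, X.leibR, map_add]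
      rw [add_left_comm, ZModModule.add_self, add_zero])
    (fun f a => by
      ext x
      simp only [LinearMap.lcomp_apply, LinearMap.mk₂_apply, LinearMap.comp_apply,
        LinearMap.flip_apply, LinearMap.add_apply, X.leibL, map_add]
      rw [add_right_comm, ZModModule.add_self, zero_add])

/-- The functional underlying an element of the dual. -/
def dval (X : DGBimod A) : (dual X).V →ₗ[ZMod 2] X.V →ₗ[ZMod 2] ZMod 2 :=
  (⨆ s, grD X s).subtype

theorem dval_inj (X : DGBimod A) {f g : (dual X).V} (h : ∀ x, dval X f x = dval X g x) : f = g :=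
  Subtype.ext (LinearMap.ext h)

theorem dval_d (X : DGBimod A) (f : (dual X).V) (x : X.V) :
    dval X ((dual X).d f) x = dval X f (X.d x) := rfl

theorem dval_actL (X : DGBimod A) (a : A.V) (f : (dual X).V) (x : X.V) :
    dval X ((dual X).actL a f) x = dval X f (X.actR x a) := rfl

theorem dval_actR (X : DGBimod A) (a : A.V) (f : (dual X).V) (x : X.V) :
    dval X ((dual X).actR f a) x = dval X f (X.actL a x) := rfl

theorem dval_gr (X : DGBimod A) (s : ℤ) (f : (dual X).V) :
    f ∈ (dual X).gr s ↔ ∀ i, i + s ≠ 0 → ∀ x ∈ X.gr i, dval X f x = 0 := Iff.rfl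

/-- A homogeneous functional as an element of the dual. -/
def toDual (X : DGBimod A) (s : ℤ) (f : X.V →ₗ[ZMod 2] ZMod 2) (hf : f ∈ grD X s) : (dual X).V :=
  ⟨f, Submodule.mem_iSup_of_mem s hf⟩

theorem dval_toDual (X : DGBimod A) (s : ℤ) (f : X.V →ₗ[ZMod 2] ZMod 2) (hf : f ∈ grD X s) :
    dval X (toDual X s f hf) = f := rfl

theorem dval_mem (X : DGBimod A) (f : X.V →ₗ[ZMod 2] ZMod 2) (hf : f ∈ ⨆ s, grD X s) :
    ∃ g : (dual X).V, dval X g = f := ⟨⟨f, hf⟩, rfl⟩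

end Dual
end Part3

section Part4
set_option linter.unusedVariables false
set_option linter.unusedSimpArgs false
section Cone

variable {A : DGA (ZMod 2)} {X Y : DGBimod A}

/-- The mapping cone of a degree zero chain map. -/
def cone (ψ : X.V →ₗ[ZMod 2] Y.V) (hψ : IsBHom X Y 0 ψ) : DGBimod A where
  V := Y.V × X.V
  gr := fun n => (Y.gr n).prod (X.gr (n - 1))
  internal := by
    refine internal_of_dec
      (((Finsupp.mapRange.linearMap (LinearMap.inl (ZMod 2) Y.V X.V)).comp
          ((dec Y.internal).comp (LinearMap.fst (ZMod 2) Y.V X.V))) +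
        (((Finsupp.lmapDomain (Y.V × X.V) (ZMod 2) (fun j : ℤ => j + 1)).comp
          (Finsupp.mapRange.linearMap (LinearMap.inr (ZMod 2) Y.V X.V))).comp
          ((dec X.internal).comp (LinearMap.snd (ZMod 2) Y.V X.V)))) ?_ ?_
    · rintro n ⟨y, x⟩ ⟨hy, hx⟩
      simp only [LinearMap.add_apply, LinearMap.comp_apply, LinearMap.fst_apply,
        LinearMap.snd_apply, dec_apply Y.internal n y hy, dec_apply X.internal (n - 1) x hx]
      simp [Finsupp.mapDomain_single, ← Finsupp.single_add]
    · rw [eq_top_iff]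
      rintro ⟨y, x⟩ -
      have h1 : (y, (0 : X.V)) ∈ ⨆ n, (Y.gr n).prod (X.gr (n - 1)) := by
        refine gr_induction Y.internal
          (p := fun y => (y, (0 : X.V)) ∈ ⨆ n, (Y.gr n).prod (X.gr (n - 1))) y
          (Submodule.zero_mem _) ?_ ?_
        · intro a b ha hb
          simpa using Submodule.add_mem _ ha hb
        · intro i a ha
          exact Submodule.mem_iSup_of_mem i ⟨ha, Submodule.zero_mem _⟩
      have h2 : ((0 : Y.V), x) ∈ ⨆ n, (Y.gr n).prod (X.gr (n - 1)) := by
        refine gr_induction X.internal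
          (p := fun x => ((0 : Y.V), x) ∈ ⨆ n, (Y.gr n).prod (X.gr (n - 1))) x
          (Submodule.zero_mem _) ?_ ?_
        · intro a b ha hb
          simpa using Submodule.add_mem _ ha hb
        · intro i a ha
          refine Submodule.mem_iSup_of_mem (i + 1) ⟨Submodule.zero_mem _, ?_⟩
          simpa using ha
      simpa using Submodule.add_mem _ h1 h2
  d := LinearMap.prod (Y.d.coprod ψ) (X.d.comp (LinearMap.snd (ZMod 2) Y.V X.V))
  d_d := by
    rintro ⟨y, x⟩
    simp [Y.d_d, X.d_d, hψ.2.1, ZModModule.add_self]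
  d_gr := by
    rintro i ⟨y, x⟩ ⟨hy, hx⟩
    refine ⟨?_, ?_⟩
    · have := hψ.1 _ _ hx
      rw [add_zero] at this
      exact Submodule.add_mem _ (Y.d_gr i y hy) this
    · exact X.d_gr _ x hx
  actL := LinearMap.mk₂ (ZMod 2) (fun a p => (Y.actL a p.1, X.actL a p.2))
      (fun a b m => by simp) (fun c a m => by simp)
      (fun a b m => by simp) (fun c a m => by simp)
  actR := LinearMap.mk₂ (ZMod 2) (fun p a => (Y.actR p.1 a, X.actR p.2 a))
      (fun a b m => by simp) (fun c a m => by simp)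
      (fun a b m => by simp) (fun c a m => by simp)
  actL_one := fun m => by simp [Y.actL_one, X.actL_one]
  actR_one := fun m => by simp [Y.actR_one, X.actR_one]
  actL_mul := fun a b m => by simp [Y.actL_mul, X.actL_mul]
  actR_mul := fun a b m => by simp [Y.actR_mul, X.actR_mul]
  actLR := fun a b m => by simp [Y.actLR, X.actLR]
  actL_gr := by
    rintro i j a ha ⟨y, x⟩ ⟨hy, hx⟩
    refine ⟨Y.actL_gr i j a ha y hy, ?_⟩
    have := X.actL_gr i _ a ha x hx
    rwa [← add_sub_assoc] at this
  actR_gr := by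
    rintro i j ⟨y, x⟩ ⟨hy, hx⟩ a ha
    refine ⟨Y.actR_gr i j y hy a ha, ?_⟩
    have := X.actR_gr _ j x hx a ha
    rwa [show i - 1 + j = i + j - 1 by ring] at this
  leibnizL := by
    rintro i a ha ⟨y, x⟩
    rw [neg_smul2]
    simp [Y.leibL, X.leibL, hψ.2.2.1]
    abel
  leibnizR := by
    rintro i ⟨y, x⟩ hm a
    rw [neg_smul2]
    simp [Y.leibR, X.leibR, hψ.2.2.2]
    abel

variable (ψ : X.V →ₗ[ZMod 2] Y.V) (hψ : IsBHom X Y 0 ψ)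

theorem cone_d (y : Y.V) (x : X.V) :
    (cone ψ hψ).d ((y, x) : Y.V × X.V) = ((Y.d y + ψ x, X.d x) : Y.V × X.V) := rfl

theorem cone_actL (a : A.V) (y : Y.V) (x : X.V) :
    (cone ψ hψ).actL a ((y, x) : Y.V × X.V) = ((Y.actL a y, X.actL a x) : Y.V × X.V) := rfl

theorem cone_actR (a : A.V) (y : Y.V) (x : X.V) :
    (cone ψ hψ).actR ((y, x) : Y.V × X.V) a = ((Y.actR y a, X.actR x a) : Y.V × X.V) := rfl

theorem cone_gr (n : ℤ) (y : Y.V) (x : X.V) :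
    ((y, x) : Y.V × X.V) ∈ (cone ψ hψ).gr n ↔ y ∈ Y.gr n ∧ x ∈ X.gr (n - 1) := Iff.rfl

def cinl : Y.V →ₗ[ZMod 2] (cone ψ hψ).V := LinearMap.inl (ZMod 2) Y.V X.V
def cinr : X.V →ₗ[ZMod 2] (cone ψ hψ).V := LinearMap.inr (ZMod 2) Y.V X.V
def cfst : (cone ψ hψ).V →ₗ[ZMod 2] Y.V := LinearMap.fst (ZMod 2) Y.V X.V
def csnd : (cone ψ hψ).V →ₗ[ZMod 2] X.V := LinearMap.snd (ZMod 2) Y.V X.V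

theorem cinl_hom : IsBHom Y (cone ψ hψ) 0 (cinl ψ hψ) := by
  refine ⟨fun i x hx => ?_, fun x => ?_, fun a m => ?_, fun m a => ?_⟩
  · rw [add_zero]; exact ⟨hx, Submodule.zero_mem _⟩
  · show ((Y.d x, 0) : Y.V × X.V) = ((Y.d x + ψ 0, X.d 0) : Y.V × X.V)
    simp
  · show ((Y.actL a m, 0) : Y.V × X.V) = ((Y.actL a m, X.actL a 0) : Y.V × X.V)
    simp
  · show ((Y.actR m a, 0) : Y.V × X.V) = ((Y.actR m a, X.actR 0 a) : Y.V × X.V)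
    simp

theorem csnd_hom : IsBHom (cone ψ hψ) X (-1) (csnd ψ hψ) := by
  refine ⟨fun i x hx => hx.2, fun x => rfl, fun a m => rfl, fun m a => rfl⟩

theorem cfst_gr : cfst ψ hψ ∈ grHomSub (cone ψ hψ) Y 0 := by
  refine ⟨fun i x hx => ?_, fun a m => rfl, fun m a => rfl⟩
  rw [add_zero]; exact hx.1

theorem cinr_gr : cinr ψ hψ ∈ grHomSub X (cone ψ hψ) 1 := by
  refine ⟨fun i x hx => ?_, fun a m => ?_, fun m a => ?_⟩
  · refine ⟨Submodule.zero_mem _, ?_⟩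
    rw [add_sub_cancel_right]; exact hx
  · show ((0, X.actL a m) : Y.V × X.V) = ((Y.actL a 0, X.actL a m) : Y.V × X.V)
    simp
  · show ((0, X.actR m a) : Y.V × X.V) = ((Y.actR 0 a, X.actR m a) : Y.V × X.V)
    simp

theorem cinr_d (x : X.V) :
    (cone ψ hψ).d (cinr ψ hψ x) + cinr ψ hψ (X.d x) = cinl ψ hψ (ψ x) := by
  show ((Y.d 0 + ψ x, X.d x) : Y.V × X.V) + ((0, X.d x) : Y.V × X.V) = ((ψ x, 0) : Y.V × X.V)
  simp [ZModModule.add_self]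

theorem cone_eta (p : (cone ψ hψ).V) :
    p = cinl ψ hψ (cfst ψ hψ p) + cinr ψ hψ (csnd ψ hψ p) := by
  show (p : Y.V × X.V) = ((p.1, 0) : Y.V × X.V) + ((0, p.2) : Y.V × X.V)
  simp
  rfl

theorem cfst_d (p : (cone ψ hψ).V) :
    cfst ψ hψ ((cone ψ hψ).d p) = Y.d (cfst ψ hψ p) + ψ (csnd ψ hψ p) := rfl

/-- Every graded complex over a field splits. -/
def Acyc (Y : DGBimod A) : Prop := ∀ n, ∀ y ∈ Y.gr n, Y.d y = 0 → ∃ z ∈ Y.gr (n + 1), Y.d z = y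

theorem cone_acyc (hq : IsQIsoDeg X.V Y.V X.gr Y.gr X.d Y.d 0 ψ) : Acyc (cone ψ hψ) := by
  rintro n ⟨y, x⟩ ⟨hy, hx⟩ h
  have h1 : Y.d y + ψ x = 0 := congrArg Prod.fst h
  have h2 : X.d x = 0 := congrArg Prod.snd h
  -- `x` is a cycle whose image is a boundary
  obtain ⟨x', hx', hxx⟩ := (hq (n - 1)).2 x hx h2
    ⟨y, by rw [show n - 1 + 0 + 1 = n by ring]; exact hy, eq_of_add_eq_zero2 h1⟩
  rw [sub_add_cancel] at hx'
  have hc : Y.d (y + ψ x') = 0 := by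
    rw [map_add, ← hψ.2.1, hxx, h1]
  have hg : y + ψ x' ∈ Y.gr (n + 0) := by
    have := hψ.1 _ _ hx'
    rw [add_zero] at this ⊢
    exact Submodule.add_mem _ hy this
  obtain ⟨x0, hx0, hd0, y0, hy0, hyy⟩ := (hq n).1 _ hg hc
  refine ⟨((y0, x' + x0) : Y.V × X.V), ⟨by simpa using hy0, ?_⟩, ?_⟩
  · show x' + x0 ∈ X.gr (n + 1 - 1)
    rw [add_sub_cancel_right]; exact Submodule.add_mem _ hx' hx0
  · rw [cone_d]
    refine Prod.ext ?_ ?_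
    · show Y.d y0 + ψ (x' + x0) = y
      rw [hyy, map_add, ← sub_eq_zero]
      abel_nf
      simp [nsmul2, zsmul2]
    · show X.d (x' + x0) = x
      rw [map_add, hd0, add_zero, hxx]

end Cone
end Part4

section Part5
set_option linter.unusedVariables false
set_option linter.unusedSimpArgs false
section Contr

variable {A : DGA (ZMod 2)}

theorem pseudo_inv {V W : Type} [AddCommGroup V] [Module (ZMod 2) V]
    [AddCommGroup W] [Module (ZMod 2) W] (f : V →ₗ[ZMod 2] W) :
    ∃ e : W →ₗ[ZMod 2] V, ∀ v, f (e (f v)) = f v := by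
  obtain ⟨s, hs⟩ := f.rangeRestrict.exists_rightInverse_of_surjective
    (LinearMap.range_rangeRestrict f)
  obtain ⟨p, hp⟩ := (LinearMap.range f).subtype.exists_leftInverse_of_injective
    (Submodule.ker_subtype _)
  refine ⟨s.comp p, fun v => ?_⟩
  have h1 : p (f v) = f.rangeRestrict v := LinearMap.congr_fun hp (f.rangeRestrict v)
  have h2 : f.rangeRestrict (s (f.rangeRestrict v)) = f.rangeRestrict v :=
    LinearMap.congr_fun hs (f.rangeRestrict v)
  rw [LinearMap.comp_apply, h1]
  exact congrArg Subtype.val h2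

/-- Splitting a complex by a degree one map. -/
theorem exists_contr (Y : DGBimod A) (S : ℤ → Set Y.V)
    (hS : ∀ n, ∀ z ∈ Y.gr n, Y.d z = 0 → ∃ w ∈ S n, ∃ u ∈ Y.gr (n + 1), z = w + Y.d u) :
    ∃ σ T : Y.V →ₗ[ZMod 2] Y.V, (∀ n, ∀ y ∈ Y.gr n, σ y ∈ Y.gr (n + 1)) ∧
      ∀ n, ∀ y ∈ Y.gr n, ∃ w ∈ S n, y + Y.d (σ y) + σ (Y.d y) = T w := by
  have h0 : ∀ n, ∀ y ∈ Y.gr (n + 1), Y.d y ∈ Y.gr n := fun n y hy => by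
    have := Y.d_gr _ y hy
    rwa [add_sub_cancel_right] at this
  have h1 : ∀ n, ∃ e : Y.gr n →ₗ[ZMod 2] Y.gr (n + 1), ∀ u : Y.gr (n + 1),
      (Y.d (e ⟨Y.d u, h0 n u u.2⟩) : Y.V) = Y.d u := by
    intro n
    obtain ⟨e, he⟩ := pseudo_inv (Y.d.restrict (h0 n))
    exact ⟨e, fun u => congrArg Subtype.val (he u)⟩
  choose e he using h1
  let E : Y.V →ₗ[ZMod 2] Y.V := homLift Y.internal (fun n => (Y.gr (n + 1)).subtype.comp (e n))
  have hE : ∀ n, ∀ y ∈ Y.gr n, E y ∈ Y.gr (n + 1) := by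
    intro n y hy
    show homLift Y.internal _ y ∈ _
    rw [homLift_apply Y.internal _ n y hy]
    exact (e n ⟨y, hy⟩).2
  have hdE : ∀ n, ∀ u ∈ Y.gr (n + 1), Y.d (E (Y.d u)) = Y.d u := by
    intro n u hu
    show Y.d (homLift Y.internal _ (Y.d u)) = _
    rw [homLift_apply Y.internal _ n _ (h0 n u hu)]
    exact he n ⟨u, hu⟩
  refine ⟨E.comp (LinearMap.id + E.comp Y.d), LinearMap.id + Y.d.comp E, ?_, ?_⟩
  · intro n y hy
    have : E (Y.d y) ∈ Y.gr n := by
      have := hE _ _ (Y.d_gr n y hy)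
      rwa [sub_add_cancel] at this
    exact hE n _ (Submodule.add_mem _ hy this)
  · intro n y hy
    have h2 : E (Y.d y) ∈ Y.gr n := by
      have := hE _ _ (Y.d_gr n y hy)
      rwa [sub_add_cancel] at this
    have h3 : Y.d (E (Y.d y)) = Y.d y := hdE (n - 1) y (by rwa [sub_add_cancel])
    obtain ⟨w, hw, u, hu, hz⟩ := hS n (y + E (Y.d y)) (Submodule.add_mem _ hy h2)
      (by rw [map_add, h3, ZModModule.add_self])
    refine ⟨w, hw, ?_⟩
    have h4 := hdE n u hu
    have h5 : w = (y + E (Y.d y)) + Y.d u := by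
      rw [hz, add_assoc, ZModModule.add_self, add_zero]
    simp only [LinearMap.comp_apply, LinearMap.add_apply, LinearMap.id_apply, Y.d_d, map_zero,
      add_zero, h5, map_add, h4]
    rw [← sub_eq_zero]
    abel_nf
    simp [nsmul2, zsmul2]

/-- `Y` is homotopy equivalent (as a complex) to a degreewise finite one. -/
def FinContr (Y : DGBimod A) (σ : Y.V →ₗ[ZMod 2] Y.V) : Prop :=
  (∀ n, ∀ y ∈ Y.gr n, σ y ∈ Y.gr (n + 1)) ∧
  ∀ n, Set.Finite {z | ∃ y ∈ Y.gr n, z = y + Y.d (σ y) + σ (Y.d y)}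

def Contr (Y : DGBimod A) (σ : Y.V →ₗ[ZMod 2] Y.V) : Prop :=
  (∀ n, ∀ y ∈ Y.gr n, σ y ∈ Y.gr (n + 1)) ∧ ∀ y, Y.d (σ y) + σ (Y.d y) = y

theorem Acyc.contr {Y : DGBimod A} (h : Acyc Y) : ∃ σ, Contr Y σ := by
  obtain ⟨σ, T, h1, h2⟩ := exists_contr Y (fun _ => {0}) (by
    intro n z hz hd
    obtain ⟨u, hu, hz⟩ := h n z hz hd
    exact ⟨0, rfl, u, hu, by rw [zero_add, hz]⟩)
  refine ⟨σ, h1, ?_⟩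
  have : (Y.d.comp σ + σ.comp Y.d) = LinearMap.id := by
    apply gr_ext Y.internal
    intro n y hy
    obtain ⟨w, hw, h3⟩ := h2 n y hy
    rw [Set.mem_singleton_iff.1 hw, map_zero, add_assoc] at h3
    exact (eq_of_add_eq_zero2 h3).symm
  exact fun y => LinearMap.congr_fun this y

theorem finContr_of_fin {Y : DGBimod A} (S : ℤ → Set Y.V) (hfin : ∀ n, (S n).Finite)
    (hS : ∀ n, ∀ z ∈ Y.gr n, Y.d z = 0 → ∃ w ∈ S n, ∃ u ∈ Y.gr (n + 1), z = w + Y.d u) :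
    ∃ σ, FinContr Y σ := by
  obtain ⟨σ, T, h1, h2⟩ := exists_contr Y S hS
  refine ⟨σ, h1, fun n => ((hfin n).image T).subset ?_⟩
  rintro z ⟨y, hy, rfl⟩
  obtain ⟨w, hw, h3⟩ := h2 n y hy
  exact ⟨w, hw, h3.symm⟩

/-- The transpose of a degree one map. -/
theorem exists_transpose (X : DGBimod A) (σ : X.V →ₗ[ZMod 2] X.V)
    (hσ : ∀ n, ∀ y ∈ X.gr n, σ y ∈ X.gr (n + 1)) :
    ∃ σ' : (dual X).V →ₗ[ZMod 2] (dual X).V, (∀ f x, dval X (σ' f) x = dval X f (σ x)) ∧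
      ∀ n, ∀ y ∈ (dual X).gr n, σ' y ∈ (dual X).gr (n + 1) := by
  have hg : ∀ s, ∀ f ∈ grD X s, LinearMap.lcomp (ZMod 2) (ZMod 2) σ f ∈ grD X (s + 1) := by
    intro s f hf i hi x hx
    exact hf (i + 1) (by intro h; apply hi; linarith) _ (hσ i x hx)
  have : ∀ f ∈ ⨆ s, grD X s, LinearMap.lcomp (ZMod 2) (ZMod 2) σ f ∈ ⨆ s, grD X s := by
    intro f hf
    refine Submodule.iSup_induction (grD X)
      (motive := fun f => LinearMap.lcomp (ZMod 2) (ZMod 2) σ f ∈ ⨆ s, grD X s) hf ?_ (by simp) ?_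
    · intro s f hf
      exact Submodule.mem_iSup_of_mem (s + 1) (hg s f hf)
    · intro f g hf hg
      rw [map_add]; exact Submodule.add_mem _ hf hg
  exact ⟨(LinearMap.lcomp (ZMod 2) (ZMod 2) σ).restrict this, fun f x => rfl,
    fun n y hy => hg n y.1 hy⟩

theorem Contr.dual {X : DGBimod A} {σ : X.V →ₗ[ZMod 2] X.V} (h : Contr X σ) :
    ∃ σ', Contr (dual X) σ' := by
  obtain ⟨σ', h1, h2⟩ := exists_transpose X σ h.1
  refine ⟨σ', h2, fun f => dval_inj X fun x => ?_⟩
  rw [map_add, LinearMap.add_apply, h1, dval_d, dval_d, h1, ← map_add, add_comm, h.2]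

theorem FinContr.dual {X : DGBimod A} {σ : X.V →ₗ[ZMod 2] X.V} (h : FinContr X σ) :
    ∃ σ', FinContr (dual X) σ' := by
  obtain ⟨σ', h1, h2⟩ := exists_transpose X σ h.1
  refine ⟨σ', h2, fun n => ?_⟩
  set F := {z | ∃ y ∈ X.gr (-n), z = y + X.d (σ y) + σ (X.d y)} with hF
  have : Finite F := h.2 (-n)
  set G := {z | ∃ y ∈ (LT.dual X).gr n, z = y + (LT.dual X).d (σ' y) + σ' ((LT.dual X).d y)}
  have hval : ∀ (f : (LT.dual X).V) x, dval X (f + (LT.dual X).d (σ' f) + σ' ((LT.dual X).d f)) x =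
      dval X f (x + X.d (σ x) + σ (X.d x)) := by
    intro f x
    simp only [map_add, LinearMap.add_apply, dval_d, h1]
    abel
  have hG : ∀ z : G, ∃ y ∈ (LT.dual X).gr n,
      z.1 = y + (LT.dual X).d (σ' y) + σ' ((LT.dual X).d y) := fun z => z.2
  choose y hy hz using hG
  have hinj : Function.Injective (fun (z : G) (w : F) => dval X (y z) w.1) := by
    intro z z' hzz
    apply Subtype.ext
    have hgr : ∀ z : G, z.1 ∈ (LT.dual X).gr n := by
      intro z
      rw [hz z]
      refine Submodule.add_mem _ (Submodule.add_mem _ (hy z) ?_) ?_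
      · have := (LT.dual X).d_gr _ _ (h2 n _ (hy z)); rwa [add_sub_cancel_right] at this
      · have := h2 _ _ ((LT.dual X).d_gr _ _ (hy z)); rwa [sub_add_cancel] at this
    apply dval_inj
    intro x
    refine gr_induction X.internal (p := fun x => dval X z.1 x = dval X z'.1 x) x (by simp) ?_ ?_
    · intro a b ha hb; simp [ha, hb]
    intro i x hx
    by_cases hi : i + n = 0
    · have hi' : i = -n := by linarith
      subst hi'
      rw [hz z, hz z', hval, hval]
      exact congrFun hzz ⟨_, x, hx, rfl⟩
    · rw [(dval_gr X n z.1).1 (hgr z) i hi x hx, (dval_gr X n z'.1).1 (hgr z') i hi x hx]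
  have hf : Finite G := Finite.of_injective _ hinj
  exact hf

end Contr
end Part5

section Part6
set_option linter.unusedVariables false
set_option linter.unusedSimpArgs false
section Cell

variable {A : DGA (ZMod 2)}

theorem sandwichT_tmul (M : DGBimod A) (m : M.V) (a b : A.V) :
    sandwichT M m (a ⊗ₜ b) = M.actR (M.actL a m) b := by
  simp [sandwichT, sandwich]

theorem sandwichT_one (M : DGBimod A) (m : M.V) : sandwichT M m (A.one ⊗ₜ A.one) = m := by
  rw [sandwichT_tmul, M.actL_one, M.actR_one]

/-- A cell structure: a basis of generators with levels. -/
structure CB (C : DGBimod A) : Type 1 where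
  I : Type
  g : I → C.V
  deg : I → ℤ
  lev : I → ℕ
  g_gr : ∀ i, g i ∈ C.gr (deg i)
  bij : Function.Bijective
    (Finsupp.lsum (ZMod 2) (fun i => sandwichT C (g i)) : (I →₀ A.V ⊗[ZMod 2] A.V) →ₗ[ZMod 2] C.V)
  d_lev : ∀ i, C.d (g i) ∈ ⨆ (j : I) (_ : lev j < lev i), LinearMap.range (sandwichT C (g j))

theorem exists_CB_aux {C : DGBimod A} {Fil : ℕ → Submodule (ZMod 2) C.V}
    (h0 : Fil 0 = ⊥) (hmono : Monotone Fil) (hsup : (⨆ n, Fil n) = ⊤)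
    (hL : ∀ n a, ∀ x ∈ Fil n, C.actL a x ∈ Fil n)
    (hR : ∀ n a, ∀ x ∈ Fil n, C.actR x a ∈ Fil n)
    (I : ℕ → Type) (g : ∀ n, I n → C.V) (deg : ∀ n, I n → ℤ)
    (h1 : ∀ n i, g n i ∈ Fil (n + 1)) (h2 : ∀ n i, C.d (g n i) ∈ Fil n)
    (h3 : ∀ n i p q, ∀ a ∈ A.gr p, ∀ b ∈ A.gr q,
      C.actR (C.actL a (g n i)) b ∈ C.gr (p + q + deg n i))
    (h4 : ∀ n, Fil (n + 1) ≤ Fil n ⊔ (⨆ i, LinearMap.range (sandwichT C (g n i))))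
    (h5 : ∀ n (u : Finset (I n)) (c : I n → A.V ⊗[ZMod 2] A.V),
      (∑ i ∈ u, sandwichT C (g n i) (c i)) ∈ Fil n → ∀ i ∈ u, c i = 0) :
    ∃ cb : CB C, cb.I = Σ n, I n := by
  let G : (Σ n, I n) → C.V := fun i => g i.1 i.2
  have hsw : ∀ (i : Σ n, I n) c, sandwichT C (G i) c ∈ Fil (i.1 + 1) := by
    intro i c
    induction c using TensorProduct.induction_on with
    | zero => simp
    | tmul a b => rw [sandwichT_tmul]; exact hR _ _ _ (hL _ _ _ (h1 i.1 i.2))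
    | add x y hx hy => rw [map_add]; exact Submodule.add_mem _ hx hy
  have hFil : ∀ n, Fil n ≤ ⨆ (j : Σ n, I n) (_ : j.1 < n), LinearMap.range (sandwichT C (G j)) := by
    intro n
    induction n with
    | zero => rw [h0]; exact bot_le
    | succ n ih =>
      refine (h4 n).trans (sup_le (ih.trans ?_) ?_)
      · refine iSup_le fun j => iSup_le fun hj => ?_
        exact le_iSup₂_of_le j (by omega) le_rfl
      · refine iSup_le fun i => ?_
        exact le_iSup₂_of_le (⟨n, i⟩ : Σ n, I n) (by simp) le_rfl
  have hinj : ∀ n, ∀ c : (Σ n, I n) →₀ A.V ⊗[ZMod 2] A.V, (∀ i ∈ c.support, i.1 < n) →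
      Finsupp.lsum (ZMod 2) (fun i => sandwichT C (G i)) c = 0 → c = 0 := by
    classical
    intro n
    induction n with
    | zero =>
      intro c hc _
      ext i
      by_contra hi
      exact absurd (hc i (Finsupp.mem_support_iff.2 hi)) (by omega)
    | succ n ih =>
      intro c hc hs
      refine ih c ?_ hs
      intro i hi
      by_contra hin
      have hin' : i.1 = n := by have := hc i hi; omega
      rw [Finsupp.lsum_apply, Finsupp.sum,
        ← Finset.sum_filter_add_sum_filter_not c.support (fun j => j.1 = n)] at hs
      have hb : ∑ x ∈ c.support with ¬ x.1 = n, sandwichT C (G x) (c x) ∈ Fil n := by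
        refine Submodule.sum_mem _ fun j hj => ?_
        rw [Finset.mem_filter] at hj
        have := hc j hj.1
        exact hmono (by omega) (hsw j _)
      have ha : ∑ x ∈ c.support with x.1 = n, sandwichT C (G x) (c x) ∈ Fil n := by
        rw [eq_of_add_eq_zero2 hs]; exact hb
      have hinj' : Set.InjOn (Sigma.mk n : I n → Σ n, I n)
          ((Sigma.mk n) ⁻¹' ↑(c.support.filter (fun j => j.1 = n))) :=
        sigma_mk_injective.injOn
      rw [← Finset.sum_preimage (Sigma.mk n) _ hinj' (fun x => sandwichT C (G x) (c x))] at ha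
      · obtain ⟨n', i⟩ := i
        simp only at hin'
        subst hin'
        have := h5 n' _ (fun j => c ⟨n', j⟩) ha i (by
          simp only [Finset.mem_preimage, Finset.mem_filter]
          exact ⟨hi, trivial⟩)
        exact (Finsupp.mem_support_iff.1 hi) this
      · rintro ⟨n', j⟩ hx hx'
        exfalso
        apply hx'
        rw [Finset.mem_filter] at hx
        obtain ⟨_, rfl⟩ := hx
        exact ⟨j, rfl⟩
  refine ⟨⟨Σ n, I n, G, fun i => deg i.1 i.2, fun i => i.1, ?_, ⟨?_, ?_⟩, ?_⟩, rfl⟩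
  · intro i
    have := h3 i.1 i.2 0 0 A.one A.one_gr A.one A.one_gr
    rwa [C.actL_one, C.actR_one, zero_add, zero_add] at this
  · rw [← LinearMap.ker_eq_bot, LinearMap.ker_eq_bot']
    intro c hc
    refine hinj (c.support.sup (fun i => i.1) + 1) c ?_ hc
    intro i hi
    have := Finset.le_sup (f := fun i : Σ n, I n => i.1) hi
    exact Nat.lt_succ_of_le this
  · rw [← LinearMap.range_eq_top, eq_top_iff, ← hsup]
    refine iSup_le fun n => (hFil n).trans (iSup_le fun j => iSup_le fun _ => ?_)
    rintro _ ⟨c, rfl⟩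
    exact ⟨Finsupp.single j c, by simp⟩
  · intro i
    exact hFil i.1 (h2 i.1 i.2)

theorem exists_CB {C : DGBimod A} (h : IsCellBimod C) : Nonempty (CB C) := by
  obtain ⟨Fil, h0, hmono, hsup, hd, hL, hR, hst⟩ := h
  choose I g deg h1 h2 h3 h4 h5 using hst
  obtain ⟨cb, -⟩ := exists_CB_aux h0 hmono hsup hL hR I g deg h1 h2 h3 h4 h5
  exact ⟨cb⟩

theorem exists_CB_fin {C : DGBimod A} (h : IsFiniteCellBimod C) :
    ∃ cb : CB C, Finite cb.I := by
  obtain ⟨Fil, ⟨h0, hmono, hsup, hd, hL, hR, hst⟩, n₀, hn₀⟩ := h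
  choose I hfin g deg h1 h2 h3 h4 h5 using hst
  obtain ⟨cb, hcb⟩ := exists_CB_aux h0 hmono hsup hL hR I g deg h1 h2 h3 h4 h5
  by_cases hA : Subsingleton (A.V ⊗[ZMod 2] A.V)
  · have hs : Subsingleton C.V := cb.bij.2.subsingleton
    refine ⟨⟨Empty, fun i => 0, fun i => 0, fun i => 0, fun i => i.elim, ?_, fun i => i.elim⟩,
      inferInstance⟩
    exact ⟨fun x y _ => Subsingleton.elim _ _, fun y => ⟨0, Subsingleton.elim _ _⟩⟩
  · refine ⟨cb, ?_⟩
    rw [not_subsingleton_iff_nontrivial] at hA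
    obtain ⟨c, hc⟩ := exists_ne (0 : A.V ⊗[ZMod 2] A.V)
    rw [hcb]
    have hempty : ∀ n, I n → n < n₀ := by
      intro n i
      by_contra hn
      push Not at hn
      refine hc (h5 n {i} (fun _ => c) ?_ i (by simp))
      have : Fil n = ⊤ := by rw [eq_top_iff, ← hn₀]; exact hmono hn
      rw [this]; trivial
    have : Finite (Σ n : Fin n₀, I n) := inferInstance
    exact Finite.of_injective (fun i : Σ n, I n => (⟨⟨i.1, hempty i.1 i.2⟩, i.2⟩ : Σ n : Fin n₀, I n))
      (by
        rintro ⟨n, i⟩ ⟨m, j⟩ h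
        simp only [Sigma.mk.injEq, Fin.mk.injEq] at h
        obtain ⟨rfl, h⟩ := h
        rw [eq_of_heq h])

namespace CB

variable {C : DGBimod A} (cb : CB C)

/-- The coordinates. -/
def eqv : (cb.I →₀ A.V ⊗[ZMod 2] A.V) ≃ₗ[ZMod 2] C.V := LinearEquiv.ofBijective _ cb.bij

theorem eqv_single (i : cb.I) (c : A.V ⊗[ZMod 2] A.V) :
    cb.eqv (Finsupp.single i c) = sandwichT C (cb.g i) c := by
  simp [eqv]

theorem eqv_symm (i : cb.I) (a b : A.V) :
    cb.eqv.symm (C.actR (C.actL a (cb.g i)) b) = Finsupp.single i (a ⊗ₜ b) := by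
  rw [LinearEquiv.symm_apply_eq, eqv_single, sandwichT_tmul]

theorem induction {p : C.V → Prop} (x : C.V) (h0 : p 0) (hadd : ∀ x y, p x → p y → p (x + y))
    (hg : ∀ i a b, p (C.actR (C.actL a (cb.g i)) b)) : p x := by
  obtain ⟨c, rfl⟩ := cb.eqv.surjective x
  induction c using Finsupp.induction_linear with
  | zero => simpa using h0
  | add f g hf hg => rw [map_add]; exact hadd _ _ hf hg
  | single i c =>
    rw [eqv_single]
    induction c using TensorProduct.induction_on with
    | zero => simpa using h0
    | tmul a b => rw [sandwichT_tmul]; exact hg i a b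
    | add x y hx hy => rw [map_add]; exact hadd _ _ hx hy

theorem span_eq : Submodule.span (ZMod 2) {x | ∃ i p q, ∃ a ∈ A.gr p, ∃ b ∈ A.gr q,
    x = C.actR (C.actL a (cb.g i)) b} = ⊤ := by
  rw [eq_top_iff]
  rintro x -
  refine cb.induction (p := fun x => x ∈ _) x (Submodule.zero_mem _)
    (fun x y hx hy => Submodule.add_mem _ hx hy) ?_
  intro i a b
  refine gr_induction A.internal (p := fun a => C.actR (C.actL a (cb.g i)) b ∈ _) a
    (by simp) ?_ ?_
  · intro x y hx hy
    simpa using Submodule.add_mem _ hx hy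
  intro p a ha
  refine gr_induction A.internal (p := fun b => C.actR (C.actL a (cb.g i)) b ∈ _) b
    (by simp) ?_ ?_
  · intro x y hx hy
    simpa using Submodule.add_mem _ hx hy
  intro q b hb
  exact Submodule.subset_span ⟨i, p, q, a, ha, b, hb, rfl⟩

/-- Extension of a function on generators to a bimodule map. -/
def ext (Y : DGBimod A) (y : cb.I → Y.V) : C.V →ₗ[ZMod 2] Y.V :=
  (Finsupp.lsum (ZMod 2) (fun i => sandwichT Y (y i))).comp cb.eqv.symm.toLinearMap

variable {Y : DGBimod A}

theorem ext_agb (y : cb.I → Y.V) (i : cb.I) (a b : A.V) :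
    cb.ext Y y (C.actR (C.actL a (cb.g i)) b) = Y.actR (Y.actL a (y i)) b := by
  simp only [ext, LinearMap.comp_apply, LinearEquiv.coe_coe, eqv_symm, Finsupp.lsum_single,
    sandwichT_tmul]

theorem ext_g (y : cb.I → Y.V) (i : cb.I) : cb.ext Y y (cb.g i) = y i := by
  have := cb.ext_agb y i A.one A.one
  rwa [C.actL_one, C.actR_one, Y.actL_one, Y.actR_one] at this

theorem ext_actL (y : cb.I → Y.V) (a : A.V) (x : C.V) :
    cb.ext Y y (C.actL a x) = Y.actL a (cb.ext Y y x) := by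
  refine cb.induction (p := fun x => cb.ext Y y (C.actL a x) = Y.actL a (cb.ext Y y x)) x
    (by simp) (fun x z hx hz => by simp only [map_add, hx, hz]) ?_
  intro i b c
  rw [ext_agb, ← C.actLR, ← C.actL_mul, ext_agb, Y.actL_mul, Y.actLR]

theorem ext_actR (y : cb.I → Y.V) (x : C.V) (a : A.V) :
    cb.ext Y y (C.actR x a) = Y.actR (cb.ext Y y x) a := by
  refine cb.induction (p := fun x => cb.ext Y y (C.actR x a) = Y.actR (cb.ext Y y x) a) x
    (by simp) (fun x z hx hz => by simp only [map_add, LinearMap.add_apply, hx, hz]) ?_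
  intro i b c
  rw [ext_agb, C.actR_mul, ext_agb, Y.actR_mul]

theorem ext_gr {s : ℤ} (y : cb.I → Y.V) (hy : ∀ i, y i ∈ Y.gr (cb.deg i + s)) :
    cb.ext Y y ∈ grHomSub C Y s := by
  refine ⟨?_, cb.ext_actL y, cb.ext_actR y⟩
  refine degree_of_span C.internal Y.internal s _ _ cb.span_eq ?_
  rintro x ⟨i, p, q, a, ha, b, hb, rfl⟩
  refine ⟨p + cb.deg i + q, C.actR_gr _ _ _ (C.actL_gr _ _ _ ha _ (cb.g_gr i)) _ hb, ?_⟩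
  rw [ext_agb]
  have := Y.actR_gr _ _ _ (Y.actL_gr _ _ _ ha _ (hy i)) _ hb
  rwa [show p + (cb.deg i + s) + q = p + cb.deg i + q + s by ring] at this

theorem eqOn_range {F G : C.V →ₗ[ZMod 2] Y.V}
    (hF : ∀ a m, F (C.actL a m) = Y.actL a (F m)) (hF' : ∀ m a, F (C.actR m a) = Y.actR (F m) a)
    (hG : ∀ a m, G (C.actL a m) = Y.actL a (G m)) (hG' : ∀ m a, G (C.actR m a) = Y.actR (G m) a)
    (i : cb.I) (h : F (cb.g i) = G (cb.g i)) :
    LinearMap.range (sandwichT C (cb.g i)) ≤ LinearMap.eqLocus F G := by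
  rintro _ ⟨c, rfl⟩
  induction c using TensorProduct.induction_on with
  | zero => simp
  | tmul a b => rw [LinearMap.mem_eqLocus, sandwichT_tmul, hF', hF, hG', hG, h]
  | add x y hx hy => rw [map_add]; exact Submodule.add_mem _ hx hy

theorem eqOn_d {F G : C.V →ₗ[ZMod 2] Y.V}
    (hF : ∀ a m, F (C.actL a m) = Y.actL a (F m)) (hF' : ∀ m a, F (C.actR m a) = Y.actR (F m) a)
    (hG : ∀ a m, G (C.actL a m) = Y.actL a (G m)) (hG' : ∀ m a, G (C.actR m a) = Y.actR (G m) a)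
    (i : cb.I) (h : ∀ j, cb.lev j < cb.lev i → F (cb.g j) = G (cb.g j)) :
    F (C.d (cb.g i)) = G (C.d (cb.g i)) := by
  have : (⨆ (j : cb.I) (_ : cb.lev j < cb.lev i), LinearMap.range (sandwichT C (cb.g j))) ≤
      LinearMap.eqLocus F G :=
    iSup_le fun j => iSup_le fun hj => cb.eqOn_range hF hF' hG hG' j (h j hj)
  exact this (cb.d_lev i)

theorem hom_ext {F G : C.V →ₗ[ZMod 2] Y.V}
    (hF : ∀ a m, F (C.actL a m) = Y.actL a (F m)) (hF' : ∀ m a, F (C.actR m a) = Y.actR (F m) a)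
    (hG : ∀ a m, G (C.actL a m) = Y.actL a (G m)) (hG' : ∀ m a, G (C.actR m a) = Y.actR (G m) a)
    (h : ∀ i, F (cb.g i) = G (cb.g i)) : F = G := by
  ext x
  refine cb.induction (p := fun x => F x = G x) x (by simp)
    (fun x y hx hy => by rw [map_add, map_add, hx, hy]) ?_
  intro i a b
  rw [hF', hF, hG', hG, h]

theorem uniq {F G : C.V →ₗ[ZMod 2] Y.V}
    (hF : ∀ a m, F (C.actL a m) = Y.actL a (F m)) (hF' : ∀ m a, F (C.actR m a) = Y.actR (F m) a)
    (hG : ∀ a m, G (C.actL a m) = Y.actL a (G m)) (hG' : ∀ m a, G (C.actR m a) = Y.actR (G m) a)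
    (h : ∀ i, F (C.d (cb.g i)) = G (C.d (cb.g i)) → F (cb.g i) = G (cb.g i)) : F = G := by
  refine cb.hom_ext hF hF' hG hG' ?_
  have : ∀ n i, cb.lev i = n → F (cb.g i) = G (cb.g i) := by
    intro n
    induction n using Nat.strong_induction_on with
    | _ n ih =>
      intro i hi
      refine h i (cb.eqOn_d hF hF' hG hG' i ?_)
      intro j hj
      exact ih (cb.lev j) (by omega) j rfl
  exact fun i => this _ i rfl

theorem exists_rec {t : ℤ} (Φ : cb.I → Y.V → Y.V)
    (hΦ : ∀ i, ∀ y ∈ Y.gr (cb.deg i - 1 + t), Φ i y ∈ Y.gr (cb.deg i + t)) :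
    ∃ h ∈ grHomSub C Y t, ∀ i, h (cb.g i) = Φ i (h (C.d (cb.g i))) := by
  classical
  let F : ∀ i : cb.I, (∀ j : cb.I, cb.lev j < cb.lev i → Y.V) → Y.V := fun i rec =>
    Φ i (cb.ext Y (fun j => if hj : cb.lev j < cb.lev i then rec j hj else 0) (C.d (cb.g i)))
  let y : cb.I → Y.V := (measure cb.lev).wf.fix F
  have hy : ∀ i, y i = Φ i (cb.ext Y (fun j => if cb.lev j < cb.lev i then y j else 0)
      (C.d (cb.g i))) := by
    intro i
    have := (measure cb.lev).wf.fix_eq F i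
    simpa only [F, dite_eq_ite] using this
  have hgr : ∀ n i, cb.lev i = n → y i ∈ Y.gr (cb.deg i + t) := by
    intro n
    induction n using Nat.strong_induction_on with
    | _ n ih =>
      intro i hi
      rw [hy i]
      apply hΦ
      refine (cb.ext_gr (s := t) _ ?_).1 _ _ (C.d_gr _ _ (cb.g_gr i))
      intro j
      split_ifs with hj
      · exact ih _ (by omega) j rfl
      · exact Submodule.zero_mem _
  refine ⟨cb.ext Y y, cb.ext_gr y (fun i => hgr _ i rfl), fun i => ?_⟩
  rw [ext_g, hy i]
  congr 1
  refine cb.eqOn_d (cb.ext_actL _) (cb.ext_actR _) (cb.ext_actL _) (cb.ext_actR _) i ?_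
  intro j hj
  rw [ext_g, ext_g, if_pos hj]

/-- Pushing a chain map along a homotopy built from `σ`. -/
theorem push {s : ℤ} {f : C.V →ₗ[ZMod 2] Y.V} (hf : IsBHom C Y s f) (σ : Y.V →ₗ[ZMod 2] Y.V)
    (hσ : ∀ n, ∀ y ∈ Y.gr n, σ y ∈ Y.gr (n + 1)) :
    ∃ f' : C.V →ₗ[ZMod 2] Y.V, IsBHom C Y s f' ∧ f + f' ∈ nullHtpSub C Y s ∧
      ∀ i, ∃ w ∈ Y.gr (cb.deg i + s),
        f' (cb.g i) = (w + Y.d (σ w) + σ (Y.d w)) + σ (f' (C.d (cb.g i))) := by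
  obtain ⟨h, hh, hrec⟩ := cb.exists_rec (t := s + 1) (fun i z => σ (f (cb.g i) + z)) (by
    intro i z hz
    rw [← add_assoc]
    apply hσ
    refine Submodule.add_mem _ (hf.1 _ _ (cb.g_gr i)) ?_
    rwa [show cb.deg i + s = cb.deg i - 1 + (s + 1) by ring])
  let f' : C.V →ₗ[ZMod 2] Y.V := f + (Y.d.comp h + h.comp C.d)
  have hn : f + f' ∈ nullHtpSub C Y s := by
    rw [mem_nullHtp]
    refine ⟨h, hh, fun x => ?_⟩
    show f x + (f x + (Y.d (h x) + h (C.d x))) = _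
    rw [add_add_self2]
  have hd : ∀ x, f' (C.d x) = Y.d (f' x) := by
    intro x
    show f (C.d x) + (Y.d (h (C.d x)) + h (C.d (C.d x))) = Y.d (f x + (Y.d (h x) + h (C.d x)))
    simp only [map_add, C.d_d, Y.d_d, map_zero, add_zero, zero_add, hf.2.1]
  have hgr : f' ∈ grHomSub C Y s := by
    refine Submodule.add_mem _ hf.grHom ⟨fun i x hx => ?_, fun a m => ?_, fun m a => ?_⟩
    · refine Submodule.add_mem _ ?_ ?_
      · have := Y.d_gr _ _ (hh.1 i x hx)
        rwa [show i + (s + 1) - 1 = i + s by ring] at this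
      · have := hh.1 _ _ (C.d_gr i x hx)
        rwa [show i - 1 + (s + 1) = i + s by ring] at this
    · simp only [LinearMap.add_apply, LinearMap.comp_apply, hh.2.1, C.leibL, Y.leibL, map_add]
      rw [← sub_eq_zero]; abel_nf; simp [nsmul2, zsmul2]
    · simp only [LinearMap.add_apply, LinearMap.comp_apply, hh.2.2, C.leibR, Y.leibR, map_add]
      rw [← sub_eq_zero]; abel_nf; simp [nsmul2, zsmul2]
  refine ⟨f', IsBHom.of_gr hgr hd, hn, fun i => ⟨f (cb.g i) + h (C.d (cb.g i)), ?_, ?_⟩⟩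
  · refine Submodule.add_mem _ (hf.1 _ _ (cb.g_gr i)) ?_
    have := hh.1 _ _ (C.d_gr _ _ (cb.g_gr i))
    rwa [show cb.deg i - 1 + (s + 1) = cb.deg i + s by ring] at this
  · show f (cb.g i) + (Y.d (h (cb.g i)) + h (C.d (cb.g i))) = _ + σ (f (C.d (cb.g i)) +
      (Y.d (h (C.d (cb.g i))) + h (C.d (C.d (cb.g i)))))
    rw [hrec i, C.d_d]
    simp only [map_add, map_zero, add_zero, hf.2.1]
    rw [← sub_eq_zero]; abel_nf; simp [nsmul2, zsmul2]

theorem null_of_contr (cb : CB C) {σ : Y.V →ₗ[ZMod 2] Y.V} (hσ : Contr Y σ) {s : ℤ}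
    {f : C.V →ₗ[ZMod 2] Y.V} (hf : IsBHom C Y s f) : f ∈ nullHtpSub C Y s := by
  obtain ⟨f', hf', hn, hi⟩ := cb.push hf σ hσ.1
  have : f' = 0 := by
    refine cb.uniq hf'.2.2.1 hf'.2.2.2 (by simp) (by simp) ?_
    intro i h
    obtain ⟨w, hw, h2⟩ := hi i
    rw [h2, h, add_assoc w, hσ.2, ZModModule.add_self]
    simp
  rwa [this, add_zero] at hn

theorem finite_htpy (cb : CB C) [Finite cb.I] {σ : Y.V →ₗ[ZMod 2] Y.V} (hσ : FinContr Y σ) (s : ℤ) :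
    ∃ (J : Type) (_ : Finite J) (c : bcmSub C Y s → J),
      ∀ f g, c f = c g → f.1 + g.1 ∈ nullHtpSub C Y s := by
  have h := fun f : bcmSub C Y s => cb.push f.2 σ hσ.1
  choose f' hf' hn hi using h
  choose w hw hfw using hi
  have : ∀ i, Finite {z | ∃ y ∈ Y.gr (cb.deg i + s), z = y + Y.d (σ y) + σ (Y.d y)} :=
    fun i => hσ.2 _
  refine ⟨∀ i, {z | ∃ y ∈ Y.gr (cb.deg i + s), z = y + Y.d (σ y) + σ (Y.d y)}, inferInstance,
    fun f i => ⟨_, w f i, hw f i, rfl⟩, ?_⟩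
  intro f g hfg
  have h1 : f' f = f' g := by
    refine cb.uniq (hf' f).2.2.1 (hf' f).2.2.2 (hf' g).2.2.1 (hf' g).2.2.2 ?_
    intro i h
    have := congrArg Subtype.val (congrFun hfg i)
    simp only at this
    rw [hfw f i, hfw g i, h, this]
  have := Submodule.add_mem _ (hn f) (hn g)
  rw [h1] at this
  convert this using 1
  rw [← sub_eq_zero]; abel_nf; simp [nsmul2, zsmul2]

end CB

end Cell
end Part6

section Part7
set_option linter.unusedVariables false
set_option linter.unusedSimpArgs false
section Retract

variable {A : DGA (ZMod 2)}

theorem IsCellRetract.null {R Y : DGBimod A} (hR : IsCellRetract R) {σ : Y.V →ₗ[ZMod 2] Y.V}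
    (hσ : Contr Y σ) {s : ℤ} {f : R.V →ₗ[ZMod 2] Y.V} (hf : IsBHom R Y s f) :
    f ∈ nullHtpSub R Y s := by
  obtain ⟨C, hC, ι, r, hι, hr, -, hid⟩ := hR
  obtain ⟨cb⟩ := exists_CB hC
  have h1 : IsBHom C Y (0 + s) (f.comp r) := hf.comp hr
  have h2 := null_comp_right (u := s) hι (cb.null_of_contr hσ h1) (by ring)
  rwa [LinearMap.comp_assoc, hid, LinearMap.comp_id] at h2

theorem IsFiniteCellRetract.toRetract {R : DGBimod A} (hR : IsFiniteCellRetract R) :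
    IsCellRetract R := by
  obtain ⟨C, ⟨Fil, ⟨h0, h1, h2, h3, h4, h5, h6⟩, -⟩, hrest⟩ := hR
  refine ⟨C, ⟨Fil, h0, h1, h2, h3, h4, h5, fun n => ?_⟩, hrest⟩
  obtain ⟨I, -, h⟩ := h6 n
  exact ⟨I, h⟩

theorem lift_qi {R X Y : DGBimod A} (hR : IsCellRetract R) {ψ : X.V →ₗ[ZMod 2] Y.V}
    (hψ : IsBHom X Y 0 ψ) (hq : IsQIsoDeg X.V Y.V X.gr Y.gr X.d Y.d 0 ψ) {s : ℤ}
    {f : R.V →ₗ[ZMod 2] Y.V} (hf : IsBHom R Y s f) :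
    ∃ g, IsBHom R X s g ∧ f + ψ.comp g ∈ nullHtpSub R Y s := by
  obtain ⟨σ, hσ⟩ := (cone_acyc ψ hψ hq).contr
  have h1 := hR.null hσ ((cinl_hom ψ hψ).comp hf)
  rw [mem_nullHtp] at h1
  obtain ⟨h, hh, hx⟩ := h1
  rw [add_zero] at hh
  have hg : (csnd ψ hψ).comp h ∈ grHomSub R X s := by
    have := grHom_comp hh (csnd_hom ψ hψ).grHom
    rwa [show s + 1 + -1 = s by ring] at this
  have hgd : ∀ x, csnd ψ hψ (h (R.d x)) = X.d (csnd ψ hψ (h x)) := by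
    intro x
    have h2 := congrArg (csnd ψ hψ) (hx x)
    rw [map_add, (csnd_hom ψ hψ).2.1] at h2
    exact (eq_of_add_eq_zero2 h2.symm).symm
  refine ⟨_, IsBHom.of_gr hg hgd, ?_⟩
  rw [mem_nullHtp]
  refine ⟨(cfst ψ hψ).comp h, ?_, fun x => ?_⟩
  · have := grHom_comp hh (cfst_gr ψ hψ)
    rwa [add_zero] at this
  · have h2 := congrArg (cfst ψ hψ) (hx x)
    rw [map_add, cfst_d] at h2
    have h3 : f x = Y.d (cfst ψ hψ (h x)) + ψ (csnd ψ hψ (h x)) + cfst ψ hψ (h (R.d x)) := h2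
    simp only [LinearMap.add_apply, LinearMap.comp_apply]
    rw [h3, ← sub_eq_zero]; abel_nf; simp [nsmul2, zsmul2]

theorem inj_qi {R X Y : DGBimod A} (hR : IsCellRetract R) {ψ : X.V →ₗ[ZMod 2] Y.V}
    (hψ : IsBHom X Y 0 ψ) (hq : IsQIsoDeg X.V Y.V X.gr Y.gr X.d Y.d 0 ψ) {s : ℤ}
    {g : R.V →ₗ[ZMod 2] X.V} (hg : IsBHom R X s g) (hn : ψ.comp g ∈ nullHtpSub R Y s) :
    g ∈ nullHtpSub R X s := by
  obtain ⟨σ, hσ⟩ := (cone_acyc ψ hψ hq).contr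
  rw [mem_nullHtp] at hn
  obtain ⟨h, hh, hx⟩ := hn
  have hc : (cinl ψ hψ).comp h + (cinr ψ hψ).comp g ∈ grHomSub R (cone ψ hψ) (s + 1) := by
    refine Submodule.add_mem _ ?_ (grHom_comp hg.grHom (cinr_gr ψ hψ))
    have := grHom_comp hh (cinl_hom ψ hψ).grHom
    rwa [add_zero] at this
  have hcd : IsBHom R (cone ψ hψ) (s + 1) ((cinl ψ hψ).comp h + (cinr ψ hψ).comp g) := by
    refine IsBHom.of_gr hc fun x => ?_
    have h1 := cinr_d ψ hψ (g x)
    have h2 := hx x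
    simp only [LinearMap.add_apply, LinearMap.comp_apply, map_add, ← (cinl_hom ψ hψ).2.1,
      hg.2.1] at h1 h2 ⊢
    rw [h2, map_add] at h1
    have h3 := add_add_self2 ((cone ψ hψ).d (cinr ψ hψ (g x))) (cinr ψ hψ (X.d (g x)))
    rw [← h3, h1, ← sub_eq_zero]
    abel_nf; simp [nsmul2, zsmul2]
  have h1 := null_comp_left (hR.null hσ hcd) (csnd_hom ψ hψ) (u := s) (by ring)
  have h2 : (csnd ψ hψ).comp ((cinl ψ hψ).comp h + (cinr ψ hψ).comp g) = g := by
    ext x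
    show (0 : X.V) + g x = g x
    rw [zero_add]
  rwa [h2] at h1

/-- A resolution of a perfect bimodule is dominated by a finite cell bimodule. -/
theorem exists_domination {R D : DGBimod A} {ρ : R.V →ₗ[ZMod 2] D.V} (hres : IsResolution R D ρ)
    (hperf : IsPerfect D) :
    ∃ (C : DGBimod A) (cb : CB C) (α : R.V →ₗ[ZMod 2] C.V) (β : C.V →ₗ[ZMod 2] R.V),
      Finite cb.I ∧ IsBHom R C 0 α ∧ IsBHom C R 0 β ∧
      β.comp α + LinearMap.id ∈ nullHtpSub R R 0 := by
  obtain ⟨hR, hρ, hq⟩ := hres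
  obtain ⟨R', ρ', hR', hρ', hq'⟩ := hperf
  have hR'' := hR'.toRetract
  obtain ⟨C, hC, ι, r, hι, hr, -, hid⟩ := hR'
  obtain ⟨cb, hcb⟩ := exists_CB_fin hC
  obtain ⟨a, ha, ha'⟩ := lift_qi hR hρ' hq' hρ
  obtain ⟨b, hb, hb'⟩ := lift_qi hR'' hρ hq hρ'
  refine ⟨C, cb, ι.comp a, b.comp r, hcb, ?_, ?_, ?_⟩
  · simpa using hι.comp ha
  · simpa using hb.comp hr
  have h1 : (b.comp r).comp (ι.comp a) = b.comp a := by
    rw [LinearMap.comp_assoc, ← LinearMap.comp_assoc a, hid, LinearMap.id_comp]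
  rw [h1]
  have hba : IsBHom R R 0 (b.comp a) := by simpa using hb.comp ha
  have hid' : IsBHom R R 0 LinearMap.id :=
    ⟨fun i x hx => by simpa using hx, fun x => rfl, fun a m => rfl, fun m a => rfl⟩
  refine inj_qi hR hρ hq ((bcmSub R R 0).add_mem hba hid') ?_
  have h2 := null_comp_right (u := 0) ha hb' (by ring)
  have h3 := Submodule.add_mem _ h2 ha'
  convert h3 using 1
  ext x
  simp only [LinearMap.comp_apply, LinearMap.add_apply, LinearMap.id_apply, map_add]
  rw [← sub_eq_zero]; abel_nf; simp [nsmul2, zsmul2]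

end Retract

section FinR

variable {A : DGA (ZMod 2)}

theorem finContr_resolution_aux {R D : DGBimod A} {ρ : R.V →ₗ[ZMod 2] D.V}
    (hres : IsResolution R D ρ) (hfin : ∀ n, Finite (Hgr D.V D.gr ⊥ D.d n)) :
    ∃ σ, FinContr R σ := by
  obtain ⟨hR, hρ, hq⟩ := hres
  let Zn : ℤ → Submodule (ZMod 2) D.V := fun n => (D.gr n ⊔ ⊥) ⊓ Submodule.comap D.d ⊥
  have hZ : ∀ n z, z ∈ Zn n ↔ z ∈ D.gr n ∧ D.d z = 0 := by
    intro n z; simp [Zn]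
  let cl : ∀ n, Zn n → Hgr D.V D.gr ⊥ D.d n := fun n z => Submodule.Quotient.mk z
  have hcl : ∀ n (z z' : Zn n), cl n z = cl n z' →
      (z.1 - z'.1) ∈ Submodule.map D.d (D.gr (n + 1)) := by
    intro n z z' h
    have := (Submodule.Quotient.eq _).1 h
    rw [Submodule.mem_comap, sup_bot_eq, sup_bot_eq] at this
    exact this
  -- representatives
  have hrep : ∀ n, ∀ z : Zn n, ∃ x ∈ R.gr n, R.d x = 0 ∧
      ρ x - z.1 ∈ Submodule.map D.d (D.gr (n + 1)) := by
    intro n z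
    obtain ⟨h1, h2⟩ := (hZ n z.1).1 z.2
    have := (hq n).1 z.1 (by rw [add_zero]; exact h1) h2
    simpa only [add_zero] using this
  choose x hx hdx hρx using hrep
  have hsur : ∀ n, Function.Surjective (cl n) := fun n => Submodule.Quotient.mk_surjective _
  refine finContr_of_fin (fun n => Set.range fun c : Hgr D.V D.gr ⊥ D.d n => x n (Function.surjInv (hsur n) c))
    (fun n => Set.finite_range _) ?_
  intro n z hz hdz
  have hρz : ρ z ∈ Zn n := by
    rw [hZ]
    refine ⟨?_, ?_⟩
    · have := hρ.1 n z hz; rwa [add_zero] at this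
    · have := hρ.2.1 z; rw [hdz, map_zero] at this; exact this.symm
  let z0 := Function.surjInv (hsur n) (cl n ⟨ρ z, hρz⟩)
  have h1 : cl n ⟨ρ z, hρz⟩ = cl n z0 := (Function.surjInv_eq (hsur n) _).symm
  have h2 := hcl n _ _ h1
  have h3 := hρx n z0
  have h4 : ρ (z - x n z0) ∈ Submodule.map D.d (D.gr (n + 1)) := by
    have := Submodule.sub_mem _ h2 h3
    convert this using 1
    rw [map_sub]; abel
  obtain ⟨u, hu, hu'⟩ := (hq n).2 (z - x n z0) (Submodule.sub_mem _ hz (hx n z0))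
    (by rw [map_sub, hdz, hdx, sub_zero]) (by rw [add_zero]; exact h4)
  exact ⟨x n z0, ⟨_, rfl⟩, u, hu, by rw [hu']; abel⟩

theorem finContr_resolution {R : DGBimod A} {ρ : R.V →ₗ[ZMod 2] A.diag.V}
    (hres : IsResolution R A.diag ρ) (hproper : HomProper A) : ∃ σ, FinContr R σ := by
  refine finContr_resolution_aux hres fun n => ?_
  have : Module.Finite (ZMod 2) (Hgr A.diag.V A.diag.gr ⊥ A.diag.d n) := hproper.1 n
  exact Module.finite_of_finite (ZMod 2)

end FinR
end Part7

section Part8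
set_option linter.unusedVariables false
set_option linter.unusedSimpArgs false
section Outer

variable {A : DGA (ZMod 2)}

/-- The tensor product of two bimodules over the ground field with the outer action. -/
def outer (X Y : DGBimod A) : DGBimod A where
  V := T2 X Y
  gr := gr2 X Y
  internal := internal_gr2 X Y
  d := d2 X Y
  d_d := d2_d2 X Y
  d_gr := fun i x hx => d2_gr X Y hx
  actL := LinearMap.mk₂ (ZMod 2) (fun a z => TensorProduct.map (X.actL a) LinearMap.id z)
    (fun a b z => by simp [TensorProduct.map_add_left]) (fun c a z => by simp [TensorProduct.map_smul_left])
    (fun a z w => by simp) (fun c a z => by simp)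
  actR := LinearMap.mk₂ (ZMod 2) (fun z a => TensorProduct.map LinearMap.id (Y.actR.flip a) z)
    (fun a z w => by simp) (fun c a z => by simp)
    (fun a b z => by simp [TensorProduct.map_add_right]) (fun c a z => by simp [TensorProduct.map_smul_right])
  actL_one := fun z => by
    induction z using TensorProduct.induction_on with
    | zero => simp
    | tmul x y => simp [X.actL_one]
    | add x y hx hy => rw [map_add, hx, hy]
  actR_one := fun z => by
    induction z using TensorProduct.induction_on with
    | zero => simp
    | tmul x y => simp [Y.actR_one]
    | add x y hx hy => rw [map_add, LinearMap.add_apply, hx, hy]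
  actL_mul := fun a b z => by
    induction z using TensorProduct.induction_on with
    | zero => simp
    | tmul x y => simp [X.actL_mul]
    | add x y hx hy => simp only [map_add, hx, hy]
  actR_mul := fun z a b => by
    induction z using TensorProduct.induction_on with
    | zero => simp
    | tmul x y => simp [Y.actR_mul]
    | add x y hx hy => simp only [map_add, LinearMap.add_apply, hx, hy]
  actLR := fun a z b => by
    induction z using TensorProduct.induction_on with
    | zero => simp
    | tmul x y => simp
    | add x y hx hy => simp only [map_add, LinearMap.add_apply, hx, hy]
  actL_gr := fun i j a ha z hz => by
    have : gr2 X Y j ≤ (gr2 X Y (i + j)).comap (TensorProduct.map (X.actL a) LinearMap.id) := by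
      refine gr2_le X Y ?_
      rintro p q rfl x hx y hy
      simp only [Submodule.mem_comap, TensorProduct.map_tmul]
      exact tmul_mem_gr2 X Y (X.actL_gr i p a ha x hx) hy (by ring)
    exact this hz
  actR_gr := fun i j z hz a ha => by
    have : gr2 X Y i ≤ (gr2 X Y (i + j)).comap (TensorProduct.map LinearMap.id (Y.actR.flip a)) := by
      refine gr2_le X Y ?_
      rintro p q rfl x hx y hy
      simp only [Submodule.mem_comap, TensorProduct.map_tmul]
      exact tmul_mem_gr2 X Y hx (Y.actR_gr q j y hy a ha) (by ring)
    exact this hz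
  leibnizL := fun i a ha z => by
    rw [neg_smul2]
    induction z using TensorProduct.induction_on with
    | zero => simp
    | tmul x y => simp [d2_tmul, X.leibL, TensorProduct.add_tmul, add_assoc]
    | add x y hx hy => simp only [map_add, hx, hy]; abel
  leibnizR := fun i z hz a => by
    rw [neg_smul2]
    clear hz
    induction z using TensorProduct.induction_on with
    | zero => simp
    | tmul x y => simp [d2_tmul, Y.leibR, TensorProduct.tmul_add, add_assoc]
    | add x y hx hy => simp only [map_add, LinearMap.add_apply, hx, hy]; abel

variable (A) in
/-- The free bimodule of rank one. -/
def AA : DGBimod A := outer A.diag A.diag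

variable (A) in
/-- Pure tensors. -/
def tt2 : A.V →ₗ[ZMod 2] A.V →ₗ[ZMod 2] (AA A).V := TensorProduct.mk (ZMod 2) A.V A.V

theorem AA_induction {p : (AA A).V → Prop} (w : (AA A).V) (h0 : p 0)
    (hadd : ∀ x y, p x → p y → p (x + y)) (ht : ∀ x y, p (tt2 A x y)) : p w :=
  TensorProduct.induction_on (motive := p) w h0 ht hadd

theorem AA_d (x y : A.V) : (AA A).d (tt2 A x y) = tt2 A (A.d x) y + tt2 A x (A.d y) :=
  d2_tmul A.diag A.diag x y

theorem AA_actL (a x y : A.V) : (AA A).actL a (tt2 A x y) = tt2 A (A.mul a x) y := rfl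

theorem AA_actR (a x y : A.V) : (AA A).actR (tt2 A x y) a = tt2 A x (A.mul y a) := rfl

theorem tt2_gr {i j n : ℤ} {x y : A.V} (hx : x ∈ A.gr i) (hy : y ∈ A.gr j) (h : i + j = n) :
    tt2 A x y ∈ (AA A).gr n := tmul_mem_gr2 A.diag A.diag hx hy h

theorem AA_gr_le {n : ℤ} {P : Submodule (ZMod 2) (AA A).V}
    (h : ∀ i j, i + j = n → ∀ x ∈ A.gr i, ∀ y ∈ A.gr j, tt2 A x y ∈ P) : (AA A).gr n ≤ P :=
  gr2_le A.diag A.diag h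

/-- lift of bilinear map. -/
def AAlift {W : Type} [AddCommGroup W] [Module (ZMod 2) W] (B : A.V →ₗ[ZMod 2] A.V →ₗ[ZMod 2] W) :
    (AA A).V →ₗ[ZMod 2] W := TensorProduct.lift (M := A.V) (N := A.V) B

theorem AAlift_t {W : Type} [AddCommGroup W] [Module (ZMod 2) W]
    (B : A.V →ₗ[ZMod 2] A.V →ₗ[ZMod 2] W) (x y : A.V) : AAlift B (tt2 A x y) = B x y := rfl

theorem AA_hom_ext {W : Type} [AddCommGroup W] [Module (ZMod 2) W]
    {f g : (AA A).V →ₗ[ZMod 2] W} (h : ∀ x y, f (tt2 A x y) = g (tt2 A x y)) : f = g := by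
  ext w
  refine AA_induction (p := fun w => f w = g w) w (by simp) ?_ h
  intro x y hx hy; rw [map_add, map_add, hx, hy]

/-- `x ⊗ y ↦ x m y`. -/
def swL (M : DGBimod A) : M.V →ₗ[ZMod 2] (AA A).V →ₗ[ZMod 2] M.V where
  toFun m := AAlift (LinearMap.mk₂ (ZMod 2) (fun x y => M.actR (M.actL x m) y)
    (by simp) (by simp) (by simp) (by simp))
  map_add' m m' := AA_hom_ext fun x y => by simp [AAlift_t]
  map_smul' c m := AA_hom_ext fun x y => by simp [AAlift_t]

theorem swL_t (M : DGBimod A) (m : M.V) (x y : A.V) :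
    swL M m (tt2 A x y) = M.actR (M.actL x m) y := rfl

/-- `x ⊗ y ↦ y m x`. -/
def swR (M : DGBimod A) : M.V →ₗ[ZMod 2] (AA A).V →ₗ[ZMod 2] M.V where
  toFun m := AAlift (LinearMap.mk₂ (ZMod 2) (fun x y => M.actR (M.actL y m) x)
    (by simp) (by simp) (by simp) (by simp))
  map_add' m m' := AA_hom_ext fun x y => by simp [AAlift_t]
  map_smul' c m := AA_hom_ext fun x y => by simp [AAlift_t]

theorem swR_t (M : DGBimod A) (m : M.V) (x y : A.V) :
    swR M m (tt2 A x y) = M.actR (M.actL y m) x := rfl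

/-- inner left action -/
def inL : A.V →ₗ[ZMod 2] (AA A).V →ₗ[ZMod 2] (AA A).V where
  toFun a := AAlift ((tt2 A).compl₂ (A.mul a))
  map_add' m m' := AA_hom_ext fun x y => by simp [AAlift_t]
  map_smul' c m := AA_hom_ext fun x y => by simp [AAlift_t]

/-- inner right action -/
def inR : A.V →ₗ[ZMod 2] (AA A).V →ₗ[ZMod 2] (AA A).V where
  toFun a := AAlift ((tt2 A).comp (A.mul.flip a))
  map_add' m m' := AA_hom_ext fun x y => by simp [AAlift_t]
  map_smul' c m := AA_hom_ext fun x y => by simp [AAlift_t]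

theorem inL_t (a x y : A.V) : inL a (tt2 A x y) = tt2 A x (A.mul a y) := rfl
theorem inR_t (a x y : A.V) : inR a (tt2 A x y) = tt2 A (A.mul x a) y := rfl

theorem inL_gr {i j : ℤ} {a : A.V} (ha : a ∈ A.gr i) {w : (AA A).V} (hw : w ∈ (AA A).gr j) :
    inL a w ∈ (AA A).gr (i + j) := by
  have : (AA A).gr j ≤ ((AA A).gr (i + j)).comap (inL a) := by
    refine AA_gr_le ?_
    rintro p q rfl x hx y hy
    exact tt2_gr hx (A.mul_gr i q a ha y hy) (by ring)
  exact this hw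

theorem inR_gr {i j : ℤ} {a : A.V} (ha : a ∈ A.gr i) {w : (AA A).V} (hw : w ∈ (AA A).gr j) :
    inR a w ∈ (AA A).gr (j + i) := by
  have : (AA A).gr j ≤ ((AA A).gr (j + i)).comap (inR a) := by
    refine AA_gr_le ?_
    rintro p q rfl x hx y hy
    exact tt2_gr (A.mul_gr p i x hx a ha) hy (by ring)
  exact this hw

theorem inL_actL (a b : A.V) (w : (AA A).V) : inL a ((AA A).actL b w) = (AA A).actL b (inL a w) := by
  refine AA_induction (p := fun w => inL a ((AA A).actL b w) = (AA A).actL b (inL a w)) w (by simp)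
    (fun x y hx hy => by simp only [map_add, hx, hy]) (fun x y => rfl)

theorem inR_actR (a b : A.V) (w : (AA A).V) : inR a ((AA A).actR w b) = (AA A).actR (inR a w) b := by
  refine AA_induction (p := fun w => inR a ((AA A).actR w b) = (AA A).actR (inR a w) b) w (by simp)
    (fun x y hx hy => by simp only [map_add, LinearMap.add_apply, hx, hy]) (fun x y => rfl)

theorem inL_actR (a b : A.V) (w : (AA A).V) : inL a ((AA A).actR w b) = (AA A).actR (inL a w) b := by
  refine AA_induction (p := fun w => inL a ((AA A).actR w b) = (AA A).actR (inL a w) b) w (by simp)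
    (fun x y hx hy => by simp only [map_add, LinearMap.add_apply, hx, hy]) (fun x y => ?_)
  simp only [AA_actR, inL_t, A.mul_assoc']

theorem inR_actL (a b : A.V) (w : (AA A).V) : inR a ((AA A).actL b w) = (AA A).actL b (inR a w) := by
  refine AA_induction (p := fun w => inR a ((AA A).actL b w) = (AA A).actL b (inR a w)) w (by simp)
    (fun x y hx hy => by simp only [map_add, LinearMap.add_apply, hx, hy]) (fun x y => ?_)
  simp only [AA_actL, inR_t, A.mul_assoc']

/-- The bimodule dual of `C`. -/
def bdual (C : DGBimod A) : DGBimod A :=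
  mkBimod (A := A) (C.V →ₗ[ZMod 2] (AA A).V) (grHomSub C (AA A))
    (indep_of_degree C.internal (AA A).internal.submodule_iSupIndep (grHomSub C (AA A))
      (fun s f hf => hf.1))
    ((LinearMap.llcomp (ZMod 2) C.V (AA A).V (AA A).V (AA A).d) + (LinearMap.lcomp (ZMod 2) (AA A).V C.d))
    (LinearMap.mk₂ (ZMod 2) (fun a f => (inL a).comp f)
      (fun a b f => by ext x; simp) (fun c a f => by ext x; simp)
      (fun a b f => by ext x; simp) (fun c a f => by ext x; simp))
    (LinearMap.mk₂ (ZMod 2) (fun f a => (inR a).comp f)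
      (fun a b f => by ext x; simp) (fun c a f => by ext x; simp)
      (fun a b f => by ext x; simp) (fun c a f => by ext x; simp))
    (fun f => by
      ext x
      simp [(AA A).d_d, C.d_d, ZModModule.add_self])
    (fun s f hf => by
      refine ⟨fun i x hx => ?_, fun a m => ?_, fun m a => ?_⟩
      · have h1 := (AA A).d_gr _ _ (hf.1 i x hx)
        have h2 := hf.1 _ _ (C.d_gr i x hx)
        rw [show i + s - 1 = i + (s - 1) by ring] at h1
        rw [show i - 1 + s = i + (s - 1) by ring] at h2
        exact Submodule.add_mem _ h1 h2
      · simp only [LinearMap.add_apply, LinearMap.llcomp_apply, LinearMap.lcomp_apply, hf.2.1,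
          DGBimod.leibL, map_add]
        rw [← sub_eq_zero]; abel_nf; simp [nsmul2, zsmul2]
      · simp only [LinearMap.add_apply, LinearMap.llcomp_apply, LinearMap.lcomp_apply, hf.2.2,
          DGBimod.leibR, map_add]
        rw [← sub_eq_zero]; abel_nf; simp [nsmul2, zsmul2])
    (fun f => by
      ext x
      refine AA_induction (p := fun w => inL A.one w = w) (f x) (by simp)
        (fun x y hx hy => by rw [map_add, hx, hy]) (fun x y => by rw [inL_t, A.one_mul']))
    (fun f => by
      ext x
      refine AA_induction (p := fun w => inR A.one w = w) (f x) (by simp)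
        (fun x y hx hy => by rw [map_add, hx, hy]) (fun x y => by rw [inR_t, A.mul_one']))
    (fun a b f => by
      ext x
      refine AA_induction (p := fun w => inL (A.mul a b) w = inL a (inL b w)) (f x) (by simp)
        (fun x y hx hy => by simp only [map_add, hx, hy]) (fun x y => by simp only [inL_t, A.mul_assoc']))
    (fun f a b => by
      ext x
      refine AA_induction (p := fun w => inR b (inR a w) = inR (A.mul a b) w) (f x) (by simp)
        (fun x y hx hy => by simp only [map_add, hx, hy]) (fun x y => by simp only [inR_t, A.mul_assoc']))
    (fun a f b => by
      ext x
      refine AA_induction (p := fun w => inR b (inL a w) = inL a (inR b w)) (f x) (by simp)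
        (fun x y hx hy => by simp only [map_add, hx, hy]) (fun x y => rfl))
    (fun p q a ha f hf => by
      refine ⟨fun i x hx => ?_, fun b m => ?_, fun m b => ?_⟩
      · have := inL_gr ha (hf.1 i x hx)
        rw [show p + (i + q) = i + (p + q) by ring] at this
        exact this
      · show inL a (f _) = (AA A).actL b (inL a (f m))
        rw [hf.2.1, inL_actL]
      · show inL a (f _) = (AA A).actR (inL a (f m)) b
        rw [hf.2.2, inL_actR])
    (fun p q f hf a ha => by
      refine ⟨fun i x hx => ?_, fun b m => ?_, fun m b => ?_⟩
      · have := inR_gr ha (hf.1 i x hx)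
        rw [show i + p + q = i + (p + q) by ring] at this
        exact this
      · show inR a (f _) = (AA A).actL b (inR a (f m))
        rw [hf.2.1, inR_actL]
      · show inR a (f _) = (AA A).actR (inR a (f m)) b
        rw [hf.2.2, inR_actR])
    (fun a f => by
      ext x
      have h : ∀ w, (AA A).d (inL a w) = inL (A.d a) w + inL a ((AA A).d w) := fun w =>
        AA_induction (p := fun w => (AA A).d (inL a w) = inL (A.d a) w + inL a ((AA A).d w)) w (by simp)
          (fun x y hx hy => by simp only [map_add, hx, hy]; abel) (fun x y => by
            simp only [AA_d, inL_t, map_add, A.leib]; abel)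
      simp only [LinearMap.add_apply, LinearMap.llcomp_apply, LinearMap.lcomp_apply,
        LinearMap.mk₂_apply, LinearMap.comp_apply, h, map_add]
      abel)
    (fun f a => by
      ext x
      have h : ∀ w, (AA A).d (inR a w) = inR a ((AA A).d w) + inR (A.d a) w := fun w =>
        AA_induction (p := fun w => (AA A).d (inR a w) = inR a ((AA A).d w) + inR (A.d a) w) w (by simp)
          (fun x y hx hy => by simp only [map_add, hx, hy]; abel) (fun x y => by
            simp only [AA_d, inR_t, map_add, A.leib, LinearMap.add_apply]; abel)
      simp only [LinearMap.add_apply, LinearMap.llcomp_apply, LinearMap.lcomp_apply,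
        LinearMap.mk₂_apply, LinearMap.comp_apply, h, map_add]
      abel)

/-- evaluation -/
def bval (C : DGBimod A) : (bdual C).V →ₗ[ZMod 2] C.V →ₗ[ZMod 2] (AA A).V :=
  (⨆ s, grHomSub C (AA A) s).subtype

variable {C : DGBimod A}

theorem bval_inj {f g : (bdual C).V} (h : ∀ x, bval C f x = bval C g x) : f = g :=
  Subtype.ext (LinearMap.ext h)

theorem bval_d (f : (bdual C).V) (x : C.V) :
    bval C ((bdual C).d f) x = (AA A).d (bval C f x) + bval C f (C.d x) := rfl

theorem bval_actL (a : A.V) (f : (bdual C).V) (x : C.V) :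
    bval C ((bdual C).actL a f) x = inL a (bval C f x) := rfl

theorem bval_actR (a : A.V) (f : (bdual C).V) (x : C.V) :
    bval C ((bdual C).actR f a) x = inR a (bval C f x) := rfl

theorem bval_gr (s : ℤ) (f : (bdual C).V) :
    f ∈ (bdual C).gr s ↔ bval C f ∈ grHomSub C (AA A) s := Iff.rfl

theorem exists_bval {s : ℤ} {f : C.V →ₗ[ZMod 2] (AA A).V} (hf : f ∈ grHomSub C (AA A) s) :
    ∃ g ∈ (bdual C).gr s, bval C g = f := ⟨⟨f, Submodule.mem_iSup_of_mem s hf⟩, hf, rfl⟩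

theorem bval_L (f : (bdual C).V) (a : A.V) (x : C.V) :
    bval C f (C.actL a x) = (AA A).actL a (bval C f x) := by
  refine gr_induction (bdual C).internal (p := fun f => bval C f (C.actL a x) = (AA A).actL a (bval C f x)) f
    (by simp) (fun x y hx hy => by simp only [map_add, LinearMap.add_apply, hx, hy]) ?_
  intro i f hf
  exact ((bval_gr i f).1 hf).2.1 a x

theorem bval_R (f : (bdual C).V) (x : C.V) (a : A.V) :
    bval C f (C.actR x a) = (AA A).actR (bval C f x) a := by
  refine gr_induction (bdual C).internal (p := fun f => bval C f (C.actR x a) = (AA A).actR (bval C f x) a) f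
    (by simp) (fun x y hx hy => by simp only [map_add, LinearMap.add_apply, hx, hy]) ?_
  intro i f hf
  exact ((bval_gr i f).1 hf).2.2 x a

end Outer
end Part8

section Part9
set_option linter.unusedVariables false
set_option linter.unusedSimpArgs false
section Xi

variable {A : DGA (ZMod 2)}

theorem swL_d (M : DGBimod A) (m : M.V) (w : (AA A).V) :
    M.d (swL M m w) = swL M (M.d m) w + swL M m ((AA A).d w) := by
  refine AA_induction (p := fun w => M.d (swL M m w) = swL M (M.d m) w + swL M m ((AA A).d w)) w
    (by simp) (fun x y hx hy => by simp only [map_add, hx, hy]; abel) ?_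
  intro x y
  simp only [swL_t, AA_d, map_add, M.leibR, M.leibL, LinearMap.add_apply]
  abel

theorem swR_d (M : DGBimod A) (m : M.V) (w : (AA A).V) :
    M.d (swR M m w) = swR M (M.d m) w + swR M m ((AA A).d w) := by
  refine AA_induction (p := fun w => M.d (swR M m w) = swR M (M.d m) w + swR M m ((AA A).d w)) w
    (by simp) (fun x y hx hy => by simp only [map_add, hx, hy]; abel) ?_
  intro x y
  simp only [swR_t, AA_d, map_add, M.leibR, M.leibL, LinearMap.add_apply]
  abel

theorem swL_gr (M : DGBimod A) {i j n : ℤ} {m : M.V} (hm : m ∈ M.gr i) {w : (AA A).V}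
    (hw : w ∈ (AA A).gr j) (h : i + j = n) : swL M m w ∈ M.gr n := by
  have : (AA A).gr j ≤ (M.gr n).comap (swL M m) := by
    refine AA_gr_le ?_
    rintro p q rfl x hx y hy
    have := M.actR_gr _ _ _ (M.actL_gr _ _ _ hx _ hm) _ hy
    rwa [show p + i + q = n by linarith] at this
  exact this hw

theorem swR_gr (M : DGBimod A) {i j n : ℤ} {m : M.V} (hm : m ∈ M.gr i) {w : (AA A).V}
    (hw : w ∈ (AA A).gr j) (h : i + j = n) : swR M m w ∈ M.gr n := by
  have : (AA A).gr j ≤ (M.gr n).comap (swR M m) := by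
    refine AA_gr_le ?_
    rintro p q rfl x hx y hy
    have := M.actR_gr _ _ _ (M.actL_gr _ _ _ hy _ hm) _ hx
    rwa [show q + i + p = n by linarith] at this
  exact this hw

theorem swL_actL (M : DGBimod A) (m : M.V) (a : A.V) (w : (AA A).V) :
    swL M m ((AA A).actL a w) = M.actL a (swL M m w) := by
  refine AA_induction (p := fun w => swL M m ((AA A).actL a w) = M.actL a (swL M m w)) w
    (by simp) (fun x y hx hy => by simp only [map_add, hx, hy]) ?_
  intro x y
  rw [AA_actL, swL_t, swL_t, M.actL_mul, M.actLR]

theorem swL_actR (M : DGBimod A) (m : M.V) (a : A.V) (w : (AA A).V) :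
    swL M m ((AA A).actR w a) = M.actR (swL M m w) a := by
  refine AA_induction (p := fun w => swL M m ((AA A).actR w a) = M.actR (swL M m w) a) w
    (by simp) (fun x y hx hy => by simp only [map_add, LinearMap.add_apply, hx, hy]) ?_
  intro x y
  rw [AA_actR, swL_t, swL_t, M.actR_mul]

theorem swL_inL (M : DGBimod A) (m : M.V) (a : A.V) (w : (AA A).V) :
    swL M m (inL a w) = swL M (M.actR m a) w := by
  refine AA_induction (p := fun w => swL M m (inL a w) = swL M (M.actR m a) w) w
    (by simp) (fun x y hx hy => by simp only [map_add, LinearMap.add_apply, hx, hy]) ?_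
  intro x y
  rw [inL_t, swL_t, swL_t, ← M.actLR, M.actR_mul]

theorem swL_inR (M : DGBimod A) (m : M.V) (a : A.V) (w : (AA A).V) :
    swL M m (inR a w) = swL M (M.actL a m) w := by
  refine AA_induction (p := fun w => swL M m (inR a w) = swL M (M.actL a m) w) w
    (by simp) (fun x y hx hy => by simp only [map_add, LinearMap.add_apply, hx, hy]) ?_
  intro x y
  rw [inR_t, swL_t, swL_t, M.actL_mul]

theorem swR_inL (M : DGBimod A) (m : M.V) (a : A.V) (w : (AA A).V) :
    swR M m (inL a w) = M.actL a (swR M m w) := by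
  refine AA_induction (p := fun w => swR M m (inL a w) = M.actL a (swR M m w)) w
    (by simp) (fun x y hx hy => by simp only [map_add, LinearMap.add_apply, hx, hy]) ?_
  intro x y
  rw [inL_t, swR_t, swR_t, M.actL_mul, M.actLR]

theorem swR_inR (M : DGBimod A) (m : M.V) (a : A.V) (w : (AA A).V) :
    swR M m (inR a w) = M.actR (swR M m w) a := by
  refine AA_induction (p := fun w => swR M m (inR a w) = M.actR (swR M m w) a) w
    (by simp) (fun x y hx hy => by simp only [map_add, LinearMap.add_apply, hx, hy]) ?_
  intro x y
  rw [inR_t, swR_t, swR_t, M.actR_mul]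

theorem swR_actL (M : DGBimod A) (m : M.V) (a : A.V) (w : (AA A).V) :
    swR M m ((AA A).actL a w) = swR M (M.actR m a) w := by
  refine AA_induction (p := fun w => swR M m ((AA A).actL a w) = swR M (M.actR m a) w) w
    (by simp) (fun x y hx hy => by simp only [map_add, LinearMap.add_apply, hx, hy]) ?_
  intro x y
  rw [AA_actL, swR_t, swR_t, ← M.actR_mul, M.actLR]

theorem swR_actR (M : DGBimod A) (m : M.V) (a : A.V) (w : (AA A).V) :
    swR M m ((AA A).actR w a) = swR M (M.actL a m) w := by
  refine AA_induction (p := fun w => swR M m ((AA A).actR w a) = swR M (M.actL a m) w) w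
    (by simp) (fun x y hx hy => by simp only [map_add, LinearMap.add_apply, hx, hy]) ?_
  intro x y
  rw [AA_actR, swR_t, swR_t, ← M.actL_mul]

theorem tmul_swR (R M : DGBimod A) (r : R.V) (m : M.V) (w : (AA A).V) :
    r ⊗ₜ[ZMod 2] swR M m w + swL R r w ⊗ₜ[ZMod 2] m ∈ rel2 R M := by
  refine AA_induction (p := fun w => r ⊗ₜ[ZMod 2] swR M m w + swL R r w ⊗ₜ[ZMod 2] m ∈ rel2 R M) w
    (by simp) (fun x y hx hy => ?_) ?_
  · have := Submodule.add_mem _ hx hy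
    convert this using 1
    simp only [map_add, TensorProduct.tmul_add, TensorProduct.add_tmul]; abel
  intro x y
  rw [swR_t, swL_t]
  have h1 := rel2_left R M r x (M.actL y m)
  have h2 := rel2_right R M (R.actL x r) y m
  have := Submodule.add_mem _ h1 h2
  convert this using 1
  rw [← sub_eq_zero]; abel_nf; simp [nsmul2, zsmul2]

variable {C : DGBimod A} (cb : CB C) (R M : DGBimod A)

/-- The map `R ⊗ C^* → Hom(C, R)`. -/
def Xi (C R : DGBimod A) : T2 R (bdual C) →ₗ[ZMod 2] (C.V →ₗ[ZMod 2] R.V) :=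
  TensorProduct.lift (LinearMap.mk₂ (ZMod 2) (fun r f => (swL R r).comp (bval C f))
    (fun a b f => by ext x; simp) (fun c a f => by ext x; simp)
    (fun a b f => by ext x; simp) (fun c a f => by ext x; simp))

theorem Xi_tmul (r : R.V) (f : (bdual C).V) (c : C.V) :
    Xi C R (r ⊗ₜ f) c = swL R r (bval C f c) := rfl

theorem Xi_L (z : T2 R (bdual C)) (a : A.V) (c : C.V) :
    Xi C R z (C.actL a c) = R.actL a (Xi C R z c) := by
  refine T2_induction _ _ (p := fun z => Xi C R z (C.actL a c) = R.actL a (Xi C R z c)) z (by simp)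
    (fun x y hx hy => by simp only [map_add, LinearMap.add_apply, hx, hy]) ?_
  intro r f
  rw [Xi_tmul, Xi_tmul, bval_L, swL_actL]

theorem Xi_R (z : T2 R (bdual C)) (c : C.V) (a : A.V) :
    Xi C R z (C.actR c a) = R.actR (Xi C R z c) a := by
  refine T2_induction _ _ (p := fun z => Xi C R z (C.actR c a) = R.actR (Xi C R z c) a) z (by simp)
    (fun x y hx hy => by simp only [map_add, LinearMap.add_apply, hx, hy]) ?_
  intro r f
  rw [Xi_tmul, Xi_tmul, bval_R, swL_actR]

theorem Xi_gr {s : ℤ} {z : T2 R (bdual C)} (hz : z ∈ gr2 R (bdual C) s) :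
    Xi C R z ∈ grHomSub C R s := by
  have : gr2 R (bdual C) s ≤ (grHomSub C R s).comap (Xi C R) := by
    refine gr2_le _ _ ?_
    rintro p q rfl r hr f hf
    refine ⟨fun i x hx => ?_, Xi_L R _, Xi_R R _⟩
    rw [Xi_tmul]
    exact swL_gr R hr (((bval_gr q f).1 hf).1 i x hx) (by ring)
  exact this hz

theorem Xi_rel {z : T2 R (bdual C)} (hz : z ∈ rel2 R (bdual C)) : Xi C R z = 0 := by
  have : rel2 R (bdual C) ≤ LinearMap.ker (Xi C R) := by
    refine rel2_le _ _ ?_ ?_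
    · intro r a m
      rw [LinearMap.mem_ker]
      ext c
      rw [map_add, LinearMap.add_apply, Xi_tmul, Xi_tmul, bval_actL, swL_inL, ZModModule.add_self]
      rfl
    · intro r a m
      rw [LinearMap.mem_ker]
      ext c
      rw [map_add, LinearMap.add_apply, Xi_tmul, Xi_tmul, bval_actR, swL_inR, ZModModule.add_self]
      rfl
  exact this hz

theorem Xi_d (z : T2 R (bdual C)) (c : C.V) :
    Xi C R (d2 R (bdual C) z) c = R.d (Xi C R z c) + Xi C R z (C.d c) := by
  refine T2_induction _ _ (p := fun z => Xi C R (d2 R (bdual C) z) c = R.d (Xi C R z c) + Xi C R z (C.d c))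
    z (by simp) (fun x y hx hy => by simp only [map_add, LinearMap.add_apply, hx, hy]; abel) ?_
  intro r f
  rw [d2_tmul, map_add, LinearMap.add_apply, Xi_tmul, Xi_tmul, Xi_tmul, Xi_tmul, bval_d, swL_d, map_add]
  abel

namespace CB

open Classical in
theorem exists_gs (i : cb.I) : ∃ g ∈ (bdual C).gr (-cb.deg i),
    bval C g = cb.ext (AA A) (fun j => if j = i then tt2 A A.one A.one else 0) := by
  refine exists_bval (cb.ext_gr _ ?_)
  intro j
  split_ifs with h
  · subst h
    rw [add_neg_cancel]
    exact tt2_gr A.one_gr A.one_gr rfl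
  · exact Submodule.zero_mem _

/-- dual generators -/
def gs (i : cb.I) : (bdual C).V := (cb.exists_gs i).choose

theorem gs_gr (i : cb.I) : cb.gs i ∈ (bdual C).gr (-cb.deg i) := (cb.exists_gs i).choose_spec.1

open Classical in
theorem gs_g (i j : cb.I) : bval C (cb.gs i) (cb.g j) = if j = i then tt2 A A.one A.one else 0 := by
  rw [gs, (cb.exists_gs i).choose_spec.2, ext_g]

variable [Fintype cb.I]

theorem bd_expand (f : (bdual C).V) : f = ∑ i, swR (bdual C) (cb.gs i) (bval C f (cb.g i)) := by
  classical
  apply bval_inj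
  have : bval C f = bval C (∑ i, swR (bdual C) (cb.gs i) (bval C f (cb.g i))) := by
    refine cb.hom_ext (Y := AA A) (bval_L f) (bval_R f) (bval_L _) (bval_R _) ?_
    intro j
    rw [map_sum, LinearMap.sum_apply, Finset.sum_eq_single j]
    · have : ∀ w, w = bval C (swR (bdual C) (cb.gs j) w) (cb.g j) := by
        intro w
        refine AA_induction (p := fun w => w = bval C (swR (bdual C) (cb.gs j) w) (cb.g j)) w (by simp)
          (fun x y hx hy => by rw [map_add, map_add, LinearMap.add_apply, ← hx, ← hy]) ?_
        intro x y
        rw [swR_t, bval_actR, bval_actL, gs_g, if_pos rfl, inL_t, inR_t, A.mul_one', A.one_mul']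
      exact this _
    · intro i _ hij
      refine AA_induction (p := fun w => bval C (swR (bdual C) (cb.gs i) w) (cb.g j) = 0) _ (by simp)
          (fun x y hx hy => by rw [map_add, map_add, LinearMap.add_apply, hx, hy, add_zero]) ?_
      intro x y
      rw [swR_t, bval_actR, bval_actL, gs_g, if_neg (fun h => hij h.symm), map_zero, map_zero]
    · simp
  intro x; rw [← this]

/-- inverse of Xi -/
def Xinv (h : C.V →ₗ[ZMod 2] R.V) : T2 R (bdual C) := ∑ i, h (cb.g i) ⊗ₜ cb.gs i

theorem Xinv_gr {s : ℤ} {h : C.V →ₗ[ZMod 2] R.V} (hh : h ∈ grHomSub C R s) :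
    cb.Xinv R h ∈ gr2 R (bdual C) s :=
  Submodule.sum_mem _ fun i _ => tmul_mem_gr2 _ _ (hh.1 _ _ (cb.g_gr i)) (cb.gs_gr i) (by ring)

theorem Xi_Xinv {s : ℤ} {h : C.V →ₗ[ZMod 2] R.V} (hh : h ∈ grHomSub C R s) :
    Xi C R (cb.Xinv R h) = h := by
  classical
  refine cb.hom_ext (Xi_L R _) (Xi_R R _) hh.2.1 hh.2.2 ?_
  intro j
  rw [Xinv, map_sum, LinearMap.sum_apply, Finset.sum_eq_single j]
  · rw [Xi_tmul, gs_g, if_pos rfl, swL_t, R.actL_one, R.actR_one]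
  · intro i _ hij
    rw [Xi_tmul, gs_g, if_neg (fun h => hij h.symm), map_zero]
  · simp

theorem Xinv_Xi (z : T2 R (bdual C)) : z + cb.Xinv R (Xi C R z) ∈ rel2 R (bdual C) := by
  refine T2_induction _ _ (p := fun z => z + cb.Xinv R (Xi C R z) ∈ rel2 R (bdual C)) z
    (by simp [Xinv]) ?_ ?_
  · intro x y hx hy
    have := Submodule.add_mem _ hx hy
    convert this using 1
    simp only [Xinv, map_add, LinearMap.add_apply, TensorProduct.add_tmul, Finset.sum_add_distrib]
    abel
  intro r f
  have h1 : r ⊗ₜ[ZMod 2] f = ∑ i, r ⊗ₜ swR (bdual C) (cb.gs i) (bval C f (cb.g i)) := by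
    rw [← TensorProduct.tmul_sum, ← cb.bd_expand f]
  rw [h1, Xinv, ← Finset.sum_add_distrib]
  refine Submodule.sum_mem _ fun i _ => ?_
  have h2 : Xi C R (∑ i, r ⊗ₜ[ZMod 2] swR (bdual C) (cb.gs i) (bval C f (cb.g i))) (cb.g i) =
      swL R r (bval C f (cb.g i)) := by
    rw [← h1, Xi_tmul]
  rw [h2]
  exact tmul_swR _ _ _ _ _

theorem mem_rel_of_Xi (cb : CB C) [Fintype cb.I] {z : T2 R (bdual C)} (hz : Xi C R z = 0) : z ∈ rel2 R (bdual C) := by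
  have := cb.Xinv_Xi R z
  rw [hz] at this
  simpa [Xinv] using this

/-- finiteness of the homology of `R ⊗ C^*`. -/
theorem finite_bdual (cb : CB C) [Fintype cb.I] {σ : R.V →ₗ[ZMod 2] R.V} (hσ : FinContr R σ) (s : ℤ) :
    ∃ (J : Type) (_ : Finite J) (c : T2 R (bdual C) → J),
      ∀ z ∈ gr2 R (bdual C) s, ∀ z' ∈ gr2 R (bdual C) s,
        d2 _ _ z ∈ rel2 R (bdual C) → d2 _ _ z' ∈ rel2 R (bdual C) → c z = c z' →
        ∃ w ∈ gr2 R (bdual C) (s + 1), z + z' + d2 _ _ w ∈ rel2 R (bdual C) := by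
  classical
  obtain ⟨J, hJ, c, hc⟩ := cb.finite_htpy hσ s
  have hX : ∀ z ∈ gr2 R (bdual C) s, d2 _ _ z ∈ rel2 R (bdual C) → Xi C R z ∈ bcmSub C R s := by
    intro z hz hdz
    refine IsBHom.of_gr (Xi_gr R hz) fun x => ?_
    have := congrArg (fun f => f x) (Xi_rel R hdz)
    simp only [Xi_d, LinearMap.zero_apply] at this
    exact (eq_of_add_eq_zero2 this).symm
  refine ⟨J, hJ, fun z => if h : Xi C R z ∈ bcmSub C R s then c ⟨_, h⟩ else c 0, ?_⟩
  intro z hz z' hz' hdz hdz' h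
  beta_reduce at h
  rw [dif_pos (hX z hz hdz), dif_pos (hX z' hz' hdz')] at h
  have h1 := hc _ _ h
  rw [mem_nullHtp] at h1
  obtain ⟨H, hH, hx⟩ := h1
  refine ⟨cb.Xinv R H, cb.Xinv_gr R hH, cb.mem_rel_of_Xi R ?_⟩
  ext x
  have := hx x
  simp only [map_add, LinearMap.add_apply, Xi_d, cb.Xi_Xinv R hH, LinearMap.zero_apply] at this ⊢
  rw [this, ZModModule.add_self]

theorem d_Xinv_rel (cb : CB C) [Fintype cb.I] {β : C.V →ₗ[ZMod 2] R.V} (hβ : IsBHom C R 0 β) :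
    d2 _ _ (cb.Xinv R β) ∈ rel2 R (bdual C) := by
  refine cb.mem_rel_of_Xi R ?_
  ext x
  rw [Xi_d, cb.Xi_Xinv R hβ.grHom, hβ.2.1, ZModModule.add_self]; rfl

end CB

/-- The contraction. -/
def Kc (C M : DGBimod A) : T2 C M →ₗ[ZMod 2] ((bdual C).V →ₗ[ZMod 2] M.V) :=
  TensorProduct.lift (LinearMap.mk₂ (ZMod 2) (fun c m => (swR M m).comp ((bval C).flip c))
    (fun a b f => by ext x; simp) (fun c a f => by ext x; simp)
    (fun a b f => by ext x; simp) (fun c a f => by ext x; simp))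

theorem Kc_tmul (c : C.V) (m : M.V) (f : (bdual C).V) : Kc C M (c ⊗ₜ m) f = swR M m (bval C f c) := rfl

theorem Kc_rel {z : T2 C M} (hz : z ∈ rel2 C M) : Kc C M z = 0 := by
  have : rel2 C M ≤ LinearMap.ker (Kc C M) := by
    refine rel2_le _ _ ?_ ?_
    · intro r a m
      rw [LinearMap.mem_ker]
      ext c
      rw [map_add, LinearMap.add_apply, Kc_tmul, Kc_tmul, bval_R, swR_actR, ZModModule.add_self]
      rfl
    · intro r a m
      rw [LinearMap.mem_ker]
      ext c
      rw [map_add, LinearMap.add_apply, Kc_tmul, Kc_tmul, bval_L, swR_actL, ZModModule.add_self]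
      rfl
  exact this hz

theorem Kc_d (z : T2 C M) (f : (bdual C).V) :
    M.d (Kc C M z f) + Kc C M z ((bdual C).d f) = Kc C M (d2 C M z) f := by
  refine T2_induction _ _ (p := fun z => M.d (Kc C M z f) + Kc C M z ((bdual C).d f) = Kc C M (d2 C M z) f)
    z (by simp) (fun x y hx hy => by simp only [map_add, LinearMap.add_apply, ← hx, ← hy]; abel) ?_
  intro c m
  rw [d2_tmul, map_add, LinearMap.add_apply, Kc_tmul, Kc_tmul, Kc_tmul, Kc_tmul, bval_d, swR_d, map_add]
  rw [← sub_eq_zero]; abel_nf; simp [nsmul2, zsmul2]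

theorem Kc_gr {n : ℤ} {z : T2 C M} (hz : z ∈ gr2 C M n) : Kc C M z ∈ grHomSub (bdual C) M n := by
  have : gr2 C M n ≤ (grHomSub (bdual C) M n).comap (Kc C M) := by
    refine gr2_le _ _ ?_
    rintro p q rfl c hc m hm
    refine ⟨fun i f hf => ?_, fun a f => ?_, fun f a => ?_⟩
    · rw [Kc_tmul]
      exact swR_gr M hm (((bval_gr i f).1 hf).1 p c hc) (by ring)
    · rw [Kc_tmul, bval_actL, swR_inL]; rfl
    · rw [Kc_tmul, bval_actR, swR_inR]; rfl
  exact this hz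

theorem Kc_hom {n : ℤ} {z : T2 C M} (hz : z ∈ gr2 C M n) (hd : d2 C M z ∈ rel2 C M) :
    IsBHom (bdual C) M n (Kc C M z) := by
  refine IsBHom.of_gr (Kc_gr M hz) fun f => ?_
  have := Kc_d M z f
  rw [Kc_rel M hd] at this
  exact (eq_of_add_eq_zero2 this).symm

theorem CB.lT_Kc [Fintype cb.I] {s : ℤ} {β : C.V →ₗ[ZMod 2] R.V} (hβ : β ∈ grHomSub C R s) (w : T2 C M) :
    lT R (Kc C M w) (cb.Xinv R β) + rT β M w ∈ rel2 R M := by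
  classical
  refine T2_induction _ _ (p := fun w => lT R (Kc C M w) (cb.Xinv R β) + rT β M w ∈ rel2 R M) w
    (by simp [CB.Xinv]) ?_ ?_
  · intro x y hx hy
    have := Submodule.add_mem _ hx hy
    convert this using 1
    simp only [CB.Xinv, map_add, LinearMap.add_apply, TensorProduct.tmul_add, map_sum, lT_tmul, Finset.sum_add_distrib]
    abel
  intro c m
  refine cb.induction (p := fun c => lT R (Kc C M (c ⊗ₜ m)) (cb.Xinv R β) + rT β M (c ⊗ₜ m) ∈ rel2 R M) c
    (by simp [CB.Xinv]) ?_ ?_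
  · intro x y hx hy
    have := Submodule.add_mem _ hx hy
    convert this using 1
    simp only [CB.Xinv, map_add, LinearMap.add_apply, TensorProduct.tmul_add, TensorProduct.add_tmul, map_sum, lT_tmul, Finset.sum_add_distrib]
    abel
  intro j a b
  have h1 : lT R (Kc C M (C.actR (C.actL a (cb.g j)) b ⊗ₜ m)) (cb.Xinv R β) =
      β (cb.g j) ⊗ₜ swR M m (tt2 A a b) := by
    rw [CB.Xinv, map_sum, Finset.sum_eq_single j]
    · rw [lT_tmul, Kc_tmul, bval_R, bval_L, cb.gs_g, if_pos rfl, AA_actL, AA_actR, A.mul_one', A.one_mul']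
    · intro i _ hij
      rw [lT_tmul, Kc_tmul, bval_R, bval_L, cb.gs_g, if_neg (fun h => hij h.symm)]
      simp
    · simp
  rw [h1, rT_tmul, hβ.2.2, hβ.2.1]
  exact tmul_swR R M (β (cb.g j)) m (tt2 A a b)

end Xi
end Part9

section Part10
set_option linter.unusedVariables false
set_option linter.unusedSimpArgs false
section Duality

variable {A : DGA (ZMod 2)} {R X : DGBimod A}

theorem pr2_mem (n : ℤ) (x : T2 R X) : pr2 R X n x ∈ gr2 R X n := by
  refine gr_induction (internal_gr2 R X) (p := fun x => pr2 R X n x ∈ gr2 R X n) x (by simp)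
    (fun x y hx hy => by rw [map_add]; exact Submodule.add_mem _ hx hy) ?_
  intro i x hx
  by_cases h : i = n
  · subst h; rwa [pr2_same R X hx]
  · rw [pr2_ne R X h hx]; exact Submodule.zero_mem _

theorem pr2_d2 (n : ℤ) (x : T2 R X) : pr2 R X n (d2 R X x) = d2 R X (pr2 R X (n + 1) x) := by
  refine gr_induction (internal_gr2 R X)
    (p := fun x => pr2 R X n (d2 R X x) = d2 R X (pr2 R X (n + 1) x)) x (by simp)
    (fun x y hx hy => by simp only [map_add, hx, hy]) ?_
  intro i x hx
  by_cases h : i = n + 1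
  · subst h
    have := d2_gr R X hx
    rw [add_sub_cancel_right] at this
    rw [pr2_same R X hx, pr2_same R X this]
  · rw [pr2_ne R X h hx, pr2_ne R X (by intro h'; apply h; linarith) (d2_gr R X hx), map_zero]

/-- Homogeneous functionals on Hochschild chains. -/
def Fn (R X : DGBimod A) (n : ℤ) (l : T2 R X →ₗ[ZMod 2] ZMod 2) : Prop :=
  (∀ z ∈ rel2 R X, l z = 0) ∧ ∀ j, j ≠ n → ∀ z ∈ gr2 R X j, l z = 0

theorem Fn.pr {n : ℤ} {l : T2 R X →ₗ[ZMod 2] ZMod 2} (h : Fn R X n l) (z : T2 R X) :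
    l (pr2 R X n z) = l z := by
  refine gr_induction (internal_gr2 R X) (p := fun z => l (pr2 R X n z) = l z) z (by simp)
    (fun x y hx hy => by simp only [map_add, hx, hy]) ?_
  intro i x hx
  by_cases hi : i = n
  · subst hi; rw [pr2_same R X hx]
  · rw [pr2_ne R X hi hx, h.2 i hi x hx, map_zero]

theorem Fn.of_pr {n : ℤ} {l : T2 R X →ₗ[ZMod 2] ZMod 2} (h : ∀ z ∈ rel2 R X, l z = 0) :
    Fn R X n (l.comp (pr2 R X n)) := by
  refine ⟨fun z hz => h _ (pr2_rel R X n hz), fun j hj z hz => ?_⟩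
  rw [LinearMap.comp_apply, pr2_ne R X hj hz, map_zero]

theorem separate {n : ℤ} {Q : Submodule (ZMod 2) (T2 R X)} (hQ : Q ≤ gr2 R X n) {z : T2 R X}
    (hz : z ∈ gr2 R X n) (hzQ : z ∉ Q ⊔ rel2 R X) :
    ∃ l, Fn R X n l ∧ (∀ x ∈ Q, l x = 0) ∧ l z ≠ 0 := by
  obtain ⟨f, hf, hfQ⟩ := Submodule.exists_le_ker_of_notMem hzQ
  refine ⟨f.comp (pr2 R X n), Fn.of_pr fun x hx => hfQ (Submodule.mem_sup_right hx), ?_, ?_⟩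
  · intro x hx
    rw [LinearMap.comp_apply, pr2_same R X (hQ hx)]
    exact hfQ (Submodule.mem_sup_left hx)
  · rwa [LinearMap.comp_apply, pr2_same R X hz]

theorem Fn.extend {n : ℤ} {l : T2 R X →ₗ[ZMod 2] ZMod 2} (h : Fn R X n l)
    (hc : ∀ x ∈ gr2 R X n, d2 R X x ∈ rel2 R X → l x = 0) :
    ∃ ν, Fn R X (n - 1) ν ∧ ∀ x, l x = ν (d2 R X x) := by
  obtain ⟨e, he⟩ := pseudo_inv ((rel2 R X).mkQ.comp (d2 R X))
  refine ⟨((l.comp e).comp (rel2 R X).mkQ).comp (pr2 R X (n - 1)), Fn.of_pr ?_, ?_⟩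
  · intro z hz
    have : (rel2 R X).mkQ z = 0 := by simpa using hz
    simp only [LinearMap.comp_apply, this, map_zero]
  · intro x
    refine gr_induction (internal_gr2 R X) (p := fun x => l x =
        (((l.comp e).comp (rel2 R X).mkQ).comp (pr2 R X (n - 1))) (d2 R X x)) x (by simp only [map_zero])
      (fun x y hx hy => by simp only [map_add, hx, hy]) ?_
    intro i x hx
    by_cases hi : i = n
    · subst hi
      simp only [LinearMap.comp_apply]
      rw [pr2_same R X (d2_gr R X hx)]
      have h1 := he x
      simp only [LinearMap.comp_apply] at h1
      set y := e ((rel2 R X).mkQ (d2 R X x)) with hy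
      have h2 : d2 R X (x - y) ∈ rel2 R X := by
        have : (rel2 R X).mkQ (d2 R X (x - y)) = 0 := by
          rw [map_sub, map_sub, h1, sub_self]
        exact (Submodule.Quotient.mk_eq_zero _).1 this
      have h3 : l (x - y) = 0 := by
        rw [← h.pr]
        refine hc _ (pr2_mem _ _) ?_
        have := pr2_rel R X (i - 1) h2
        rwa [pr2_d2, sub_add_cancel] at this
      rw [map_sub] at h3
      exact sub_eq_zero.1 h3
    · simp only [LinearMap.comp_apply]
      rw [h.2 i hi x hx, pr2_ne R X (by intro h; apply hi; linarith) (d2_gr R X hx)]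
      simp

theorem dual_lift {V : Type} [AddCommGroup V] [Module (ZMod 2) V] (Y : DGBimod A)
    (f : V →ₗ[ZMod 2] (Y.V →ₗ[ZMod 2] ZMod 2)) (h : ∀ x, f x ∈ ⨆ s, grD Y s) :
    ∃ φ : V →ₗ[ZMod 2] (dual Y).V, ∀ x, dval Y (φ x) = f x :=
  ⟨LinearMap.codRestrict _ f h, fun _ => rfl⟩

theorem Fn.adjR {n : ℤ} {l : T2 R X →ₗ[ZMod 2] ZMod 2} (h : Fn R X n l) :
    ∃ φ ∈ grHomSub X (dual R) (-n), ∀ r x, dval R (φ x) r = l (r ⊗ₜ x) := by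
  have hmem : ∀ i, ∀ x ∈ X.gr i, (TensorProduct.curry l).flip x ∈ grD R (i + -n) := by
    intro i x hx
    rw [mem_grD]
    intro p hp r hr
    exact h.2 (p + i) (by intro h'; apply hp; linarith) _ (tmul_mem_gr2 R X hr hx rfl)
  obtain ⟨φ, hφ⟩ := dual_lift R (TensorProduct.curry l).flip (fun x =>
    gr_induction X.internal (p := fun x => (TensorProduct.curry l).flip x ∈ ⨆ s, grD R s) x (by simp)
      (fun x y hx hy => by rw [map_add]; exact Submodule.add_mem _ hx hy)
      (fun i x hx => Submodule.mem_iSup_of_mem _ (hmem i x hx)))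
  have hv : ∀ r x, dval R (φ x) r = l (r ⊗ₜ x) := fun r x => by rw [hφ]; rfl
  refine ⟨φ, ⟨fun i x hx => ?_, fun a x => ?_, fun x a => ?_⟩, hv⟩
  · rw [dval_gr, hφ]
    exact hmem i x hx
  · apply dval_inj; intro r
    rw [hv, dval_actL, hv]
    have := h.1 _ (rel2_right R X r a x)
    rw [map_add] at this
    exact (eq_of_add_eq_zero2 this).symm
  · apply dval_inj; intro r
    rw [hv, dval_actR, hv]
    have := h.1 _ (rel2_left R X r a x)
    rw [map_add] at this
    exact (eq_of_add_eq_zero2 this).symm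

theorem Fn.adjL {n : ℤ} {l : T2 R X →ₗ[ZMod 2] ZMod 2} (h : Fn R X n l) :
    ∃ φ ∈ grHomSub R (dual X) (-n), ∀ r x, dval X (φ r) x = l (r ⊗ₜ x) := by
  have hmem : ∀ i, ∀ r ∈ R.gr i, (TensorProduct.curry l) r ∈ grD X (i + -n) := by
    intro i r hr
    rw [mem_grD]
    intro p hp x hx
    exact h.2 (i + p) (by intro h'; apply hp; linarith) _ (tmul_mem_gr2 R X hr hx rfl)
  obtain ⟨φ, hφ⟩ := dual_lift X (TensorProduct.curry l) (fun x =>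
    gr_induction R.internal (p := fun x => (TensorProduct.curry l) x ∈ ⨆ s, grD X s) x (by simp)
      (fun x y hx hy => by rw [map_add]; exact Submodule.add_mem _ hx hy)
      (fun i x hx => Submodule.mem_iSup_of_mem _ (hmem i x hx)))
  have hv : ∀ r x, dval X (φ r) x = l (r ⊗ₜ x) := fun r x => by rw [hφ]; rfl
  refine ⟨φ, ⟨fun i x hx => ?_, fun a r => ?_, fun r a => ?_⟩, hv⟩
  · rw [dval_gr, hφ]
    exact hmem i x hx
  · apply dval_inj; intro x
    rw [hv, dval_actL, hv]
    have := h.1 _ (rel2_left R X r a x)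
    rw [map_add] at this
    exact eq_of_add_eq_zero2 this
  · apply dval_inj; intro x
    rw [hv, dval_actR, hv]
    have := h.1 _ (rel2_right R X r a x)
    rw [map_add] at this
    exact eq_of_add_eq_zero2 this

theorem adjR_hom {s : ℤ} {l : T2 R X →ₗ[ZMod 2] ZMod 2} (hd : ∀ x, l (d2 R X x) = 0)
    {φ : X.V →ₗ[ZMod 2] (dual R).V} (hφ : φ ∈ grHomSub X (dual R) s)
    (hv : ∀ r x, dval R (φ x) r = l (r ⊗ₜ x)) : IsBHom X (dual R) s φ := by
  refine IsBHom.of_gr hφ fun x => dval_inj _ fun r => ?_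
  rw [dval_d, hv, hv]
  have := hd (r ⊗ₜ x)
  rw [d2_tmul, map_add] at this
  exact (eq_of_add_eq_zero2 this).symm

theorem adjL_hom {s : ℤ} {l : T2 R X →ₗ[ZMod 2] ZMod 2} (hd : ∀ x, l (d2 R X x) = 0)
    {φ : R.V →ₗ[ZMod 2] (dual X).V} (hφ : φ ∈ grHomSub R (dual X) s)
    (hv : ∀ r x, dval X (φ r) x = l (r ⊗ₜ x)) : IsBHom R (dual X) s φ := by
  refine IsBHom.of_gr hφ fun r => dval_inj _ fun x => ?_
  rw [dval_d, hv, hv]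
  have := hd (r ⊗ₜ x)
  rw [d2_tmul, map_add] at this
  exact eq_of_add_eq_zero2 this

theorem adjR_null {n : ℤ} {l ν : T2 R X →ₗ[ZMod 2] ZMod 2} (hν : Fn R X (n - 1) ν)
    (hl : ∀ x, l x = ν (d2 R X x))
    {φ : X.V →ₗ[ZMod 2] (dual R).V} (hv : ∀ r x, dval R (φ x) r = l (r ⊗ₜ x)) :
    φ ∈ nullHtpSub X (dual R) (-n) := by
  obtain ⟨χ, hχ, hw⟩ := hν.adjR
  rw [mem_nullHtp]
  refine ⟨χ, by rwa [show -(n - 1) = -n + 1 by ring] at hχ, fun x => dval_inj _ fun r => ?_⟩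
  rw [map_add, LinearMap.add_apply, dval_d, hv, hw, hw, hl, d2_tmul, map_add]

theorem adjL_of_null {n : ℤ} {l : T2 R X →ₗ[ZMod 2] ZMod 2}
    {φ : R.V →ₗ[ZMod 2] (dual X).V} (hv : ∀ r x, dval X (φ r) x = l (r ⊗ₜ x))
    (hφ : φ ∈ nullHtpSub R (dual X) n) (z : T2 R X) (hz : d2 R X z ∈ rel2 R X) : l z = 0 := by
  rw [mem_nullHtp] at hφ
  obtain ⟨χ, hχ, hx⟩ := hφ
  let ν : T2 R X →ₗ[ZMod 2] ZMod 2 := TensorProduct.lift ((dval X).comp χ)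
  have h1 : l = ν.comp (d2 R X) := by
    ext r x
    simp only [TensorProduct.AlgebraTensorModule.curry_apply, TensorProduct.curry_apply,
      LinearMap.coe_restrictScalars, LinearMap.comp_apply, d2_tmul, map_add]
    rw [← hv, hx]
    simp only [map_add, LinearMap.add_apply, dval_d, ν, TensorProduct.lift.tmul, LinearMap.comp_apply]
    abel
  have h2 : rel2 R X ≤ LinearMap.ker ν := by
    refine rel2_le _ _ ?_ ?_
    · intro r a m
      simp only [LinearMap.mem_ker, map_add, ν, TensorProduct.lift.tmul, LinearMap.comp_apply]
      rw [hχ.2.2, dval_actR, ZModModule.add_self]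
    · intro r a m
      simp only [LinearMap.mem_ker, map_add, ν, TensorProduct.lift.tmul, LinearMap.comp_apply]
      rw [hχ.2.1, dval_actL, ZModModule.add_self]
  rw [h1]
  exact h2 hz

/-- (5a) -/
theorem acyc_T2 (hR : IsCellRetract R) {σ : X.V →ₗ[ZMod 2] X.V} (hσ : Contr X σ) {n : ℤ}
    {z : T2 R X} (hz : z ∈ gr2 R X n) (hd : d2 R X z ∈ rel2 R X) :
    ∃ w ∈ gr2 R X (n + 1), z + d2 R X w ∈ rel2 R X := by
  by_contra hcon
  have hQ : (gr2 R X (n + 1)).map (d2 R X) ≤ gr2 R X n := by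
    rintro _ ⟨w, hw, rfl⟩
    have := d2_gr R X hw
    rwa [add_sub_cancel_right] at this
  have hzQ : z ∉ (gr2 R X (n + 1)).map (d2 R X) ⊔ rel2 R X := by
    intro h
    obtain ⟨_, ⟨w, hw, rfl⟩, y, hy, h⟩ := Submodule.mem_sup.1 h
    refine hcon ⟨w, hw, ?_⟩
    rwa [← h, add_comm, ← add_assoc, ZModModule.add_self, zero_add]
  obtain ⟨l, hl, hlQ, hlz⟩ := separate hQ hz hzQ
  obtain ⟨φ, hφ, hv⟩ := hl.adjL
  have hld : ∀ x, l (d2 R X x) = 0 := fun x => by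
    rw [← hl.pr, pr2_d2]
    exact hlQ _ ⟨_, pr2_mem _ _, rfl⟩
  have h1 := adjL_hom hld hφ hv
  obtain ⟨σ', hσ'⟩ := hσ.dual
  exact hlz (adjL_of_null hv (hR.null hσ' h1) z hd)

end Duality

section Cyc

variable {A : DGA (ZMod 2)} (R X : DGBimod A)

/-- homogeneous Hochschild cycles -/
def cyc (s : ℤ) : Submodule (ZMod 2) (T2 R X) := gr2 R X s ⊓ (rel2 R X).comap (d2 R X)

/-- class of a cycle -/
def hmk (s : ℤ) : cyc R X s →ₗ[ZMod 2] HH R X s :=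
  (Submodule.mkQ _).comp (Submodule.inclusion (inf_le_inf_right _ le_sup_left))

variable {R X}

theorem hmk_eq_zero {s : ℤ} (z : cyc R X s) :
    hmk R X s z = 0 ↔ ∃ w ∈ gr2 R X (s + 1), z.1 + d2 R X w ∈ rel2 R X := by
  have : hmk R X s z = 0 ↔ z.1 ∈ Submodule.map (d2 R X) (gr2 R X (s + 1) ⊔ rel2 R X) ⊔ rel2 R X :=
    Submodule.Quotient.mk_eq_zero _
  rw [this]
  constructor
  · intro h
    obtain ⟨_, ⟨w, hw, rfl⟩, y, hy, h⟩ := Submodule.mem_sup.1 h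
    obtain ⟨w1, hw1, w2, hw2, rfl⟩ := Submodule.mem_sup.1 hw
    refine ⟨w1, hw1, ?_⟩
    have := Submodule.add_mem _ (d2_rel R X hw2) hy
    convert this using 1
    rw [← h, map_add, ← sub_eq_zero]; abel_nf; simp [nsmul2, zsmul2]
  · rintro ⟨w, hw, h⟩
    refine Submodule.mem_sup.2 ⟨_, ⟨w, Submodule.mem_sup_left hw, rfl⟩, _, h, ?_⟩
    rw [add_comm z.1, add_add_self2]

theorem hmk_surj (s : ℤ) : Function.Surjective (hmk R X s) := by
  intro h
  obtain ⟨⟨z, hz⟩, rfl⟩ := Submodule.Quotient.mk_surjective _ h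
  obtain ⟨z1, hz1, z2, hz2, rfl⟩ := Submodule.mem_sup.1 hz.1
  have hd : d2 R X z1 ∈ rel2 R X := by
    have h1 : d2 R X (z1 + z2) ∈ rel2 R X := hz.2
    rw [map_add] at h1
    exact (Submodule.add_mem_iff_left _ (d2_rel R X hz2)).1 h1
  refine ⟨⟨z1, hz1, hd⟩, ?_⟩
  refine (Submodule.Quotient.eq _).2 ?_
  show z1 - (z1 + z2) ∈ Submodule.map (d2 R X) (gr2 R X (s + 1) ⊔ rel2 R X) ⊔ rel2 R X
  refine Submodule.mem_sup_right ?_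
  simpa using hz2

/-- (6) -/
theorem finite_HH {C : DGBimod A} (cb : CB C) [Finite cb.I] {α : R.V →ₗ[ZMod 2] C.V}
    {β : C.V →ₗ[ZMod 2] R.V} (hα : IsBHom R C 0 α) (hβ : IsBHom C R 0 β)
    (hβα : β.comp α + LinearMap.id ∈ nullHtpSub R R 0)
    {σ : (dual X).V →ₗ[ZMod 2] (dual X).V} (hσ : FinContr (dual X) σ) (s : ℤ) :
    Module.Finite (ZMod 2) (HH R X s) := by
  obtain ⟨J, hJ, c, hc⟩ := cb.finite_htpy hσ (-s)
  have key : ∀ f : HH R X s →ₗ[ZMod 2] ZMod 2, ∃ l, Fn R X s l ∧ (∀ x, l (d2 R X x) = 0) ∧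
      ∀ z : cyc R X s, l z.1 = f (hmk R X s z) := by
    intro f
    obtain ⟨F, hF⟩ := LinearMap.exists_extend (f.comp (hmk R X s))
    have hF' : ∀ z : cyc R X s, F z.1 = f (hmk R X s z) := fun z => by
      rw [← LinearMap.comp_apply, ← hF]; rfl
    refine ⟨F.comp (pr2 R X s), ⟨?_, ?_⟩, ?_, ?_⟩
    · intro z hz
      have h1 := pr2_rel R X s hz
      have h2 : hmk R X s ⟨pr2 R X s z, pr2_mem _ _, d2_rel R X h1⟩ = 0 := by
        rw [hmk_eq_zero]
        exact ⟨0, Submodule.zero_mem _, by simpa using h1⟩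
      have := hF' ⟨pr2 R X s z, pr2_mem _ _, d2_rel R X h1⟩
      rw [h2, map_zero] at this
      exact this
    · intro j hj z hz
      rw [LinearMap.comp_apply, pr2_ne R X hj hz, map_zero]
    · intro x
      have h1 : d2 R X (pr2 R X (s + 1) x) ∈ cyc R X s := by
        refine ⟨?_, ?_⟩
        · rw [← pr2_d2]; exact pr2_mem _ _
        · show d2 R X (d2 R X _) ∈ rel2 R X
          rw [d2_d2]; exact Submodule.zero_mem _
      have h2 : hmk R X s ⟨_, h1⟩ = 0 := by
        rw [hmk_eq_zero]
        refine ⟨_, pr2_mem (s + 1) x, ?_⟩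
        show d2 R X (pr2 R X (s + 1) x) + d2 R X (pr2 R X (s + 1) x) ∈ rel2 R X
        rw [ZModModule.add_self]; exact Submodule.zero_mem _
      rw [LinearMap.comp_apply, pr2_d2]
      have := hF' ⟨_, h1⟩
      rw [h2, map_zero] at this
      exact this
    · intro z
      rw [LinearMap.comp_apply, pr2_same R X z.2.1, hF']
  choose l hl hld hlf using key
  have key2 := fun f => (hl f).adjL
  choose φ hφ hv using key2
  have hhom := fun f => adjL_hom (hld f) (hφ f) (hv f)
  have hcomp : ∀ f, IsBHom C (dual X) (-s) ((φ f).comp β) := fun f => by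
    have := (hhom f).comp hβ
    rwa [zero_add] at this
  have hinj : Function.Injective fun f => c ⟨(φ f).comp β, hcomp f⟩ := by
    intro f f' h
    have h1 := null_comp_right (u := -s) hα (hc _ _ h) (by ring)
    have hff : IsBHom R (dual X) (-s) (φ f + φ f') := (bcmSub _ _ _).add_mem (hhom f) (hhom f')
    have h2 := null_comp_left (u := -s) hβα hff (by ring)
    have h3 := Submodule.add_mem _ h1 h2
    have h4 : φ f + φ f' ∈ nullHtpSub R (dual X) (-s) := by
      convert h3 using 1
      ext x
      simp only [LinearMap.comp_apply, LinearMap.add_apply, LinearMap.id_apply, map_add]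
      rw [← sub_eq_zero]; abel_nf; simp [nsmul2, zsmul2]
    ext h
    obtain ⟨z, rfl⟩ := hmk_surj s h
    rw [← hlf, ← hlf]
    apply eq_of_add_eq_zero2
    exact adjL_of_null (l := l f + l f') (φ := φ f + φ f') (fun r x => by
      simp only [map_add, LinearMap.add_apply, hv]) h4 z.1 z.2.2
  have : Finite (Module.Dual (ZMod 2) (HH R X s)) := Finite.of_injective _ hinj
  have : Module.Finite (ZMod 2) (Module.Dual (ZMod 2) (HH R X s)) := inferInstance
  exact Module.finite_dual_iff (ZMod 2) |>.1 this

theorem finite_HH_bdual {C : DGBimod A} (cb : CB C) [Fintype cb.I] {σ : R.V →ₗ[ZMod 2] R.V}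
    (hσ : FinContr R σ) (s : ℤ) : Module.Finite (ZMod 2) (HH R (bdual C) s) := by
  obtain ⟨J, hJ, c, hc⟩ := cb.finite_bdual R hσ s
  have hinj : Function.Injective fun h : HH R (bdual C) s => c (Function.surjInv (hmk_surj s) h).1 := by
    intro h h' hh
    set z := Function.surjInv (hmk_surj s) h with hz
    set z' := Function.surjInv (hmk_surj s) h' with hz'
    have e1 : hmk _ _ _ z = h := Function.surjInv_eq _ _
    have e2 : hmk _ _ _ z' = h' := Function.surjInv_eq _ _
    have := hc z.1 z.2.1 z'.1 z'.2.1 z.2.2 z'.2.2 hh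
    have h3 := (hmk_eq_zero (z + z')).2 this
    rw [map_add] at h3
    rw [← e1, ← e2, eq_of_add_eq_zero2 h3]
  have : Finite (HH R (bdual C) s) := Finite.of_injective _ hinj
  infer_instance

end Cyc
end Part10

section Part11
set_option linter.unusedVariables false
set_option linter.unusedSimpArgs false
theorem factor_surj {C H H' : Type} [AddCommGroup C] [Module (ZMod 2) C] [AddCommGroup H]
    [Module (ZMod 2) H] [AddCommGroup H'] [Module (ZMod 2) H'] (π : C →ₗ[ZMod 2] H)
    (hπ : Function.Surjective π) (φ : C →ₗ[ZMod 2] H') (h : ∀ c, π c = 0 → φ c = 0) :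
    ∃ φ' : H →ₗ[ZMod 2] H', ∀ c, φ' (π c) = φ c := by
  let E := LinearMap.quotKerEquivOfSurjective π hπ
  refine ⟨((LinearMap.ker π).liftQ φ h).comp E.symm.toLinearMap, fun c => ?_⟩
  have : E.symm (π c) = Submodule.Quotient.mk c := by
    rw [LinearEquiv.symm_apply_eq]; rfl
  show (LinearMap.ker π).liftQ φ h (E.symm (π c)) = φ c
  rw [this]; rfl

theorem dim_count {X Y Z X' Y' Z' : Type} [AddCommGroup X] [Module (ZMod 2) X]
    [AddCommGroup Y] [Module (ZMod 2) Y] [AddCommGroup Z] [Module (ZMod 2) Z]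
    [AddCommGroup X'] [Module (ZMod 2) X'] [AddCommGroup Y'] [Module (ZMod 2) Y']
    [AddCommGroup Z'] [Module (ZMod 2) Z']
    (eX : X' ≃ₗ[ZMod 2] X) (eY : Y' ≃ₗ[ZMod 2] Y) (eZ : Z' ≃ₗ[ZMod 2] Z)
    [Module.Finite (ZMod 2) X] [Module.Finite (ZMod 2) Z]
    (i : X →ₗ[ZMod 2] Y) (p : Y →ₗ[ZMod 2] Z) (hex : ∀ y, p y = 0 → ∃ x, i x = y)
    (i' : X' →ₗ[ZMod 2] Y') (p' : Y' →ₗ[ZMod 2] Z') (hi' : Function.Injective i')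
    (hp' : Function.Surjective p') (h0 : ∀ x, p' (i' x) = 0) : Function.Injective i := by
  have hle : LinearMap.ker p ≤ LinearMap.range i := fun y hy => hex y hy
  have : Module.Finite (ZMod 2) (LinearMap.ker p) := Submodule.finiteDimensional_of_le hle
  have hY : Module.Finite (ZMod 2) Y := by
    have : Module.Finite (ZMod 2) (LinearMap.range p) := inferInstance
    have e := p.quotKerEquivRange
    have : Module.Finite (ZMod 2) (Y ⧸ LinearMap.ker p) := Module.Finite.equiv e.symm
    exact Module.Finite.of_submodule_quotient (LinearMap.ker p)
  have : Module.Finite (ZMod 2) X' := Module.Finite.equiv eX.symm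
  have : Module.Finite (ZMod 2) Y' := Module.Finite.equiv eY.symm
  have : Module.Finite (ZMod 2) Z' := Module.Finite.equiv eZ.symm
  have a1 := LinearMap.finrank_range_add_finrank_ker p
  have a2 := LinearMap.finrank_range_add_finrank_ker p'
  have a3 := LinearMap.finrank_range_add_finrank_ker i
  have a4 := LinearMap.finrank_range_add_finrank_ker i'
  have b1 := Submodule.finrank_mono hle
  have b2 := Submodule.finrank_mono (show LinearMap.range i' ≤ LinearMap.ker p' by
    rintro _ ⟨x, rfl⟩; exact h0 x)
  have b3 := Submodule.finrank_le (LinearMap.range p)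
  rw [LinearMap.ker_eq_bot.2 hi', finrank_bot] at a4
  rw [LinearMap.range_eq_top.2 hp', finrank_top] at a2
  have c1 := eX.finrank_eq
  have c2 := eY.finrank_eq
  have c3 := eZ.finrank_eq
  rw [← LinearMap.ker_eq_bot, ← Submodule.finrank_eq_zero (R := ZMod 2)]
  omega

section

variable {A : DGA (ZMod 2)} {R Ab X Y : DGBimod A}

/-- induced map on Hochschild homology -/
theorem HHmap {s t u : ℤ} {G : X.V →ₗ[ZMod 2] Y.V} (hG : IsBHom X Y s G) (hu : t + s = u) :
    ∃ φ : HH R X t →ₗ[ZMod 2] HH R Y u, ∀ z : cyc R X t, ∃ z' : cyc R Y u,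
      z'.1 = lT R G z.1 ∧ φ (hmk R X t z) = hmk R Y u z' := by
  have hc : ∀ z : cyc R X t, lT R G z.1 ∈ cyc R Y u := fun z => by
    refine ⟨lT_gr hG.grHom hu z.2.1, ?_⟩
    show d2 R Y (lT R G z.1) ∈ rel2 R Y
    rw [← lT_d hG.2.1]
    exact lT_rel hG.grHom z.2.2
  let F : cyc R X t →ₗ[ZMod 2] cyc R Y u :=
    LinearMap.codRestrict _ ((lT R G).comp (Submodule.subtype _)) hc
  obtain ⟨φ, hφ⟩ := factor_surj (hmk R X t) (hmk_surj t) ((hmk R Y u).comp F) (by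
    intro c h
    rw [hmk_eq_zero] at h
    obtain ⟨w, hw, h⟩ := h
    rw [LinearMap.comp_apply, hmk_eq_zero]
    refine ⟨lT R G w, lT_gr hG.grHom (by rw [← hu]; ring) hw, ?_⟩
    show lT R G c.1 + _ ∈ _
    rw [← lT_d hG.2.1, ← map_add]
    exact lT_rel hG.grHom h)
  exact ⟨φ, fun z => ⟨F z, rfl, hφ z⟩⟩

/-- homotopy class -/
def tmk (M N : DGBimod A) (s : ℤ) : bcmSub M N s →ₗ[ZMod 2] HtpyHom M N s := Submodule.mkQ _

theorem tmk_surj {M N : DGBimod A} {s : ℤ} : Function.Surjective (tmk M N s) :=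
  Submodule.mkQ_surjective _

theorem tmk_eq_zero {M N : DGBimod A} {s : ℤ} (f : bcmSub M N s) :
    tmk M N s f = 0 ↔ f.1 ∈ nullHtpSub M N s := Submodule.Quotient.mk_eq_zero _

theorem Htpymap {s t u : ℤ} {G : X.V →ₗ[ZMod 2] Y.V} (hG : IsBHom X Y s G) (hu : t + s = u) :
    ∃ φ : HtpyHom Ab X t →ₗ[ZMod 2] HtpyHom Ab Y u, ∀ (f : bcmSub Ab X t) (g : bcmSub Ab Y u),
      g.1 = G.comp f.1 → φ (tmk _ _ _ f) = tmk _ _ _ g := by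
  have hc : ∀ z : bcmSub Ab X t, G.comp z.1 ∈ bcmSub Ab Y u := fun z => by
    subst hu
    exact hG.comp z.2
  let F : bcmSub Ab X t →ₗ[ZMod 2] bcmSub Ab Y u :=
    LinearMap.codRestrict _ ((LinearMap.llcomp (ZMod 2) Ab.V X.V Y.V G).comp (Submodule.subtype _)) hc
  refine ⟨Submodule.mapQ _ _ F ?_, ?_⟩
  · intro f hf
    exact null_comp_left (f := f.1) hf hG hu
  · intro f g h
    have : g = F f := Subtype.ext h
    rw [this]; rfl

theorem lT_cfst_d {ψ : X.V →ₗ[ZMod 2] Y.V} (hψ : IsBHom X Y 0 ψ) (q : T2 R (cone ψ hψ)) :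
    lT R (cfst ψ hψ) (d2 R _ q) = d2 R Y (lT R (cfst ψ hψ) q)
          + lT R ψ (lT R (csnd ψ hψ) q) := by
  refine T2_induction R _ (p := fun q => lT R (cfst ψ hψ) (d2 R _ q) =
    d2 R Y (lT R (cfst ψ hψ) q) + lT R ψ (lT R (csnd ψ hψ) q)) q (by simp only [map_zero, add_zero]) ?_ ?_
  · intro x y hx hy; simp only [map_add, hx, hy]; abel
  · intro r m
    simp only [lT, d2_tmul, map_add, LinearMap.lTensor_tmul, cfst_d, TensorProduct.tmul_add]
    abel

theorem lT_cone_eta {ψ : X.V →ₗ[ZMod 2] Y.V} (hψ : IsBHom X Y 0 ψ) (q : T2 R (cone ψ hψ)) :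
    q = lT R (cinl ψ hψ) (lT R (cfst ψ hψ) q) + lT R (cinr ψ hψ) (lT R (csnd ψ hψ) q) := by
  refine T2_induction R _ (p := fun q =>
    q = lT R (cinl ψ hψ) (lT R (cfst ψ hψ) q) + lT R (cinr ψ hψ) (lT R (csnd ψ hψ) q)) q
    (by simp only [map_zero, add_zero]) ?_ ?_
  · intro x y hx hy
    simp only [map_add]
    nth_rewrite 1 [hx, hy]
    abel
  · intro r m
    simp only [lT, LinearMap.lTensor_tmul]
    rw [← TensorProduct.tmul_add, ← cone_eta]

theorem lT_csnd_cinr {ψ : X.V →ₗ[ZMod 2] Y.V} (hψ : IsBHom X Y 0 ψ) (q : T2 R X) :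
    lT R (csnd ψ hψ) (lT R (cinr ψ hψ) q) = q := by
  refine T2_induction R _ (p := fun q => lT R (csnd ψ hψ) (lT R (cinr ψ hψ) q) = q) q
    (by simp only [map_zero]) ?_ ?_
  · intro x y hx hy
    simp only [map_add, hx, hy]
  · intro r m
    simp only [lT, LinearMap.lTensor_tmul]
    rfl

theorem lT_csnd_cinl {ψ : X.V →ₗ[ZMod 2] Y.V} (hψ : IsBHom X Y 0 ψ) (q : T2 R Y) :
    lT R (csnd ψ hψ) (lT R (cinl ψ hψ) q) = 0 := by
  refine T2_induction R _ (p := fun q => lT R (csnd ψ hψ) (lT R (cinl ψ hψ) q) = 0) q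
    (by simp only [map_zero]) ?_ ?_
  · intro x y hx hy
    simp only [map_add, hx, hy, add_zero]
  · intro r m
    simp only [lT, LinearMap.lTensor_tmul]
    exact TensorProduct.tmul_zero _ _

theorem lT_cinr_d {ψ : X.V →ₗ[ZMod 2] Y.V} (hψ : IsBHom X Y 0 ψ) (q : T2 R X) :
    lT R (cinl ψ hψ) (lT R ψ q) = d2 R _ (lT R (cinr ψ hψ) q) + lT R (cinr ψ hψ) (d2 R X q) := by
  refine T2_induction R _ (p := fun q => lT R (cinl ψ hψ) (lT R ψ q) =
      d2 R _ (lT R (cinr ψ hψ) q) + lT R (cinr ψ hψ) (d2 R X q)) q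
    (by simp only [map_zero, add_zero]) ?_ ?_
  · intro x y hx hy
    simp only [map_add, hx, hy]; abel
  · intro r m
    simp only [lT, LinearMap.lTensor_tmul, d2_tmul, map_add]
    rw [← cinr_d, TensorProduct.tmul_add, ← sub_eq_zero]; abel_nf; simp [nsmul2, zsmul2]

theorem csnd_cinl {ψ : X.V →ₗ[ZMod 2] Y.V} (hψ : IsBHom X Y 0 ψ) (y) :
    csnd ψ hψ (cinl ψ hψ y) = 0 := rfl
theorem cfst_cinl {ψ : X.V →ₗ[ZMod 2] Y.V} (hψ : IsBHom X Y 0 ψ) (y) :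
    cfst ψ hψ (cinl ψ hψ y) = y := rfl
theorem csnd_cinr {ψ : X.V →ₗ[ZMod 2] Y.V} (hψ : IsBHom X Y 0 ψ) (y) :
    csnd ψ hψ (cinr ψ hψ y) = y := rfl

attribute [local irreducible] cone cinl cinr cfst csnd

theorem exact_mid {ψ : X.V →ₗ[ZMod 2] Y.V} (hψ : IsBHom X Y 0 ψ) {x : T2 R (cone ψ hψ)}
    (hx : x ∈ gr2 R (cone ψ hψ) 0) (hxd : d2 R _ x ∈ rel2 R (cone ψ hψ)) {w : T2 R X}
    (hw : w ∈ gr2 R X 0) (hw2 : lT R (csnd ψ hψ) x + d2 R X w ∈ rel2 R X) :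
    ∃ y ∈ cyc R Y 0, lT R (cinl ψ hψ) y + x + d2 R _ (lT R (cinr ψ hψ) w) ∈
      rel2 R (cone ψ hψ) := by
  obtain ⟨x', hx'⟩ : ∃ x', x' = x + d2 R (cone ψ hψ) (lT R (cinr ψ hψ) w) := ⟨_, rfl⟩
  have hx'g : x' ∈ gr2 R (cone ψ hψ) 0 := by
    rw [hx']
    refine Submodule.add_mem _ hx ?_
    have := d2_gr R _ (lT_gr (cinr_gr ψ hψ) (n' := 1) (by ring) hw)
    rwa [sub_self] at this
  have hx'd : d2 R _ x' ∈ rel2 R (cone ψ hψ) := by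
    rw [hx', map_add, d2_d2, add_zero]; exact hxd
  have hs : lT R (csnd ψ hψ) x' ∈ rel2 R X := by
    rw [hx', map_add, lT_d (csnd_hom ψ hψ).2.1, lT_csnd_cinr]; exact hw2
  refine ⟨lT R (cfst ψ hψ) x', ⟨lT_gr (cfst_gr ψ hψ) (add_zero _) hx'g, ?_⟩, ?_⟩
  · have h1 := lT_rel (cfst_gr ψ hψ) hx'd
    rw [lT_cfst_d] at h1
    exact (Submodule.add_mem_iff_left _ (lT_rel hψ.grHom hs)).1 h1
  · rw [add_assoc, ← hx']
    nth_rewrite 2 [lT_cone_eta hψ x']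
    rw [add_add_self2]
    exact lT_rel (cinr_gr ψ hψ) hs

theorem cinl_null {ψ : X.V →ₗ[ZMod 2] Y.V} (hψ : IsBHom X Y 0 ψ)
    (hnull : ∀ s h, IsBHom Ab X s h → ψ.comp h ∈ nullHtpSub Ab Y s) {h : Ab.V →ₗ[ZMod 2] Y.V}
    (hx' : (cinl ψ hψ).comp h ∈ nullHtpSub Ab (cone ψ hψ) 0) : h ∈ nullHtpSub Ab Y 0 := by
  have hcs : ∀ y, csnd ψ hψ (cinl ψ hψ y) = 0 := csnd_cinl hψ
  have hcf : ∀ y, cfst ψ hψ (cinl ψ hψ y) = y := cfst_cinl hψ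
  have hsr : ∀ y, csnd ψ hψ (cinr ψ hψ y) = y := csnd_cinr hψ
  rw [mem_nullHtp] at hx'
  obtain ⟨H, hH, hHx⟩ := hx'
  have hH2 : IsBHom Ab X 0 ((csnd ψ hψ).comp H) := by
    refine IsBHom.of_gr (by simpa using grHom_comp hH (csnd_hom ψ hψ).grHom) fun x => ?_
    have := congrArg (csnd ψ hψ) (hHx x)
    rw [map_add, LinearMap.comp_apply, hcs, (csnd_hom ψ hψ).2.1] at this
    exact (eq_of_add_eq_zero2 this.symm).symm
  have h1 := hnull _ _ hH2
  have h2 : (ψ.comp ((csnd ψ hψ).comp H)) + h ∈ nullHtpSub Ab Y 0 := by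
    rw [mem_nullHtp]
    refine ⟨(cfst ψ hψ).comp H, by simpa using grHom_comp hH (cfst_gr ψ hψ), fun x => ?_⟩
    have := congrArg (cfst ψ hψ) (hHx x)
    rw [map_add, LinearMap.comp_apply, hcf, cfst_d] at this
    simp only [LinearMap.add_apply, LinearMap.comp_apply]
    rw [this, ← sub_eq_zero]; abel_nf; simp [nsmul2, zsmul2]
  exact (Submodule.add_mem_iff_right _ h1).1 h2

theorem csnd_lift {ψ : X.V →ₗ[ZMod 2] Y.V} (hψ : IsBHom X Y 0 ψ)
    {h : Ab.V →ₗ[ZMod 2] X.V} (hh : IsBHom Ab X (-1) h) (h1 : ψ.comp h ∈ nullHtpSub Ab Y (-1)) :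
    ∃ g, IsBHom Ab (cone ψ hψ) 0 g ∧ (csnd ψ hψ).comp g = h := by
  have hcs : ∀ y, csnd ψ hψ (cinl ψ hψ y) = 0 := csnd_cinl hψ
  have hcf : ∀ y, cfst ψ hψ (cinl ψ hψ y) = y := cfst_cinl hψ
  have hsr : ∀ y, csnd ψ hψ (cinr ψ hψ y) = y := csnd_cinr hψ
  rw [mem_nullHtp] at h1
  obtain ⟨H, hH, hHx⟩ := h1
  have hg : IsBHom Ab (cone ψ hψ) 0 ((cinl ψ hψ).comp H + (cinr ψ hψ).comp h) := by
    refine IsBHom.of_gr ?_ fun x => ?_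
    · refine Submodule.add_mem _ ?_ ?_
      · simpa using grHom_comp hH (cinl_hom ψ hψ).grHom
      · simpa using grHom_comp hh.grHom (cinr_gr ψ hψ)
    · have a1 := cinr_d ψ hψ (h x)
      have a2 := hHx x
      rw [LinearMap.comp_apply] at a2
      rw [a2, map_add] at a1
      have a3 := (cinl_hom ψ hψ).2.1 (H x)
      rw [a3] at a1
      have a4 := hh.2.1 x
      simp only [LinearMap.add_apply, LinearMap.comp_apply, map_add]
      rw [a4]
      have a5 : (cone ψ hψ).d (cinr ψ hψ (h x)) = (cone ψ hψ).d (cinl ψ hψ (H x)) +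
          cinl ψ hψ (H (Ab.d x)) + cinr ψ hψ (X.d (h x)) := by
        rw [← a1, add_assoc, ZModModule.add_self, add_zero]
      rw [a5, ← sub_eq_zero]; abel_nf; simp [nsmul2, zsmul2]
  refine ⟨_, hg, ?_⟩
  ext x
  simp [hcs, hsr]

theorem hit_zero (e : ∀ (M : DGBimod A) (s : ℤ), Nonempty (HtpyHom Ab M s ≃ₗ[ZMod 2] HH R M s))
    {ψ : X.V →ₗ[ZMod 2] Y.V} (hψ : IsBHom X Y 0 ψ)
    (hnull : ∀ s h, IsBHom Ab X s h → ψ.comp h ∈ nullHtpSub Ab Y s)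
    (f1 : Module.Finite (ZMod 2) (HH R Y 0)) (f2 : Module.Finite (ZMod 2) (HH R X (-1)))
    {u : T2 R X} (hu : u ∈ gr2 R X 0) (hdu : d2 R X u ∈ rel2 R X) :
    ∃ w ∈ gr2 R Y 1, lT R ψ u + d2 R Y w ∈ rel2 R Y := by
  obtain ⟨eX⟩ := e Y 0
  obtain ⟨eY⟩ := e (cone ψ hψ) 0
  obtain ⟨eZ⟩ := e X (-1)
  obtain ⟨i, hi⟩ := HHmap (R := R) (t := 0) (u := 0) (cinl_hom ψ hψ) (by norm_num)
  obtain ⟨p, hp⟩ := HHmap (R := R) (t := 0) (u := -1) (csnd_hom ψ hψ) (by norm_num)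
  obtain ⟨i', hi'⟩ := Htpymap (Ab := Ab) (t := 0) (u := 0) (cinl_hom ψ hψ) (by norm_num)
  obtain ⟨p', hp'⟩ := Htpymap (Ab := Ab) (t := 0) (u := -1) (csnd_hom ψ hψ) (by norm_num)
  have hcs : ∀ y, csnd ψ hψ (cinl ψ hψ y) = 0 := csnd_cinl hψ
  have hcf : ∀ y, cfst ψ hψ (cinl ψ hψ y) = y := cfst_cinl hψ
  have hsr : ∀ y, csnd ψ hψ (cinr ψ hψ y) = y := csnd_cinr hψ
  have hinj : Function.Injective i := by
    refine dim_count eX eY eZ i p ?_ i' p' ?_ ?_ ?_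
    · intro y hy
      obtain ⟨x, rfl⟩ := hmk_surj 0 y
      obtain ⟨x1, hx1, hx2⟩ := hp x
      rw [hx2, hmk_eq_zero] at hy
      obtain ⟨w, hw, hw2⟩ := hy
      rw [hx1] at hw2
      have hw' : w ∈ gr2 R X 0 := by rwa [show (-1 : ℤ) + 1 = 0 by norm_num] at hw
      obtain ⟨y0, hy0, h1⟩ := exact_mid hψ x.2.1 x.2.2 hw' hw2
      refine ⟨hmk _ _ _ ⟨y0, hy0⟩, ?_⟩
      obtain ⟨y1, hy1, hy2⟩ := hi ⟨_, hy0⟩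
      rw [hy2]
      apply eq_of_add_eq_zero2
      rw [← map_add, hmk_eq_zero]
      refine ⟨lT R (cinr ψ hψ) w, lT_gr (cinr_gr ψ hψ) (by ring) hw', ?_⟩
      show y1.1 + x.1 + _ ∈ _
      rw [hy1]
      exact h1
    · rw [injective_iff_map_eq_zero]
      intro x hx
      obtain ⟨h, rfl⟩ := tmk_surj x
      have hh : IsBHom Ab (cone ψ hψ) 0 ((cinl ψ hψ).comp h.1) := by
        have := (cinl_hom ψ hψ).comp h.2
        rwa [zero_add] at this
      rw [hi' h ⟨_, hh⟩ rfl] at hx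
      have hx' : (cinl ψ hψ).comp h.1 ∈ nullHtpSub Ab (cone ψ hψ) 0 :=
        (tmk_eq_zero _).1 hx
      rw [tmk_eq_zero]
      exact cinl_null hψ hnull hx'
    · intro x
      obtain ⟨h, rfl⟩ := tmk_surj x
      have h1 := hnull _ _ h.2
      obtain ⟨g, hg, hgh⟩ := csnd_lift hψ h.2 h1
      exact ⟨tmk _ _ _ ⟨g, hg⟩, hp' _ _ hgh.symm⟩
    · intro x
      obtain ⟨h, rfl⟩ := tmk_surj x
      have hh : IsBHom Ab (cone ψ hψ) 0 ((cinl ψ hψ).comp h.1) := by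
        have := (cinl_hom ψ hψ).comp h.2
        rwa [zero_add] at this
      rw [hi' h ⟨_, hh⟩ rfl, hp' ⟨_, hh⟩ 0 (by ext x; simp [hcs]), map_zero]
  have huc : lT R ψ u ∈ cyc R Y 0 := by
    refine ⟨lT_gr hψ.grHom (add_zero _) hu, ?_⟩
    show d2 R Y _ ∈ rel2 R Y
    rw [← lT_d hψ.2.1]
    exact lT_rel hψ.grHom hdu
  have h0 : hmk R Y 0 ⟨_, huc⟩ = 0 := by
    apply hinj
    obtain ⟨z, hz, hz2⟩ := hi ⟨_, huc⟩
    rw [hz2, map_zero, hmk_eq_zero]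
    refine ⟨lT R (cinr ψ hψ) u, lT_gr (cinr_gr ψ hψ) (n := 0) (by norm_num) hu, ?_⟩
    rw [hz]
    show lT R (cinl ψ hψ) (lT R ψ u) + _ ∈ _
    rw [lT_cinr_d, add_comm (d2 _ _ _), add_assoc, ZModModule.add_self, add_zero]
    exact lT_rel (cinr_gr ψ hψ) hdu
  have h3 := (hmk_eq_zero _).1 h0
  rwa [zero_add] at h3

end
end Part11

section Part12
set_option linter.unusedVariables false
set_option linter.unusedSimpArgs false
section
variable {A : DGA (ZMod 2)} {R Ab : DGBimod A}

theorem HH_RR_zero {ρ : R.V →ₗ[ZMod 2] A.diag.V} (hres : IsResolution R A.diag ρ) {m : ℤ}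
    (hsub : Subsingleton (HH R A.diag m)) {x : T2 R R} (hx : x ∈ gr2 R R m)
    (hd : d2 R R x ∈ rel2 R R) : ∃ w ∈ gr2 R R (m + 1), x + d2 R R w ∈ rel2 R R := by
  obtain ⟨hR, hρ, hq⟩ := hres
  obtain ⟨σ, hσ⟩ := (cone_acyc ρ hρ hq).contr
  have hc : lT R ρ x ∈ cyc R A.diag m := by
    refine ⟨lT_gr hρ.grHom (add_zero _) hx, ?_⟩
    show d2 R A.diag _ ∈ rel2 R A.diag
    rw [← lT_d hρ.2.1]
    exact lT_rel hρ.grHom hd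
  obtain ⟨w, hw, hw2⟩ := (hmk_eq_zero ⟨_, hc⟩).1 (Subsingleton.elim _ _)
  have h1 : lT R (cinl ρ hρ) w + lT R (cinr ρ hρ) x ∈ gr2 R (cone ρ hρ) (m + 1) :=
    Submodule.add_mem _ (lT_gr (cinl_hom ρ hρ).grHom (add_zero _) hw) (lT_gr (cinr_gr ρ hρ) rfl hx)
  have h2 : d2 R _ (lT R (cinl ρ hρ) w + lT R (cinr ρ hρ) x) ∈ rel2 R (cone ρ hρ) := by
    have e1 := lT_cinr_d hρ x
    have e2 := lT_d (R := R) (cinl_hom ρ hρ).2.1 w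
    have e3 := Submodule.add_mem _ (lT_rel (cinl_hom ρ hρ).grHom hw2) (lT_rel (cinr_gr ρ hρ) hd)
    convert e3 using 1
    simp only [map_add]
    rw [e1, e2, ← sub_eq_zero]; abel_nf; simp [nsmul2, zsmul2]
  obtain ⟨v, hv, hv2⟩ := acyc_T2 hR hσ h1 h2
  refine ⟨lT R (csnd ρ hρ) v, lT_gr (csnd_hom ρ hρ).grHom (by ring) hv, ?_⟩
  have := lT_rel (csnd_hom ρ hρ).grHom hv2
  rwa [map_add, map_add, lT_csnd_cinl, lT_csnd_cinr, zero_add, lT_d (csnd_hom ρ hρ).2.1] at this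

/-- The generating classes of `HH(M)`. -/
def genSet (R M : DGBimod A) (m : ℤ) : Set (T2 R M) :=
  {y | ∃ (s j : ℤ) (g : R.V →ₗ[ZMod 2] M.V) (x : T2 R R), IsBHom R M s g ∧ j + s = m ∧
    x ∈ gr2 R R j ∧ d2 R R x ∈ rel2 R R ∧ y = lT R g x}

theorem generation {ρ : R.V →ₗ[ZMod 2] A.diag.V} (hres : IsResolution R A.diag ρ)
    (hsmooth : HomSmooth A) (hproper : HomProper A)
    (e : ∀ (M : DGBimod A) (s : ℤ), Nonempty (HtpyHom Ab M s ≃ₗ[ZMod 2] HH R M s))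
    {M : DGBimod A} {d : ℤ} (hM : IsDNeutral R Ab M d) {m : ℤ} {z : T2 R M}
    (hz : z ∈ gr2 R M m) (hdz : d2 R M z ∈ rel2 R M) :
    z ∈ (Submodule.span (ZMod 2) (genSet R M m) ⊔ (gr2 R M (m + 1)).map (d2 R M)) ⊔ rel2 R M := by
  by_contra hcon
  have hQ : (Submodule.span (ZMod 2) (genSet R M m) ⊔ (gr2 R M (m + 1)).map (d2 R M))
      ≤ gr2 R M m := by
    refine sup_le (Submodule.span_le.2 ?_) ?_
    · rintro _ ⟨s, j, g, x, hg, hj, hx, -, rfl⟩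
      exact lT_gr hg.grHom hj hx
    · rintro _ ⟨w, hw, rfl⟩
      have := d2_gr R M hw
      rwa [add_sub_cancel_right] at this
  obtain ⟨l, hl, hlQ, hlz⟩ := separate hQ hz hcon
  have hld : ∀ x, l (d2 R M x) = 0 := fun x => by
    rw [← hl.pr, pr2_d2]
    exact hlQ _ (Submodule.mem_sup_right ⟨_, pr2_mem _ _, rfl⟩)
  obtain ⟨φ, hφ, hv⟩ := hl.adjR
  have hφh := adjR_hom hld hφ hv
  obtain ⟨f, hf, hfM⟩ := hM
  have hnull : ∀ t h, IsBHom Ab M t h → φ.comp h ∈ nullHtpSub Ab (dual R) (t - m) := by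
    intro t h hh
    obtain ⟨g, hg, hgh⟩ := (hfM (t - d)).2 h (by rwa [sub_add_cancel])
    rw [sub_add_cancel] at hgh
    have h1 := null_comp_left (u := t - m) hgh hφh (by ring)
    have hFn : Fn R R (m - (t - d)) (l.comp (lT R g)) := by
      refine ⟨fun y hy => hl.1 _ (lT_rel hg.grHom hy), fun j hj y hy => ?_⟩
      exact hl.2 (j + (t - d)) (by intro h; apply hj; linarith) _ (lT_gr hg.grHom rfl hy)
    obtain ⟨ν, hν, hlν⟩ := hFn.extend (fun x hx hdx =>
      hlQ _ (Submodule.mem_sup_left (Submodule.subset_span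
        ⟨t - d, m - (t - d), g, x, hg, by ring, hx, hdx, rfl⟩)))
    have h2 : φ.comp g ∈ nullHtpSub R (dual R) (-(m - (t - d))) :=
      adjR_null hν hlν (fun r x => by
        rw [LinearMap.comp_apply, hv]; simp [lT])
    have h3 := null_comp_right (u := t - m) hf h2 (by ring)
    have h4 := Submodule.add_mem _ h1 h3
    convert h4 using 1
    ext x
    simp
  obtain ⟨C, cb, α, β, hfin, hα, hβ, hβα⟩ := exists_domination hres hsmooth
  have := Fintype.ofFinite cb.I
  obtain ⟨σ, hσ⟩ := finContr_resolution hres hproper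
  obtain ⟨σ1, hσ1⟩ := hσ.dual
  obtain ⟨σ2, hσ2⟩ := hσ1.dual
  have hq : IsBHom (bdual C) M m (Kc C M (rT α M z)) := by
    refine Kc_hom M (rT_gr hα.grHom (add_zero _) hz) ?_
    rw [← rT_d hα.2.1]
    exact rT_rel hα.grHom hdz
  have hψ : IsBHom (bdual C) (dual R) 0 (φ.comp (Kc C M (rT α M z))) := by
    have := hφh.comp hq
    rwa [add_neg_cancel] at this
  have hug : cb.Xinv R β ∈ gr2 R (bdual C) 0 := cb.Xinv_gr R hβ.grHom
  obtain ⟨w, hw, hw2⟩ := hit_zero e hψ (fun s h hh => by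
      have h1 := hnull _ _ (hq.comp hh)
      rwa [add_sub_cancel_right] at h1)
    (finite_HH cb hα hβ hβα hσ2 0) (finite_HH_bdual cb hσ (-1)) hug (cb.d_Xinv_rel R hβ)
  let ev : T2 R (dual R) →ₗ[ZMod 2] ZMod 2 := TensorProduct.lift (dval R).flip
  have hev : ∀ r θ, ev (r ⊗ₜ θ) = dval R θ r := fun r θ => by simp [ev]
  have hevrel : rel2 R (dual R) ≤ LinearMap.ker ev := by
    refine rel2_le _ _ ?_ ?_
    · intro r a m
      rw [LinearMap.mem_ker, map_add, hev, hev, dval_actL, ZModModule.add_self]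
    · intro r a m
      rw [LinearMap.mem_ker, map_add, hev, hev, dval_actR, ZModModule.add_self]
  have hevd : ∀ y, ev (d2 R (dual R) y) = 0 := by
    intro y
    refine T2_induction R _ (p := fun y => ev (d2 R (dual R) y) = 0) y (by simp only [map_zero]) ?_ ?_
    · intro x y hx hy; simp only [map_add, hx, hy, add_zero]
    · intro r θ
      rw [d2_tmul, map_add, hev, hev, dval_d, ZModModule.add_self]
  have hevφ : ∀ y, ev (lT R φ y) = l y := by
    intro y
    refine T2_induction R _ (p := fun y => ev (lT R φ y) = l y) y (by simp only [map_zero]) ?_ ?_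
    · intro x y hx hy; simp only [map_add, hx, hy]
    · intro r x
      rw [lT, LinearMap.lTensor_tmul, hev, hv]
  have h1 : ev (lT R (φ.comp (Kc C M (rT α M z))) (cb.Xinv R β)) = 0 := by
    have : ev _ = 0 := hevrel hw2
    rwa [map_add, hevd, add_zero] at this
  rw [lT, LinearMap.lTensor_comp_apply] at h1
  have h2 : l (lT R (Kc C M (rT α M z)) (cb.Xinv R β)) = 0 := by
    rw [← hevφ]; exact h1
  have h3 := hl.1 _ (cb.lT_Kc R M hβ.grHom (rT α M z))
  rw [map_add, h2, zero_add] at h3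
  rw [mem_nullHtp] at hβα
  obtain ⟨H, hH, hHx⟩ := hβα
  have h4 := congrArg l (rT_htpy (X := M) hHx z)
  rw [map_add, hld, hl.1 _ (rT_rel hH hdz), add_zero] at h4
  have h5 : rT (β.comp α + LinearMap.id) M z = rT β M (rT α M z) + z := by
    simp only [rT, LinearMap.rTensor_add, LinearMap.add_apply, LinearMap.rTensor_comp_apply,
      LinearMap.rTensor_id, LinearMap.id_apply]
  rw [h5, map_add, h3, zero_add] at h4
  exact hlz h4

end
end Part12

section Part13
set_option linter.unusedVariables false
set_option linter.unusedSimpArgs false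
section T4sec
variable {A : DGA (ZMod 2)} (R M : DGBimod A)

/-- The product `T2 × T2 → T4`. -/
def tt : T2 R M →ₗ[ZMod 2] T2 R M →ₗ[ZMod 2] T4 R M :=
  (TensorProduct.mk (ZMod 2) (T2 R M) (T2 R M)).compr₂
    (TensorProduct.assoc (ZMod 2) R.V M.V (T2 R M)).toLinearMap

theorem tt_tmul (r : R.V) (m : M.V) (z : T2 R M) : tt R M (r ⊗ₜ m) z = r ⊗ₜ (m ⊗ₜ z) := by
  simp [tt]

theorem assoc_symm_tt (x y : T2 R M) :
    (TensorProduct.assoc (ZMod 2) R.V M.V (T2 R M)).symm (tt R M x y) = x ⊗ₜ y := by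
  simp only [tt, LinearMap.compr₂_apply, TensorProduct.mk_apply, LinearEquiv.coe_coe,
    LinearEquiv.symm_apply_apply]

theorem T4_induction {p : T4 R M → Prop} (x : T4 R M) (h0 : p 0)
    (hadd : ∀ x y, p x → p y → p (x + y)) (ht : ∀ z z', p (tt R M z z')) : p x := by
  have hx : x = (TensorProduct.assoc (ZMod 2) R.V M.V (T2 R M))
      ((TensorProduct.assoc (ZMod 2) R.V M.V (T2 R M)).symm x) := by simp
  rw [hx]
  generalize (TensorProduct.assoc (ZMod 2) R.V M.V (T2 R M)).symm x = y
  induction y using TensorProduct.induction_on with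
  | zero => rw [map_zero]; exact h0
  | tmul a b => exact ht a b
  | add a b ha hb => rw [map_add]; exact hadd _ _ ha hb

theorem T4_hom {P : Type} [AddCommGroup P] [Module (ZMod 2) P] {f g : T4 R M →ₗ[ZMod 2] P}
    (h : ∀ z z', f (tt R M z z') = g (tt R M z z')) (x : T4 R M) : f x = g x := by
  refine T4_induction R M (p := fun x => f x = g x) x (by simp) ?_ h
  intro x y hx hy; rw [map_add, map_add, hx, hy]

theorem tau4_tt (x y : T2 R M) : tau4 R M (tt R M x y) = tt R M y x := by
  simp only [tau4, LinearMap.comp_apply, LinearEquiv.coe_coe, assoc_symm_tt,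
    TensorProduct.comm_tmul]
  rfl

theorem tau_tau (x : T4 R M) : tau4 R M (tau4 R M x) = x := by
  refine T4_hom R M (f := (tau4 R M).comp (tau4 R M)) (g := LinearMap.id) ?_ x
  intro z z'; simp [tau4_tt]

theorem d4_tt (x y : T2 R M) :
    d4 R M (tt R M x y) = tt R M (d2 R M x) y + tt R M x (d2 R M y) := by
  refine T2_induction R M (p := fun x => d4 R M (tt R M x y) =
    tt R M (d2 R M x) y + tt R M x (d2 R M y)) x (by simp) ?_ ?_
  · intro x x' hx hx'
    simp only [map_add, LinearMap.add_apply, hx, hx']; abel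
  · intro r m
    simp only [d2_tmul, map_add, LinearMap.add_apply, tt_tmul]
    simp only [d4, LinearMap.add_apply, TensorProduct.map_tmul, LinearMap.id_apply,
      TensorProduct.tmul_add, d2]
    abel

theorem d4_d4 (x : T4 R M) : d4 R M (d4 R M x) = 0 := by
  refine T4_hom R M (f := (d4 R M).comp (d4 R M)) (g := 0) ?_ x
  intro z z'
  simp only [LinearMap.comp_apply, d4_tt, map_add, d2_d2, LinearMap.zero_apply, map_zero,
    zero_add, add_zero, ZModModule.add_self]

theorem d4_tau (x : T4 R M) : d4 R M (tau4 R M x) = tau4 R M (d4 R M x) := by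
  refine T4_hom R M (f := (d4 R M).comp (tau4 R M)) (g := (tau4 R M).comp (d4 R M)) ?_ x
  intro z z'
  simp only [LinearMap.comp_apply, d4_tt, map_add, tau4_tt]; abel

theorem tt_gr {i j n : ℤ} {x y : T2 R M} (hx : x ∈ gr2 R M i) (hy : y ∈ gr2 R M j)
    (h : i + j = n) : tt R M x y ∈ gr4 R M n := by
  have h1 : gr2 R M i ≤ (gr4 R M n).comap ((tt R M).flip y) := by
    refine gr2_le R M ?_
    intro a b hab r hr m hm
    have h2 : gr2 R M j ≤ (gr4 R M n).comap (tt R M (r ⊗ₜ m)) := by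
      refine gr2_le R M ?_
      intro a' b' hab' r' hr' m' hm'
      rw [Submodule.mem_comap, tt_tmul]
      exact Submodule.subset_span ⟨a, b, a', b', r, hr, m, hm, r', hr', m', hm',
        by rw [← h, ← hab, ← hab']; ring, rfl⟩
    exact h2 hy
  exact h1 hx

theorem gr4_le {n : ℤ} {P : Submodule (ZMod 2) (T4 R M)}
    (h : ∀ i j, i + j = n → ∀ x ∈ gr2 R M i, ∀ y ∈ gr2 R M j, tt R M x y ∈ P) :
    gr4 R M n ≤ P := by
  refine Submodule.span_le.2 ?_
  rintro z ⟨i₁, j₁, i₂, j₂, r, hr, m, hm, r', hr', m', hm', hn, rfl⟩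
  rw [← tt_tmul]
  exact h (i₁ + j₁) (i₂ + j₂) (by rw [← hn]; ring) _ (tmul_mem_gr2 R M hr hm rfl) _
    (tmul_mem_gr2 R M hr' hm' rfl)

theorem d4_gr {n : ℤ} {x : T4 R M} (hx : x ∈ gr4 R M n) : d4 R M x ∈ gr4 R M (n - 1) := by
  have : gr4 R M n ≤ (gr4 R M (n - 1)).comap (d4 R M) := by
    refine gr4_le R M ?_
    intro i j h x hx y hy
    rw [Submodule.mem_comap, d4_tt]
    exact Submodule.add_mem _ (tt_gr R M (d2_gr R M hx) hy (by rw [← h]; ring))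
      (tt_gr R M hx (d2_gr R M hy) (by rw [← h]; ring))
  exact this hx

theorem tau_gr {n : ℤ} {x : T4 R M} (hx : x ∈ gr4 R M n) : tau4 R M x ∈ gr4 R M n := by
  have : gr4 R M n ≤ (gr4 R M n).comap (tau4 R M) := by
    refine gr4_le R M ?_
    intro i j h x hx y hy
    rw [Submodule.mem_comap, tau4_tt]
    exact tt_gr R M hy hx (by rw [← h]; ring)
  exact this hx

/-- Left action on the first factor. -/
def lA (a : A.V) : T2 R M →ₗ[ZMod 2] T2 R M := TensorProduct.map (R.actL a) LinearMap.id
/-- Right action on the second factor. -/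
def rA (a : A.V) : T2 R M →ₗ[ZMod 2] T2 R M := TensorProduct.map LinearMap.id (M.actR.flip a)

@[simp] theorem lA_tmul (a : A.V) (r : R.V) (m : M.V) : lA R M a (r ⊗ₜ m) = R.actL a r ⊗ₜ m := rfl
@[simp] theorem rA_tmul (a : A.V) (r : R.V) (m : M.V) : rA R M a (r ⊗ₜ m) = r ⊗ₜ M.actR m a := rfl

theorem lA_add (a b : A.V) (z : T2 R M) : lA R M (a + b) z = lA R M a z + lA R M b z := by
  simp [lA, TensorProduct.map_add_left]
theorem rA_add (a b : A.V) (z : T2 R M) : rA R M (a + b) z = rA R M a z + rA R M b z := by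
  simp [rA, TensorProduct.map_add_right]
theorem lA_zero (z : T2 R M) : lA R M 0 z = 0 := by
  simp [lA]
theorem rA_zero (z : T2 R M) : rA R M 0 z = 0 := by
  simp [rA]

/-- The inner relation. -/
def inn (r : R.V) (a : A.V) (m : M.V) : T2 R M := (R.actR r a) ⊗ₜ m + r ⊗ₜ (M.actL a m)

theorem rel4_inn (r : R.V) (a : A.V) (m : M.V) (z : T2 R M) :
    tt R M (inn R M r a m) z ∈ rel4 R M := by
  refine T2_induction R M (p := fun z => tt R M (inn R M r a m) z ∈ rel4 R M) z (by simp) ?_ ?_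
  · intro x y hx hy; rw [map_add]; exact Submodule.add_mem _ hx hy
  · intro r' m'
    rw [inn, map_add, LinearMap.add_apply, tt_tmul, tt_tmul]
    exact Submodule.subset_span (Or.inl (Or.inl (Or.inl ⟨r, a, m, r', m', rfl⟩)))

theorem rel4_inn' (r : R.V) (a : A.V) (m : M.V) (z : T2 R M) :
    tt R M z (inn R M r a m) ∈ rel4 R M := by
  refine T2_induction R M (p := fun z => tt R M z (inn R M r a m) ∈ rel4 R M) z (by simp) ?_ ?_
  · intro x y hx hy; rw [map_add, LinearMap.add_apply]; exact Submodule.add_mem _ hx hy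
  · intro r' m'
    rw [inn, map_add, tt_tmul, tt_tmul]
    exact Submodule.subset_span (Or.inr ⟨r', a, m', r, m, rfl⟩)

theorem rel4_LR (a : A.V) (z z' : T2 R M) :
    tt R M (lA R M a z) z' + tt R M z (rA R M a z') ∈ rel4 R M := by
  refine T2_induction R M (p := fun z => tt R M (lA R M a z) z' + tt R M z (rA R M a z') ∈
    rel4 R M) z (by simp) ?_ ?_
  · intro x y hx hy
    convert Submodule.add_mem _ hx hy using 1
    simp only [map_add, LinearMap.add_apply]; abel
  intro r m
  refine T2_induction R M (p := fun z' => tt R M (lA R M a (r ⊗ₜ m)) z' +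
    tt R M (r ⊗ₜ m) (rA R M a z') ∈ rel4 R M) z' (by simp) ?_ ?_
  · intro x y hx hy
    convert Submodule.add_mem _ hx hy using 1
    simp only [map_add, LinearMap.add_apply]; abel
  intro r' m'
  rw [lA_tmul, rA_tmul, tt_tmul, tt_tmul]
  exact Submodule.subset_span (Or.inl (Or.inl (Or.inr ⟨r, a, m, r', m', rfl⟩)))

theorem rel4_RL (a : A.V) (z z' : T2 R M) :
    tt R M (rA R M a z) z' + tt R M z (lA R M a z') ∈ rel4 R M := by
  refine T2_induction R M (p := fun z => tt R M (rA R M a z) z' + tt R M z (lA R M a z') ∈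
    rel4 R M) z (by simp) ?_ ?_
  · intro x y hx hy
    convert Submodule.add_mem _ hx hy using 1
    simp only [map_add, LinearMap.add_apply]; abel
  intro r m
  refine T2_induction R M (p := fun z' => tt R M (rA R M a (r ⊗ₜ m)) z' +
    tt R M (r ⊗ₜ m) (lA R M a z') ∈ rel4 R M) z' (by simp) ?_ ?_
  · intro x y hx hy
    convert Submodule.add_mem _ hx hy using 1
    simp only [map_add, LinearMap.add_apply]; abel
  intro r' m'
  rw [lA_tmul, rA_tmul, tt_tmul, tt_tmul]
  exact Submodule.subset_span (Or.inl (Or.inr ⟨r, a, m, r', m', rfl⟩))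

theorem rel4_le {P : Submodule (ZMod 2) (T4 R M)}
    (h1 : ∀ r a m z, tt R M (inn R M r a m) z ∈ P)
    (h2 : ∀ r a m z, tt R M z (inn R M r a m) ∈ P)
    (h3 : ∀ a z z', tt R M (lA R M a z) z' + tt R M z (rA R M a z') ∈ P)
    (h4 : ∀ a z z', tt R M (rA R M a z) z' + tt R M z (lA R M a z') ∈ P) :
    rel4 R M ≤ P := by
  refine Submodule.span_le.2 ?_
  rintro z (((⟨r, a, m, r', m', rfl⟩ | ⟨r, a, m, r', m', rfl⟩) | ⟨r, a, m, r', m', rfl⟩) |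
    ⟨r, a, m, r', m', rfl⟩)
  · have := h1 r a m (r' ⊗ₜ m')
    rwa [inn, map_add, LinearMap.add_apply, tt_tmul, tt_tmul] at this
  · have := h3 a (r ⊗ₜ m) (r' ⊗ₜ m')
    rwa [lA_tmul, rA_tmul, tt_tmul, tt_tmul] at this
  · have := h4 a (r ⊗ₜ m) (r' ⊗ₜ m')
    rwa [lA_tmul, rA_tmul, tt_tmul, tt_tmul] at this
  · have := h2 r' a m' (r ⊗ₜ m)
    rwa [inn, map_add, tt_tmul, tt_tmul] at this

theorem tau_rel {x : T4 R M} (hx : x ∈ rel4 R M) : tau4 R M x ∈ rel4 R M := by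
  have : rel4 R M ≤ (rel4 R M).comap (tau4 R M) := by
    refine rel4_le R M ?_ ?_ ?_ ?_
    · intro r a m z; rw [Submodule.mem_comap, tau4_tt]; exact rel4_inn' R M r a m z
    · intro r a m z; rw [Submodule.mem_comap, tau4_tt]; exact rel4_inn R M r a m z
    · intro a z z'; rw [Submodule.mem_comap, map_add, tau4_tt, tau4_tt, add_comm]
      exact rel4_RL R M a z' z
    · intro a z z'; rw [Submodule.mem_comap, map_add, tau4_tt, tau4_tt, add_comm]
      exact rel4_LR R M a z' z
  exact this hx

theorem d2_inn (r : R.V) (a : A.V) (m : M.V) : d2 R M (inn R M r a m) =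
    inn R M (R.d r) a m + inn R M r (A.d a) m + inn R M r a (M.d m) := by
  simp only [inn, map_add, d2_tmul, R.leibR, M.leibL, add_tmul, tmul_add]; abel

theorem d2_lA (a : A.V) (z : T2 R M) :
    d2 R M (lA R M a z) = lA R M (A.d a) z + lA R M a (d2 R M z) := by
  refine T2_induction R M (p := fun z => d2 R M (lA R M a z) =
    lA R M (A.d a) z + lA R M a (d2 R M z)) z (by simp) ?_ ?_
  · intro x y hx hy; simp only [map_add, hx, hy]; abel
  · intro r m; simp only [lA_tmul, d2_tmul, R.leibL, map_add, add_tmul]; abel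

theorem d2_rA (a : A.V) (z : T2 R M) :
    d2 R M (rA R M a z) = rA R M (A.d a) z + rA R M a (d2 R M z) := by
  refine T2_induction R M (p := fun z => d2 R M (rA R M a z) =
    rA R M (A.d a) z + rA R M a (d2 R M z)) z (by simp) ?_ ?_
  · intro x y hx hy; simp only [map_add, hx, hy]; abel
  · intro r m; simp only [rA_tmul, d2_tmul, M.leibR, map_add, tmul_add]; abel

theorem d4_rel {x : T4 R M} (hx : x ∈ rel4 R M) : d4 R M x ∈ rel4 R M := by
  have : rel4 R M ≤ (rel4 R M).comap (d4 R M) := by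
    refine rel4_le R M ?_ ?_ ?_ ?_
    · intro r a m z
      rw [Submodule.mem_comap, d4_tt, d2_inn, map_add, map_add, LinearMap.add_apply,
        LinearMap.add_apply]
      exact add_mem (add_mem (add_mem (rel4_inn R M _ _ _ _) (rel4_inn R M _ _ _ _)) (rel4_inn R M _ _ _ _)) (rel4_inn R M _ _ _ _)
    · intro r a m z
      rw [Submodule.mem_comap, d4_tt, d2_inn, map_add, map_add]
      exact add_mem (rel4_inn' R M _ _ _ _) (add_mem (add_mem (rel4_inn' R M _ _ _ _) (rel4_inn' R M _ _ _ _)) (rel4_inn' R M _ _ _ _))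
    · intro a z z'
      rw [Submodule.mem_comap]
      convert add_mem (rel4_LR R M (A.d a) z z') (add_mem (rel4_LR R M a (d2 R M z) z')
        (rel4_LR R M a z (d2 R M z'))) using 1
      simp only [map_add, d4_tt, d2_lA, d2_rA, LinearMap.add_apply]; abel
    · intro a z z'
      rw [Submodule.mem_comap]
      convert add_mem (rel4_RL R M (A.d a) z z') (add_mem (rel4_RL R M a (d2 R M z) z')
        (rel4_RL R M a z (d2 R M z'))) using 1
      simp only [map_add, d4_tt, d2_lA, d2_rA, LinearMap.add_apply]; abel
  exact this hx

theorem lA_gr {i j n : ℤ} {a : A.V} (ha : a ∈ A.gr i) {z : T2 R M} (hz : z ∈ gr2 R M j)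
    (h : i + j = n) : lA R M a z ∈ gr2 R M n := by
  have : gr2 R M j ≤ (gr2 R M n).comap (lA R M a) := by
    refine gr2_le R M ?_
    intro p q hpq r hr m hm
    rw [Submodule.mem_comap, lA_tmul]
    exact tmul_mem_gr2 R M (R.actL_gr i p a ha r hr) hm (by rw [← h, ← hpq]; ring)
  exact this hz

theorem rA_gr {i j n : ℤ} {a : A.V} (ha : a ∈ A.gr i) {z : T2 R M} (hz : z ∈ gr2 R M j)
    (h : i + j = n) : rA R M a z ∈ gr2 R M n := by
  have : gr2 R M j ≤ (gr2 R M n).comap (rA R M a) := by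
    refine gr2_le R M ?_
    intro p q hpq r hr m hm
    rw [Submodule.mem_comap, rA_tmul]
    exact tmul_mem_gr2 R M hr (M.actR_gr q i m hm a ha) (by rw [← h, ← hpq]; ring)
  exact this hz

/-- Projection of `T4` to degree `p`. -/
def pr4 (p : ℤ) : T4 R M →ₗ[ZMod 2] T4 R M :=
  ((TensorProduct.assoc (ZMod 2) R.V M.V (T2 R M)).toLinearMap).comp
    (((Finsupp.lapply p).comp (tdec (internal_gr2 R M) (internal_gr2 R M))).comp
      ((TensorProduct.assoc (ZMod 2) R.V M.V (T2 R M)).symm.toLinearMap))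

theorem pr4_tt (p : ℤ) {i j : ℤ} {x y : T2 R M} (hx : x ∈ gr2 R M i) (hy : y ∈ gr2 R M j) :
    pr4 R M p (tt R M x y) = if i + j = p then tt R M x y else 0 := by
  simp only [pr4, LinearMap.comp_apply, LinearEquiv.coe_coe, assoc_symm_tt,
    tdec_tmul (internal_gr2 R M) (internal_gr2 R M) i j x hx y hy, Finsupp.lapply_apply,
    Finsupp.single_apply]
  split_ifs
  · rfl
  · simp

theorem T4_induction_hom {p : T4 R M → Prop} (x : T4 R M) (h0 : p 0)
    (hadd : ∀ x y, p x → p y → p (x + y))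
    (ht : ∀ i j, ∀ z ∈ gr2 R M i, ∀ z' ∈ gr2 R M j, p (tt R M z z')) : p x := by
  refine T4_induction R M (p := p) x h0 hadd ?_
  intro z z'
  refine gr_induction (internal_gr2 R M) (p := fun z => p (tt R M z z')) z (by simpa using h0) ?_ ?_
  · intro x y hx hy; rw [map_add]; exact hadd _ _ hx hy
  intro i z hz
  refine gr_induction (internal_gr2 R M) (p := fun z' => p (tt R M z z')) z' (by simpa using h0)
    ?_ ?_
  · intro x y hx hy; rw [map_add]; exact hadd _ _ hx hy
  intro j z' hz'
  exact ht i j z hz z' hz'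

theorem pr4_tau (p : ℤ) (x : T4 R M) : pr4 R M p (tau4 R M x) = tau4 R M (pr4 R M p x) := by
  refine T4_induction_hom R M (p := fun x => pr4 R M p (tau4 R M x) = tau4 R M (pr4 R M p x)) x
    (by simp) ?_ ?_
  · intro x y hx hy; simp only [map_add, hx, hy]
  intro i j z hz z' hz'
  rw [tau4_tt, pr4_tt R M p hz' hz, pr4_tt R M p hz hz', add_comm j i]
  split_ifs
  · rw [tau4_tt]
  · simp

theorem pr4_mem (p : ℤ) (x : T4 R M) : pr4 R M p x ∈ gr4 R M p := by
  refine T4_induction_hom R M (p := fun x => pr4 R M p x ∈ gr4 R M p) x (by simp) ?_ ?_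
  · intro x y hx hy; rw [map_add]; exact add_mem hx hy
  intro i j z hz z' hz'
  rw [pr4_tt R M p hz hz']
  split_ifs with h
  · exact tt_gr R M hz hz' h
  · exact zero_mem _

theorem pr4_same {p : ℤ} {x : T4 R M} (hx : x ∈ gr4 R M p) : pr4 R M p x = x := by
  have : gr4 R M p ≤ LinearMap.eqLocus (pr4 R M p) LinearMap.id := by
    refine gr4_le R M ?_
    intro i j h x hx y hy
    rw [LinearMap.mem_eqLocus, pr4_tt R M p hx hy, if_pos h]; rfl
  exact this hx

theorem pr4_ne {p q : ℤ} (hpq : q ≠ p) {x : T4 R M} (hx : x ∈ gr4 R M q) : pr4 R M p x = 0 := by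
  have : gr4 R M q ≤ LinearMap.ker (pr4 R M p) := by
    refine gr4_le R M ?_
    intro i j h x hx y hy
    rw [LinearMap.mem_ker, pr4_tt R M p hx hy, if_neg (by rw [h]; exact hpq)]
  exact this hx

theorem pr4_rel_aux (p q : ℤ) {x : T4 R M} (hx : x ∈ gr4 R M q) (hr : x ∈ rel4 R M) :
    pr4 R M p x ∈ rel4 R M := by
  by_cases h : q = p
  · subst h; rwa [pr4_same R M hx]
  · rw [pr4_ne R M h hx]; exact zero_mem _

theorem inn_gr {i j l : ℤ} {r : R.V} {a : A.V} {m : M.V} (hr : r ∈ R.gr i) (ha : a ∈ A.gr j)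
    (hm : m ∈ M.gr l) : inn R M r a m ∈ gr2 R M (i + j + l) :=
  add_mem (tmul_mem_gr2 R M (R.actR_gr i j r hr a ha) hm rfl)
    (tmul_mem_gr2 R M hr (M.actL_gr j l a ha m hm) (by ring))

theorem pr4_inn (p : ℤ) (r : R.V) (a : A.V) (m : M.V) (z : T2 R M) :
    pr4 R M p (tt R M (inn R M r a m) z) ∈ rel4 R M := by
  refine gr_induction R.internal (p := fun r => pr4 R M p (tt R M (inn R M r a m) z) ∈ rel4 R M)
    r (by simp [inn]) ?_ ?_
  · intro x y hx hy
    convert add_mem hx hy using 1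
    simp only [inn, map_add, LinearMap.add_apply, add_tmul, tmul_add]; abel
  intro i r hr
  refine gr_induction A.internal (p := fun a => pr4 R M p (tt R M (inn R M r a m) z) ∈ rel4 R M)
    a (by simp [inn]) ?_ ?_
  · intro x y hx hy
    convert add_mem hx hy using 1
    simp only [inn, map_add, LinearMap.add_apply, add_tmul, tmul_add]; abel
  intro j a ha
  refine gr_induction M.internal (p := fun m => pr4 R M p (tt R M (inn R M r a m) z) ∈ rel4 R M)
    m (by simp [inn]) ?_ ?_
  · intro x y hx hy
    convert add_mem hx hy using 1
    simp only [inn, map_add, LinearMap.add_apply, add_tmul, tmul_add]; abel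
  intro l m hm
  refine gr_induction (internal_gr2 R M)
    (p := fun z => pr4 R M p (tt R M (inn R M r a m) z) ∈ rel4 R M) z (by simp) ?_ ?_
  · intro x y hx hy; rw [map_add, map_add]; exact add_mem hx hy
  intro q z hz
  exact pr4_rel_aux R M p _ (tt_gr R M (inn_gr R M hr ha hm) hz rfl) (rel4_inn R M r a m z)

theorem pr4_LR (p : ℤ) (a : A.V) (z z' : T2 R M) :
    pr4 R M p (tt R M (lA R M a z) z' + tt R M z (rA R M a z')) ∈ rel4 R M := by
  refine gr_induction A.internal (p := fun a => pr4 R M p (tt R M (lA R M a z) z' +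
    tt R M z (rA R M a z')) ∈ rel4 R M) a (by simp [lA_zero, rA_zero]) ?_ ?_
  · intro x y hx hy
    convert add_mem hx hy using 1
    simp only [lA_add, rA_add, map_add, LinearMap.add_apply]; abel
  intro i a ha
  refine gr_induction (internal_gr2 R M) (p := fun z => pr4 R M p (tt R M (lA R M a z) z' +
    tt R M z (rA R M a z')) ∈ rel4 R M) z (by simp) ?_ ?_
  · intro x y hx hy
    convert add_mem hx hy using 1
    simp only [map_add, LinearMap.add_apply]; abel
  intro j z hz
  refine gr_induction (internal_gr2 R M) (p := fun z' => pr4 R M p (tt R M (lA R M a z) z' +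
    tt R M z (rA R M a z')) ∈ rel4 R M) z' (by simp) ?_ ?_
  · intro x y hx hy
    convert add_mem hx hy using 1
    simp only [map_add, LinearMap.add_apply]; abel
  intro l z' hz'
  exact pr4_rel_aux R M p (i + j + l) (add_mem (tt_gr R M (lA_gr R M ha hz rfl) hz' rfl)
    (tt_gr R M hz (rA_gr R M ha hz' rfl) (by ring))) (rel4_LR R M a z z')

theorem pr4_rel (p : ℤ) {x : T4 R M} (hx : x ∈ rel4 R M) : pr4 R M p x ∈ rel4 R M := by
  have : rel4 R M ≤ (rel4 R M).comap (pr4 R M p) := by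
    refine rel4_le R M ?_ ?_ ?_ ?_
    · intro r a m z; exact pr4_inn R M p r a m z
    · intro r a m z
      have := tau_rel R M (pr4_inn R M p r a m z)
      rwa [← pr4_tau, tau4_tt] at this
    · intro a z z'; exact pr4_LR R M p a z z'
    · intro a z z'
      have := tau_rel R M (pr4_LR R M p a z' z)
      rwa [← pr4_tau, map_add, tau4_tt, tau4_tt, add_comm] at this
  exact this hx

theorem Q_add (x y : T2 R M) : tt R M (x + y) (x + y) =
    tt R M x x + tt R M y y + (tt R M x y + tau4 R M (tt R M x y)) := by
  simp only [map_add, LinearMap.add_apply, tau4_tt]; abel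

theorem pr4_Q (p : ℤ) (z : T2 R M) : ∃ v, (∀ m, p = 2 * m → pr4 R M p (tt R M z z) =
      tt R M (pr2 R M m z) (pr2 R M m z) + (v + tau4 R M v)) ∧
      ((∀ m, p ≠ 2 * m) → pr4 R M p (tt R M z z) = v + tau4 R M v) := by
  refine gr_induction (internal_gr2 R M) (p := fun z => ∃ v, (∀ m, p = 2 * m →
      pr4 R M p (tt R M z z) = tt R M (pr2 R M m z) (pr2 R M m z) + (v + tau4 R M v)) ∧
      ((∀ m, p ≠ 2 * m) → pr4 R M p (tt R M z z) = v + tau4 R M v)) z ⟨0, by simp⟩ ?_ ?_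
  · rintro x y ⟨v, hv, hv'⟩ ⟨w, hw, hw'⟩
    by_cases h : ∃ m, p = 2 * m
    · obtain ⟨m, hm⟩ := h
      refine ⟨v + w + pr4 R M p (tt R M x y) + tt R M (pr2 R M m x) (pr2 R M m y), ?_,
        fun h => absurd hm (h m)⟩
      intro m' hm'
      have : m' = m := by omega
      subst this
      rw [Q_add, map_add, map_add, map_add, hv m' hm, hw m' hm, map_add, Q_add, pr4_tau]
      simp only [map_add]
      rw [← sub_eq_zero]; abel_nf; simp [nsmul2, zsmul2]
    · push Not at h
      refine ⟨v + w + pr4 R M p (tt R M x y), fun m hm => absurd hm (h m), fun _ => ?_⟩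
      rw [Q_add, map_add, map_add, map_add, hv' h, hw' h, pr4_tau]
      simp only [map_add]; abel
  · intro i z hz
    refine ⟨0, ?_, ?_⟩
    · intro m hm
      rw [pr4_tt R M p hz hz]
      by_cases h : i = m
      · subst h; rw [if_pos (by omega), pr2_same R M hz]; simp
      · rw [if_neg (by omega), pr2_ne R M h hz]; simp
    · intro h
      rw [pr4_tt R M p hz hz, if_neg]
      · simp
      · have := h i; omega

end T4sec

section m4sec
variable {A : DGA (ZMod 2)} {R S M N : DGBimod A}

/-- Functoriality of `T2` in both variables. -/
def m2 (G : R.V →ₗ[ZMod 2] S.V) (g : M.V →ₗ[ZMod 2] N.V) : T2 R M →ₗ[ZMod 2] T2 S N :=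
  TensorProduct.map G g
/-- Functoriality of `T4`. -/
def m4 (G : R.V →ₗ[ZMod 2] S.V) (g : M.V →ₗ[ZMod 2] N.V) : T4 R M →ₗ[ZMod 2] T4 S N :=
  TensorProduct.map G (TensorProduct.map g (TensorProduct.map G g))

variable (G : R.V →ₗ[ZMod 2] S.V) (g : M.V →ₗ[ZMod 2] N.V)

@[simp] theorem m2_tmul (r : R.V) (m : M.V) : m2 G g (r ⊗ₜ m) = G r ⊗ₜ g m := rfl

theorem m4_tt (x y : T2 R M) : m4 G g (tt R M x y) = tt S N (m2 G g x) (m2 G g y) := by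
  refine T2_induction R M (p := fun x => m4 G g (tt R M x y) = tt S N (m2 G g x) (m2 G g y)) x
    (by simp) ?_ ?_
  · intro x x' hx hx'
    simp only [map_add, LinearMap.add_apply, hx, hx']
  · intro r m
    rw [tt_tmul, m2_tmul, tt_tmul]; rfl

theorem m4_tau (x : T4 R M) : m4 G g (tau4 R M x) = tau4 S N (m4 G g x) := by
  refine T4_hom R M (f := (m4 G g).comp (tau4 R M)) (g := (tau4 S N).comp (m4 G g)) ?_ x
  intro z z'
  simp only [LinearMap.comp_apply, m4_tt, tau4_tt]

theorem m2_d (hG : ∀ x, G (R.d x) = S.d (G x)) (hg : ∀ x, g (M.d x) = N.d (g x)) (x : T2 R M) :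
    m2 G g (d2 R M x) = d2 S N (m2 G g x) := by
  refine T2_induction R M (p := fun x => m2 G g (d2 R M x) = d2 S N (m2 G g x)) x (by simp) ?_ ?_
  · intro x y hx hy; simp only [map_add, hx, hy]
  · intro r m; simp [d2_tmul, hG, hg]

theorem m4_d (hG : ∀ x, G (R.d x) = S.d (G x)) (hg : ∀ x, g (M.d x) = N.d (g x)) (x : T4 R M) :
    m4 G g (d4 R M x) = d4 S N (m4 G g x) := by
  refine T4_hom R M (f := (m4 G g).comp (d4 R M)) (g := (d4 S N).comp (m4 G g)) ?_ x
  intro z z'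
  simp only [LinearMap.comp_apply, m4_tt, d4_tt, map_add, m2_d G g hG hg]

variable {G g} {s t : ℤ}

theorem m2_gr (hG : G ∈ grHomSub R S s) (hg : g ∈ grHomSub M N t) {n n' : ℤ} (h : n + (s + t) = n') {x : T2 R M} (hx : x ∈ gr2 R M n) :
    m2 G g x ∈ gr2 S N n' := by
  have : gr2 R M n ≤ (gr2 S N n').comap (m2 G g) := by
    refine gr2_le R M ?_
    rintro i j hij r hr m hm
    rw [Submodule.mem_comap, m2_tmul]
    exact tmul_mem_gr2 S N (hG.1 i r hr) (hg.1 j m hm) (by rw [← h, ← hij]; ring)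
  exact this hx

theorem m4_gr (hG : G ∈ grHomSub R S s) (hg : g ∈ grHomSub M N t) {n n' : ℤ} (h : n + 2 * (s + t) = n') {x : T4 R M} (hx : x ∈ gr4 R M n) :
    m4 G g x ∈ gr4 S N n' := by
  have : gr4 R M n ≤ (gr4 S N n').comap (m4 G g) := by
    refine gr4_le R M ?_
    rintro i j hij x hx y hy
    rw [Submodule.mem_comap, m4_tt]
    exact tt_gr S N (m2_gr hG hg rfl hx) (m2_gr hG hg rfl hy) (by rw [← h, ← hij]; ring)
  exact this hx

theorem m2_inn (hG : G ∈ grHomSub R S s) (hg : g ∈ grHomSub M N t)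
    (r : R.V) (a : A.V) (m : M.V) :
    m2 G g (inn R M r a m) = inn S N (G r) a (g m) := by
  simp [inn, hG.2.2, hg.2.1]

theorem m2_lA (hG : G ∈ grHomSub R S s) (hg : g ∈ grHomSub M N t)
    (a : A.V) (z : T2 R M) : m2 G g (lA R M a z) = lA S N a (m2 G g z) := by
  refine T2_induction R M (p := fun z => m2 G g (lA R M a z) = lA S N a (m2 G g z)) z (by simp) ?_ ?_
  · intro x y hx hy; simp only [map_add, hx, hy]
  · intro r m; simp [hG.2.1]

theorem m2_rA (hG : G ∈ grHomSub R S s) (hg : g ∈ grHomSub M N t)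
    (a : A.V) (z : T2 R M) : m2 G g (rA R M a z) = rA S N a (m2 G g z) := by
  refine T2_induction R M (p := fun z => m2 G g (rA R M a z) = rA S N a (m2 G g z)) z (by simp) ?_ ?_
  · intro x y hx hy; simp only [map_add, hx, hy]
  · intro r m; simp [hg.2.2]

theorem m4_rel (hG : G ∈ grHomSub R S s) (hg : g ∈ grHomSub M N t) {x : T4 R M} (hx : x ∈ rel4 R M) : m4 G g x ∈ rel4 S N := by
  have : rel4 R M ≤ (rel4 S N).comap (m4 G g) := by
    refine rel4_le R M ?_ ?_ ?_ ?_
    · intro r a m z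
      rw [Submodule.mem_comap, m4_tt, m2_inn hG hg]; exact rel4_inn S N _ _ _ _
    · intro r a m z
      rw [Submodule.mem_comap, m4_tt, m2_inn hG hg]; exact rel4_inn' S N _ _ _ _
    · intro a z z'
      rw [Submodule.mem_comap, map_add, m4_tt, m4_tt, m2_lA hG hg, m2_rA hG hg]; exact rel4_LR S N _ _ _
    · intro a z z'
      rw [Submodule.mem_comap, map_add, m4_tt, m4_tt, m2_lA hG hg, m2_rA hG hg]; exact rel4_RL S N _ _ _
  exact this hx

end m4sec
end Part13

section Part14
set_option linter.unusedVariables false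
set_option linter.unusedSimpArgs false
section LinAlg
variable {W : Type} [AddCommGroup W] [Module (ZMod 2) W]

/-- The swap on `W ⊗ W`. -/
def sw : W ⊗[ZMod 2] W →ₗ[ZMod 2] W ⊗[ZMod 2] W := (TensorProduct.comm (ZMod 2) W W).toLinearMap

@[simp] theorem sw_tmul (a b : W) : sw (a ⊗ₜ[ZMod 2] b) = b ⊗ₜ a := rfl

/-- Squares plus norms. -/
def sqSub (W : Type) [AddCommGroup W] [Module (ZMod 2) W] :
    Submodule (ZMod 2) (W ⊗[ZMod 2] W) where
  carrier := {y | ∃ w v, y = w ⊗ₜ w + (v + sw v)}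
  zero_mem' := ⟨0, 0, by simp⟩
  add_mem' := by
    rintro _ _ ⟨w, v, rfl⟩ ⟨w', v', rfl⟩
    refine ⟨w + w', v + v' + w ⊗ₜ w', ?_⟩
    simp only [map_add, sw_tmul, add_tmul, tmul_add]
    rw [← sub_eq_zero]; abel_nf; simp [nsmul2, zsmul2]
  smul_mem' := by
    rintro c _ ⟨w, v, rfl⟩
    have hc : c = 0 ∨ c = 1 := by revert c; decide
    rcases hc with rfl | rfl
    · exact ⟨0, 0, by simp⟩
    · exact ⟨w, v, by simp⟩

theorem sym_sq (y : W ⊗[ZMod 2] W) (hy : sw y = y) : ∃ w v, y = w ⊗ₜ w + (v + sw v) := by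
  classical
  let b := Module.Basis.ofVectorSpace (ZMod 2) W
  let o : LinearOrder (Module.Basis.ofVectorSpaceIndex (ZMod 2) W) :=
    linearOrderOfSTO WellOrderingRel
  let bb := b.tensorProduct b
  let U : W ⊗[ZMod 2] W →ₗ[ZMod 2] W ⊗[ZMod 2] W :=
    bb.constr (ZMod 2) (fun p => if p.1 < p.2 then b p.1 ⊗ₜ b p.2 else 0)
  let Dg : W ⊗[ZMod 2] W →ₗ[ZMod 2] W ⊗[ZMod 2] W :=
    bb.constr (ZMod 2) (fun p => if p.1 = p.2 then b p.1 ⊗ₜ b p.2 else 0)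
  have hU : ∀ i j, U (b i ⊗ₜ b j) = if i < j then b i ⊗ₜ b j else 0 := by
    intro i j
    have := bb.constr_basis (ZMod 2) (fun p => if p.1 < p.2 then b p.1 ⊗ₜ[ZMod 2] b p.2 else 0) (i, j)
    rwa [Module.Basis.tensorProduct_apply] at this
  have hD : ∀ i j, Dg (b i ⊗ₜ b j) = if i = j then b i ⊗ₜ b j else 0 := by
    intro i j
    have := bb.constr_basis (ZMod 2) (fun p => if p.1 = p.2 then b p.1 ⊗ₜ[ZMod 2] b p.2 else 0) (i, j)
    rwa [Module.Basis.tensorProduct_apply] at this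
  have key : ∀ x, x = U x + Dg x + sw (U (sw x)) := by
    have : LinearMap.id = U + Dg + sw.comp (U.comp sw) := by
      refine bb.ext ?_
      rintro ⟨i, j⟩
      simp only [bb, Module.Basis.tensorProduct_apply, LinearMap.add_apply, LinearMap.comp_apply,
        LinearMap.id_apply, sw_tmul, hU, hD]
      rcases lt_trichotomy i j with h | h | h
      · simp [h, h.ne, h.le, h.not_gt]
      · subst h; simp
      · simp [h, h.ne', h.not_gt]
    intro x
    exact LinearMap.congr_fun this x
  have hDs : ∀ x, Dg x ∈ sqSub W := by
    have : LinearMap.range Dg ≤ sqSub W := by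
      rw [Module.Basis.constr_range, Submodule.span_le]
      rintro _ ⟨⟨i, j⟩, rfl⟩
      simp only
      split_ifs with h
      · subst h; exact ⟨b i, 0, by simp⟩
      · exact zero_mem _
    intro x; exact this ⟨x, rfl⟩
  obtain ⟨w, v, hw⟩ := hDs y
  refine ⟨w, v + U y, ?_⟩
  have := key y
  rw [hy, hw] at this
  rw [map_add]
  refine this.trans ?_
  abel

theorem sq_zero (w : W) (v : W ⊗[ZMod 2] W) (h : w ⊗ₜ w = v + sw v) : w = 0 := by
  rw [← Module.forall_dual_apply_eq_zero_iff (ZMod 2) w]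
  intro φ
  let F : W ⊗[ZMod 2] W →ₗ[ZMod 2] ZMod 2 :=
    TensorProduct.lift ((LinearMap.mul (ZMod 2) (ZMod 2)).compl₁₂ φ φ)
  have hF : ∀ x, F (sw x) = F x := by
    intro x
    have : F.comp sw = F := by
      apply TensorProduct.ext'
      intro a b; simp [F, mul_comm]
    exact LinearMap.congr_fun this x
  have h1 := congrArg F h
  rw [map_add, hF, ZModModule.add_self] at h1
  simpa [F] using h1

end LinAlg

section Tate
variable {A : DGA (ZMod 2)} {C : DGBimod A} (cb : CB C) (M : DGBimod A)

abbrev WW := cb.I →₀ M.V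

/-- The right action on `W`. -/
def wR : A.V →ₗ[ZMod 2] WW cb M →ₗ[ZMod 2] WW cb M :=
  LinearMap.mk₂ (ZMod 2) (fun a w => Finsupp.mapRange.linearMap (M.actR.flip a) w)
    (by intro a b w; ext i; simp) (by intro c a w; ext i; simp)
    (by intro a w w'; rw [map_add]) (by intro c a w; rw [map_smul])

theorem wR_single (a : A.V) (i : cb.I) (m : M.V) :
    wR cb M a (Finsupp.single i m) = Finsupp.single i (M.actR m a) := by
  simp [wR]

theorem wR_mul (a b : A.V) (w : WW cb M) : wR cb M b (wR cb M a w) = wR cb M (A.mul a b) w := by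
  ext i; simp [wR, M.actR_mul]

/-- Left action on `A ⊗ W`. -/
def AL (a : A.V) : A.V ⊗[ZMod 2] WW cb M →ₗ[ZMod 2] A.V ⊗[ZMod 2] WW cb M :=
  TensorProduct.map (A.mul a) LinearMap.id
/-- Right action on `A ⊗ W`. -/
def AR (a : A.V) : A.V ⊗[ZMod 2] WW cb M →ₗ[ZMod 2] A.V ⊗[ZMod 2] WW cb M :=
  TensorProduct.map LinearMap.id (wR cb M a)

/-- Auxiliary. -/
def ee0 (i : cb.I) : A.V →ₗ[ZMod 2] A.V →ₗ[ZMod 2] (M.V →ₗ[ZMod 2] A.V ⊗[ZMod 2] WW cb M) :=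
  LinearMap.mk₂ (ZMod 2) (fun x y => (TensorProduct.mk (ZMod 2) A.V (WW cb M) x).comp
      ((Finsupp.lsingle i).comp (M.actL y)))
    (by intro a b w; ext m; simp) (by intro c a w; ext m; simp)
    (by intro a w w'; ext m; simp [tmul_add])
    (by intro c a w; ext m; simp [← Finsupp.smul_single, -Finsupp.smul_single])

/-- `e : C ⊗ M → A ⊗ W`. -/
def ee : T2 C M →ₗ[ZMod 2] A.V ⊗[ZMod 2] WW cb M :=
  TensorProduct.lift ((Finsupp.lsum (ZMod 2) fun i => TensorProduct.lift (ee0 cb M i)).comp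
    cb.eqv.symm.toLinearMap)

theorem ee_gen (i : cb.I) (x y : A.V) (m : M.V) :
    ee cb M (C.actR (C.actL x (cb.g i)) y ⊗ₜ m) = x ⊗ₜ Finsupp.single i (M.actL y m) := by
  simp only [ee, TensorProduct.lift.tmul, LinearMap.comp_apply, LinearEquiv.coe_coe, cb.eqv_symm]
  simp [ee0]

theorem gen_ind {p : T2 C M → Prop} (z : T2 C M) (h0 : p 0)
    (hadd : ∀ x y, p x → p y → p (x + y))
    (hg : ∀ i x y m, p (C.actR (C.actL x (cb.g i)) y ⊗ₜ m)) : p z := by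
  refine T2_induction C M (p := p) z h0 hadd ?_
  intro c m
  refine cb.induction (p := fun c => p (c ⊗ₜ m)) c (by simpa using h0) ?_ ?_
  · intro x y hx hy; rw [add_tmul]; exact hadd _ _ hx hy
  · intro i x y; exact hg i x y m

theorem ee_inn (r : C.V) (a : A.V) (m : M.V) : ee cb M (inn C M r a m) = 0 := by
  refine cb.induction (p := fun r => ee cb M (inn C M r a m) = 0) r (by simp [inn]) ?_ ?_
  · intro x y hx hy
    have : inn C M (x + y) a m = inn C M x a m + inn C M y a m := by
      simp only [inn, map_add, LinearMap.add_apply, add_tmul]; abel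
    rw [this, map_add, hx, hy, add_zero]
  · intro i x y
    rw [inn, C.actR_mul, map_add, ee_gen, ee_gen, M.actL_mul, ZModModule.add_self]

theorem ee_lA (a : A.V) (z : T2 C M) : ee cb M (lA C M a z) = AL cb M a (ee cb M z) := by
  refine gen_ind cb M (p := fun z => ee cb M (lA C M a z) = AL cb M a (ee cb M z)) z (by simp) ?_ ?_
  · intro x y hx hy; simp only [map_add, hx, hy]
  · intro i x y m
    rw [lA_tmul, ← C.actLR, ← C.actL_mul, ee_gen, ee_gen]; rfl

theorem ee_rA (a : A.V) (z : T2 C M) : ee cb M (rA C M a z) = AR cb M a (ee cb M z) := by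
  refine gen_ind cb M (p := fun z => ee cb M (rA C M a z) = AR cb M a (ee cb M z)) z (by simp) ?_ ?_
  · intro x y hx hy; simp only [map_add, hx, hy]
  · intro i x y m
    rw [rA_tmul, ee_gen, ee_gen, AR, TensorProduct.map_tmul, wR_single, M.actLR]; rfl

/-- `ν`. -/
def nu : A.V ⊗[ZMod 2] WW cb M →ₗ[ZMod 2] WW cb M := TensorProduct.lift (wR cb M)

@[simp] theorem nu_tmul (x : A.V) (w : WW cb M) : nu cb M (x ⊗ₜ w) = wR cb M x w := by simp [nu]

theorem nu_AL_AR (a : A.V) (E : A.V ⊗[ZMod 2] WW cb M) :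
    nu cb M (AL cb M a E) = nu cb M (AR cb M a E) := by
  have : (nu cb M).comp (AL cb M a) = (nu cb M).comp (AR cb M a) := by
    apply TensorProduct.ext'
    intro x w
    simp [AL, AR, wR_mul]
  exact LinearMap.congr_fun this E

/-- The cross multiplication. -/
def mu : (A.V ⊗[ZMod 2] WW cb M) ⊗[ZMod 2] (A.V ⊗[ZMod 2] WW cb M) →ₗ[ZMod 2]
    WW cb M ⊗[ZMod 2] WW cb M :=
  sw.comp ((TensorProduct.map (nu cb M) ((nu cb M).comp
    (TensorProduct.comm (ZMod 2) (WW cb M) A.V).toLinearMap)).comp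
    ((TensorProduct.tensorTensorTensorComm (ZMod 2) A.V (WW cb M) (WW cb M) A.V).toLinearMap.comp
      (TensorProduct.map LinearMap.id (TensorProduct.comm (ZMod 2) A.V (WW cb M)).toLinearMap)))

theorem mu_tmul (x x' : A.V) (w w' : WW cb M) :
    mu cb M ((x ⊗ₜ w) ⊗ₜ (x' ⊗ₜ w')) = wR cb M x' w ⊗ₜ wR cb M x w' := by
  simp [mu]

theorem AW_ind {p : (A.V ⊗[ZMod 2] WW cb M) → (A.V ⊗[ZMod 2] WW cb M) → Prop}
    (h0 : ∀ y, p 0 y) (h0' : ∀ x, p x 0) (ha : ∀ x x' y, p x y → p x' y → p (x + x') y)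
    (ha' : ∀ x y y', p x y → p x y' → p x (y + y'))
    (h : ∀ x w x' w', p (x ⊗ₜ w) (x' ⊗ₜ w')) (E E') : p E E' := by
  induction E using TensorProduct.induction_on with
  | zero => exact h0 _
  | add a b ha1 hb1 => exact ha _ _ _ ha1 hb1
  | tmul x w =>
    induction E' using TensorProduct.induction_on with
    | zero => exact h0' _
    | add a b ha1 hb1 => exact ha' _ _ _ ha1 hb1
    | tmul x' w' => exact h x w x' w'

theorem mu_swap (E E' : A.V ⊗[ZMod 2] WW cb M) :
    mu cb M (E' ⊗ₜ E) = sw (mu cb M (E ⊗ₜ E')) := by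
  refine AW_ind cb M (p := fun E E' => mu cb M (E' ⊗ₜ E) = sw (mu cb M (E ⊗ₜ E')))
    ?_ ?_ ?_ ?_ ?_ E E'
  · intro y; simp
  · intro y; simp
  · intro x x' y h h'; simp only [tmul_add, add_tmul, map_add, h, h']
  · intro x x' y h h'; simp only [tmul_add, add_tmul, map_add, h, h']
  · intro x w x' w'; simp [mu_tmul]

theorem mu_LR (a : A.V) (E E' : A.V ⊗[ZMod 2] WW cb M) :
    mu cb M (AL cb M a E ⊗ₜ E') = mu cb M (E ⊗ₜ AR cb M a E') := by
  refine AW_ind cb M (p := fun E E' => mu cb M (AL cb M a E ⊗ₜ E') = mu cb M (E ⊗ₜ AR cb M a E'))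
    ?_ ?_ ?_ ?_ ?_ E E'
  · intro y; simp
  · intro y; simp
  · intro x x' y h h'; simp only [tmul_add, add_tmul, map_add, h, h']
  · intro x x' y h h'; simp only [tmul_add, add_tmul, map_add, h, h']
  · intro x w x' w'; simp [mu_tmul, AL, AR, wR_mul]

theorem mu_RL (a : A.V) (E E' : A.V ⊗[ZMod 2] WW cb M) :
    mu cb M (AR cb M a E ⊗ₜ E') = mu cb M (E ⊗ₜ AL cb M a E') := by
  rw [mu_swap, ← mu_LR, ← mu_swap]

theorem mu_sq (E : A.V ⊗[ZMod 2] WW cb M) :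
    ∃ v, mu cb M (E ⊗ₜ E) = nu cb M E ⊗ₜ nu cb M E + (v + sw v) := by
  induction E using TensorProduct.induction_on with
  | zero => exact ⟨0, by simp⟩
  | tmul x w => exact ⟨0, by simp [mu_tmul]⟩
  | add E E' h h' =>
    obtain ⟨v, hv⟩ := h
    obtain ⟨v', hv'⟩ := h'
    refine ⟨v + v' + mu cb M (E ⊗ₜ E') + nu cb M E ⊗ₜ nu cb M E', ?_⟩
    simp only [add_tmul, tmul_add, map_add, hv, hv', sw_tmul, mu_swap cb M E E']
    rw [← sub_eq_zero]; abel_nf; simp [nsmul2, zsmul2]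

/-- `Φ₄`. -/
def Phi4 : T4 C M →ₗ[ZMod 2] WW cb M ⊗[ZMod 2] WW cb M :=
  (mu cb M).comp ((TensorProduct.map (ee cb M) (ee cb M)).comp
    (TensorProduct.assoc (ZMod 2) C.V M.V (T2 C M)).symm.toLinearMap)

theorem Phi4_tt (z z' : T2 C M) :
    Phi4 cb M (tt C M z z') = mu cb M (ee cb M z ⊗ₜ ee cb M z') := by
  simp only [Phi4, LinearMap.comp_apply, LinearEquiv.coe_coe, assoc_symm_tt,
    TensorProduct.map_tmul]

theorem Phi4_tau (x : T4 C M) : Phi4 cb M (tau4 C M x) = sw (Phi4 cb M x) := by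
  refine T4_hom C M (f := (Phi4 cb M).comp (tau4 C M)) (g := sw.comp (Phi4 cb M)) ?_ x
  intro z z'
  simp only [LinearMap.comp_apply, tau4_tt, Phi4_tt, mu_swap cb M (ee cb M z)]

theorem Phi4_rel {x : T4 C M} (hx : x ∈ rel4 C M) : Phi4 cb M x = 0 := by
  have : rel4 C M ≤ LinearMap.ker (Phi4 cb M) := by
    refine rel4_le C M ?_ ?_ ?_ ?_
    · intro r a m z; rw [LinearMap.mem_ker, Phi4_tt, ee_inn, zero_tmul, map_zero]
    · intro r a m z; rw [LinearMap.mem_ker, Phi4_tt, ee_inn, tmul_zero, map_zero]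
    · intro a z z'
      rw [LinearMap.mem_ker, map_add, Phi4_tt, Phi4_tt, ee_lA, ee_rA, mu_LR, ZModModule.add_self]
    · intro a z z'
      rw [LinearMap.mem_ker, map_add, Phi4_tt, Phi4_tt, ee_lA, ee_rA, mu_RL, ZModModule.add_self]
  exact this hx

theorem Phi2_rel {x : T2 C M} (hx : x ∈ rel2 C M) : nu cb M (ee cb M x) = 0 := by
  have : rel2 C M ≤ LinearMap.ker ((nu cb M).comp (ee cb M)) := by
    refine rel2_le C M ?_ ?_
    · intro r a m
      have := ee_inn cb M r a m
      rw [inn] at this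
      rw [LinearMap.mem_ker, LinearMap.comp_apply, this, map_zero]
    · intro r a m
      rw [LinearMap.mem_ker, LinearMap.comp_apply, ← lA_tmul, ← rA_tmul, map_add, ee_lA, ee_rA,
        map_add, nu_AL_AR, ZModModule.add_self]
  exact this hx

/-- `Ψ₂`. -/
def Psi2 : WW cb M →ₗ[ZMod 2] T2 C M :=
  Finsupp.lsum (ZMod 2) fun i => TensorProduct.mk (ZMod 2) C.V M.V (cb.g i)

theorem Psi2_single (i : cb.I) (m : M.V) :
    Psi2 cb M (Finsupp.single i m) = cb.g i ⊗ₜ m := by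
  simp [Psi2]

/-- `Ψ₄`. -/
def Psi4 : WW cb M ⊗[ZMod 2] WW cb M →ₗ[ZMod 2] T4 C M :=
  TensorProduct.lift ((tt C M).compl₁₂ (Psi2 cb M) (Psi2 cb M))

theorem Psi4_tmul (w w' : WW cb M) :
    Psi4 cb M (w ⊗ₜ w') = tt C M (Psi2 cb M w) (Psi2 cb M w') := by
  simp [Psi4]

theorem Psi4_sw (x : WW cb M ⊗[ZMod 2] WW cb M) :
    Psi4 cb M (sw x) = tau4 C M (Psi4 cb M x) := by
  have : (Psi4 cb M).comp sw = (tau4 C M).comp (Psi4 cb M) := by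
    apply TensorProduct.ext'
    intro a b
    simp [Psi4_tmul, tau4_tt]
  exact LinearMap.congr_fun this x

theorem Psi2_Phi2 (z : T2 C M) : z + Psi2 cb M (nu cb M (ee cb M z)) ∈ rel2 C M := by
  refine gen_ind cb M (p := fun z => z + Psi2 cb M (nu cb M (ee cb M z)) ∈ rel2 C M) z
    (by simp) ?_ ?_
  · intro x y hx hy
    convert add_mem hx hy using 1
    simp only [map_add]; abel
  · intro i x y m
    rw [ee_gen, nu_tmul, wR_single, Psi2_single]
    convert add_mem (rel2_right C M (C.actL x (cb.g i)) y m)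
      (rel2_left C M (cb.g i) x (M.actL y m)) using 1
    rw [← sub_eq_zero]; abel_nf; simp [nsmul2, zsmul2]

theorem lA_rA (a b : A.V) (z : T2 C M) : lA C M a (rA C M b z) = rA C M b (lA C M a z) := by
  refine T2_induction C M (p := fun z => lA C M a (rA C M b z) = rA C M b (lA C M a z)) z
    (by simp) ?_ ?_
  · intro x y hx hy; simp only [map_add, hx, hy]
  · intro r m; simp

theorem Psi4_Phi4 (x : T4 C M) : x + Psi4 cb M (Phi4 cb M x) ∈ rel4 C M := by
  refine T4_induction C M (p := fun x => x + Psi4 cb M (Phi4 cb M x) ∈ rel4 C M) x (by simp) ?_ ?_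
  · intro x y hx hy
    convert add_mem hx hy using 1
    simp only [map_add]; abel
  intro z z'
  refine gen_ind cb M (p := fun z => tt C M z z' + Psi4 cb M (Phi4 cb M (tt C M z z')) ∈ rel4 C M)
    z (by simp) ?_ ?_
  · intro x y hx hy
    convert add_mem hx hy using 1
    simp only [map_add, LinearMap.add_apply]; abel
  intro i x y m
  refine gen_ind cb M (p := fun z' => tt C M (C.actR (C.actL x (cb.g i)) y ⊗ₜ m) z' +
    Psi4 cb M (Phi4 cb M (tt C M (C.actR (C.actL x (cb.g i)) y ⊗ₜ m) z')) ∈ rel4 C M)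
    z' (by simp) ?_ ?_
  · intro x y hx hy
    convert add_mem hx hy using 1
    simp only [map_add, LinearMap.add_apply]; abel
  intro i' x' y' m'
  rw [Phi4_tt, ee_gen, ee_gen, mu_tmul, wR_single, wR_single, Psi4_tmul, Psi2_single, Psi2_single,
    ← rA_tmul, ← rA_tmul]
  have h1 := rel4_inn C M (C.actL x (cb.g i)) y m (C.actR (C.actL x' (cb.g i')) y' ⊗ₜ m')
  have h2 := rel4_inn' C M (C.actL x' (cb.g i')) y' m' (C.actL x (cb.g i) ⊗ₜ M.actL y m)
  have h3 := rel4_LR C M x (cb.g i ⊗ₜ M.actL y m) (C.actL x' (cb.g i') ⊗ₜ M.actL y' m')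
  have h4 := rel4_RL C M x' (cb.g i ⊗ₜ M.actL y m) (rA C M x (cb.g i' ⊗ₜ M.actL y' m'))
  rw [lA_rA] at h4
  rw [inn, map_add, LinearMap.add_apply] at h1
  rw [inn, map_add] at h2
  rw [lA_tmul] at h3 h4
  convert add_mem (add_mem h1 h2) (add_mem h3 h4) using 1
  rw [← sub_eq_zero]; abel_nf; simp [nsmul2, zsmul2]

theorem tate_C (cb : CB C) {y : T4 C M} (hy : y + tau4 C M y ∈ rel4 C M) :
    ∃ z v, y + (tt C M z z + (v + tau4 C M v)) ∈ rel4 C M := by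
  have h1 := Phi4_rel cb M hy
  rw [map_add, Phi4_tau] at h1
  obtain ⟨w, v, hw⟩ := sym_sq _ (eq_of_add_eq_zero2 h1).symm
  refine ⟨Psi2 cb M w, Psi4 cb M v, ?_⟩
  have h2 := Psi4_Phi4 cb M y
  rwa [hw, map_add, map_add, Psi4_sw, Psi4_tmul] at h2

theorem tate_C' (cb : CB C) {z : T2 C M} (hz : z ∈ rel2 C M) :
    ∃ v, tt C M z z + (v + tau4 C M v) ∈ rel4 C M := by
  obtain ⟨v, hv⟩ := mu_sq cb M (ee cb M z)
  rw [Phi2_rel cb M hz, zero_tmul, zero_add] at hv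
  have h2 := Psi4_Phi4 cb M (tt C M z z)
  rw [Phi4_tt, hv, map_add, Psi4_sw] at h2
  exact ⟨_, h2⟩

theorem tate_C'' (cb : CB C) {z : T2 C M} {v : T4 C M} (hz : tt C M z z + (v + tau4 C M v) ∈ rel4 C M) :
    z ∈ rel2 C M := by
  have h1 := Phi4_rel cb M hz
  obtain ⟨v', hv⟩ := mu_sq cb M (ee cb M z)
  rw [map_add, map_add, Phi4_tt, Phi4_tau, hv] at h1
  have h2 : nu cb M (ee cb M z) = 0 := by
    refine sq_zero _ (v' + Phi4 cb M v) ?_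
    rw [map_add, ← sub_eq_zero, ← h1, ← sub_eq_zero]; abel_nf; simp [nsmul2, zsmul2]
  have h3 := Psi2_Phi2 cb M z
  rwa [h2, map_zero, add_zero] at h3

end Tate

section TateR
variable {A : DGA (ZMod 2)} {R : DGBimod A} (hR : IsCellRetract R) (M : DGBimod A)

theorem id_grHom (M : DGBimod A) : (LinearMap.id : M.V →ₗ[ZMod 2] M.V) ∈ grHomSub M M 0 :=
  ⟨fun i x hx => by rw [add_zero]; exact hx, fun _ _ => rfl, fun _ _ => rfl⟩

theorem m2_comp_id {C : DGBimod A} {ι : R.V →ₗ[ZMod 2] C.V} {r : C.V →ₗ[ZMod 2] R.V}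
    (h : r.comp ι = LinearMap.id) (x : T2 R M) :
    m2 r (LinearMap.id : M.V →ₗ[ZMod 2] M.V) (m2 ι LinearMap.id x) = x := by
  refine T2_induction R M (p := fun x =>
    m2 r (LinearMap.id : M.V →ₗ[ZMod 2] M.V) (m2 ι LinearMap.id x) = x) x (by simp) ?_ ?_
  · intro x y hx hy; simp only [map_add, hx, hy]
  · intro a m; simpa using congrArg (fun t => t ⊗ₜ[ZMod 2] m) (LinearMap.congr_fun h a)

theorem m4_comp_id {C : DGBimod A} {ι : R.V →ₗ[ZMod 2] C.V} {r : C.V →ₗ[ZMod 2] R.V}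
    (h : r.comp ι = LinearMap.id) (x : T4 R M) :
    m4 r (LinearMap.id : M.V →ₗ[ZMod 2] M.V) (m4 ι LinearMap.id x) = x := by
  refine T4_hom R M (f := (m4 r (LinearMap.id : M.V →ₗ[ZMod 2] M.V)).comp (m4 ι LinearMap.id))
    (g := LinearMap.id) ?_ x
  intro z z'
  simp only [LinearMap.comp_apply, m4_tt, m2_comp_id M h, LinearMap.id_apply]

theorem m2_rel {S N : DGBimod A} {M : DGBimod A} {G : R.V →ₗ[ZMod 2] S.V} {g : M.V →ₗ[ZMod 2] N.V}
    {s t : ℤ} (hG : G ∈ grHomSub R S s) (hg : g ∈ grHomSub M N t)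
    {x : T2 R M} (hx : x ∈ rel2 R M) : m2 G g x ∈ rel2 S N := by
  have : rel2 R M ≤ (rel2 S N).comap (m2 G g) := by
    refine rel2_le R M ?_ ?_
    · intro r a m
      simp only [Submodule.mem_comap, map_add, m2_tmul, hG.2.2, hg.2.1]
      exact rel2_right S N _ a _
    · intro r a m
      simp only [Submodule.mem_comap, map_add, m2_tmul, hG.2.1, hg.2.2]
      exact rel2_left S N _ a _
  exact this hx

theorem tate_R (hR : IsCellRetract R) {y : T4 R M} (hy : y + tau4 R M y ∈ rel4 R M) :
    ∃ z v, y + (tt R M z z + (v + tau4 R M v)) ∈ rel4 R M := by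
  obtain ⟨C, hC, ι, r, hι, hr, -, hrι⟩ := hR
  obtain ⟨cb⟩ := exists_CB hC
  have h1 := m4_rel hι.grHom (id_grHom M) hy
  rw [map_add, m4_tau] at h1
  obtain ⟨z, v, h⟩ := tate_C M cb h1
  have h2 := m4_rel hr.grHom (id_grHom M) h
  rw [map_add, map_add, map_add, m4_tau, m4_comp_id M hrι, m4_tt] at h2
  exact ⟨_, _, h2⟩

theorem tate_R' (hR : IsCellRetract R) {z : T2 R M} (hz : z ∈ rel2 R M) :
    ∃ v, tt R M z z + (v + tau4 R M v) ∈ rel4 R M := by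
  obtain ⟨C, hC, ι, r, hι, hr, -, hrι⟩ := hR
  obtain ⟨cb⟩ := exists_CB hC
  obtain ⟨v, h⟩ := tate_C' M cb (m2_rel hι.grHom (id_grHom M) hz)
  have h2 := m4_rel hr.grHom (id_grHom M) h
  rw [map_add, map_add, m4_tau, m4_tt, m2_comp_id M hrι] at h2
  exact ⟨_, h2⟩

theorem tate_R'' (hR : IsCellRetract R) {z : T2 R M} {v : T4 R M}
    (hz : tt R M z z + (v + tau4 R M v) ∈ rel4 R M) : z ∈ rel2 R M := by
  obtain ⟨C, hC, ι, r, hι, hr, -, hrι⟩ := hR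
  obtain ⟨cb⟩ := exists_CB hC
  have h1 := m4_rel hι.grHom (id_grHom M) hz
  rw [map_add, map_add, m4_tau, m4_tt] at h1
  have h2 := m2_rel hr.grHom (id_grHom M) (tate_C'' M cb h1)
  rwa [m2_comp_id M hrι] at h2

/-- Odd case, graded. -/
theorem tate_odd (hR : IsCellRetract R) {p : ℤ} (hp : ∀ m, p ≠ 2 * m) {y : T4 R M}
    (hyg : y ∈ gr4 R M p) (hy : y + tau4 R M y ∈ rel4 R M) :
    ∃ v ∈ gr4 R M p, y + (v + tau4 R M v) ∈ rel4 R M := by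
  obtain ⟨z, v, h⟩ := tate_R M hR hy
  have h1 := pr4_rel R M p h
  obtain ⟨u, -, hu⟩ := pr4_Q R M p z
  have hu := congrArg (pr4 R M p) (hu hp)
  rw [pr4_same R M (pr4_mem R M p _), map_add, pr4_tau] at hu
  rw [map_add, map_add, map_add, pr4_tau, pr4_same R M hyg, hu] at h1
  refine ⟨pr4 R M p u + pr4 R M p v, add_mem (pr4_mem R M p u) (pr4_mem R M p v), ?_⟩
  convert h1 using 1
  rw [map_add]; abel

theorem tate_even (hR : IsCellRetract R) {p m : ℤ} (hp : p = 2 * m) {y : T4 R M}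
    (hyg : y ∈ gr4 R M p) (hy : y + tau4 R M y ∈ rel4 R M) :
    ∃ z ∈ gr2 R M m, ∃ v ∈ gr4 R M p, y + (tt R M z z + (v + tau4 R M v)) ∈ rel4 R M := by
  obtain ⟨z, v, h⟩ := tate_R M hR hy
  have h1 := pr4_rel R M p h
  obtain ⟨u, hu, -⟩ := pr4_Q R M p z
  have hzm := pr2_mem (R := R) (X := M) m z
  have hu := congrArg (pr4 R M p) (hu m hp)
  rw [pr4_same R M (pr4_mem R M p _), map_add, map_add, pr4_tau,
    pr4_same R M (tt_gr R M hzm hzm (by rw [hp]; ring))] at hu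
  rw [map_add, map_add, map_add, pr4_tau, pr4_same R M hyg, hu] at h1
  refine ⟨pr2 R M m z, hzm, pr4 R M p u + pr4 R M p v,
    add_mem (pr4_mem R M p u) (pr4_mem R M p v), ?_⟩
  convert h1 using 1
  rw [map_add]; abel

theorem tate_even' (hR : IsCellRetract R) {p m : ℤ} (hp : p = 2 * m) {z : T2 R M}
    (hzm : z ∈ gr2 R M m) (hz : z ∈ rel2 R M) :
    ∃ v ∈ gr4 R M p, tt R M z z + (v + tau4 R M v) ∈ rel4 R M := by
  obtain ⟨v, h⟩ := tate_R' M hR hz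
  have h1 := pr4_rel R M p h
  rw [map_add, map_add, pr4_tau, pr4_same R M (tt_gr R M hzm hzm (by rw [hp]; ring))] at h1
  exact ⟨_, pr4_mem R M p v, h1⟩

end TateR
end Part14

section Part15
set_option linter.unusedVariables false
set_option linter.unusedSimpArgs false
section T15
variable {A : DGA (ZMod 2)} (R M : DGBimod A)

/-- The total differential on the concrete model. -/
def TD : (ℤ →₀ T4 R M) →ₗ[ZMod 2] (ℤ →₀ T4 R M) := (TateBicx R M).D

/-- The row filtration on the concrete model. -/
def TF (p n : ℤ) : Submodule (ZMod 2) (ℤ →₀ T4 R M) := (TateBicx R M).Frow p n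

/-- The relations on the concrete model. -/
def TN : Submodule (ZMod 2) (ℤ →₀ T4 R M) := (TateBicx R M).N

theorem TD_apply (ξ : ℤ →₀ T4 R M) (c : ℤ) :
    TD R M ξ c = d4 R M (ξ c) + (ξ (c + 1) + tau4 R M (ξ (c + 1))) := by
  have h : TD R M ξ = Finsupp.mapDomain (fun p : ℤ => p - 1)
      (Finsupp.mapRange.linearMap (LinearMap.id + tau4 R M) ξ) +
      Finsupp.mapRange.linearMap (d4 R M) ξ := rfl
  rw [h, Finsupp.add_apply]
  have hinj : Function.Injective (fun p : ℤ => p - 1) := fun a b hab => by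
    simpa using hab
  have h2 := Finsupp.mapDomain_apply hinj
    (Finsupp.mapRange.linearMap (LinearMap.id + tau4 R M) ξ) (c + 1)
  simp only [add_sub_cancel_right] at h2
  rw [h2, add_comm]
  simp

theorem TD_single (c : ℤ) (y : T4 R M) : TD R M (Finsupp.single c y) =
    Finsupp.single (c - 1) (y + tau4 R M y) + Finsupp.single c (d4 R M y) := by
  have h : TD R M (Finsupp.single c y) = Finsupp.mapDomain (fun p : ℤ => p - 1)
      (Finsupp.mapRange.linearMap (LinearMap.id + tau4 R M) (Finsupp.single c y)) +
      Finsupp.mapRange.linearMap (d4 R M) (Finsupp.single c y) := rfl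
  rw [h]
  simp [Finsupp.mapDomain_single, Finsupp.mapDomain_add]

theorem TN_mem {ξ : ℤ →₀ T4 R M} : ξ ∈ TN R M ↔ ∀ c, ξ c ∈ rel4 R M := by
  have h : TN R M = ⨅ p : ℤ, Submodule.comap (Finsupp.lapply p) (rel4 R M) := rfl
  rw [h]
  simp

theorem TF_eq (p n : ℤ) : TF R M p n =
    ⨆ (j : ℤ) (_ : j ≤ p), Submodule.map (Finsupp.lsingle (n - j)) (gr4 R M j) := rfl

theorem TF_single {p n c q : ℤ} {y : T4 R M} (hy : y ∈ gr4 R M q) (hc : n - q = c) (hq : q ≤ p) :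
    Finsupp.single c y ∈ TF R M p n := by
  rw [TF_eq]
  refine Submodule.mem_iSup_of_mem q (Submodule.mem_iSup_of_mem hq ?_)
  exact ⟨y, hy, by rw [hc]; rfl⟩

theorem TF_le {p n : ℤ} {K : Submodule (ZMod 2) (ℤ →₀ T4 R M)}
    (h : ∀ q ≤ p, ∀ y ∈ gr4 R M q, Finsupp.single (n - q) y ∈ K) : TF R M p n ≤ K := by
  rw [TF_eq]
  refine iSup_le fun q => iSup_le fun hq => ?_
  rintro _ ⟨y, hy, rfl⟩
  exact h q hq y hy

theorem TF_mono {p p' n : ℤ} (h : p ≤ p') : TF R M p n ≤ TF R M p' n :=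
  TF_le R M fun q hq y hy => TF_single R M hy rfl (hq.trans h)

theorem TF_apply {p n : ℤ} {ξ : ℤ →₀ T4 R M} (hξ : ξ ∈ TF R M p n) {c q : ℤ} (hc : n - c = q) :
    ξ c ∈ gr4 R M q := by
  have : TF R M p n ≤ (gr4 R M q).comap (Finsupp.lapply c) := by
    refine TF_le R M fun q' hq y hy => ?_
    rw [Submodule.mem_comap, Finsupp.lapply_apply, Finsupp.single_apply]
    split_ifs with h
    · have : q' = q := by omega
      rwa [← this]
    · exact Submodule.zero_mem _
  exact this hξ

theorem TF_apply_zero {p n : ℤ} {ξ : ℤ →₀ T4 R M} (hξ : ξ ∈ TF R M p n) {c : ℤ} (hc : p < n - c) :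
    ξ c = 0 := by
  have : TF R M p n ≤ LinearMap.ker (Finsupp.lapply (R := ZMod 2) (M := T4 R M) c) := by
    refine TF_le R M fun q' hq y hy => ?_
    rw [LinearMap.mem_ker, Finsupp.lapply_apply, Finsupp.single_apply, if_neg (by omega)]
  exact this hξ

theorem TF_top {p n : ℤ} {ξ : ℤ →₀ T4 R M} (hξ : ξ ∈ TF R M p n) :
    ξ + Finsupp.single (n - p) (ξ (n - p)) ∈ TF R M (p - 1) n := by
  have : TF R M p n ≤ (TF R M (p - 1) n).comap (LinearMap.id +
      (Finsupp.lsingle (n - p)).comp (Finsupp.lapply (R := ZMod 2) (M := T4 R M) (n - p))) := by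
    refine TF_le R M fun q hq y hy => ?_
    simp only [Submodule.mem_comap, LinearMap.add_apply, LinearMap.id_apply,
      LinearMap.comp_apply, Finsupp.lapply_apply, Finsupp.lsingle_apply]
    by_cases h : q = p
    · subst h
      rw [Finsupp.single_eq_same, ZModModule.add_self]; exact Submodule.zero_mem _
    · rw [Finsupp.single_apply, if_neg (by omega), Finsupp.single_zero, add_zero]
      exact TF_single R M hy rfl (by omega)
  exact this hξ

theorem TD_F {p n : ℤ} {ξ : ℤ →₀ T4 R M} (hξ : ξ ∈ TF R M p n) : TD R M ξ ∈ TF R M p (n - 1) := by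
  have : TF R M p n ≤ (TF R M p (n - 1)).comap (TD R M) := by
    refine TF_le R M fun q hq y hy => ?_
    rw [Submodule.mem_comap, TD_single]
    exact Submodule.add_mem _
      (TF_single R M (Submodule.add_mem _ hy (tau_gr R M hy)) (by ring) hq)
      (TF_single R M (d4_gr R M hy) (by ring) (by omega))
  exact this hξ

theorem TD_TD (ξ : ℤ →₀ T4 R M) : TD R M (TD R M ξ) = 0 := by
  ext1 c
  simp only [TD_apply, map_add, d4_d4, d4_tau, tau_tau, Finsupp.coe_zero, Pi.zero_apply]
  rw [← sub_eq_zero]; abel_nf; simp [nsmul2, zsmul2]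

theorem TD_N {ξ : ℤ →₀ T4 R M} (hξ : ξ ∈ TN R M) : TD R M ξ ∈ TN R M := by
  rw [TN_mem] at *
  intro c
  rw [TD_apply]
  exact Submodule.add_mem _ (d4_rel R M (hξ c)) (Submodule.add_mem _ (hξ _) (tau_rel R M (hξ _)))

theorem TN_single {c : ℤ} {y : T4 R M} (hy : y ∈ rel4 R M) : Finsupp.single c y ∈ TN R M := by
  rw [TN_mem]; intro c'
  rw [Finsupp.single_apply]; split_ifs
  · exact hy
  · exact Submodule.zero_mem _

/-- Filtration plus relations. -/
def TFN (p n : ℤ) : Submodule (ZMod 2) (ℤ →₀ T4 R M) := TF R M p n ⊔ TN R M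

theorem TF_le_TFN {p n : ℤ} {ξ : ℤ →₀ T4 R M} (h : ξ ∈ TF R M p n) : ξ ∈ TFN R M p n :=
  Submodule.mem_sup_left h
theorem TN_le_TFN {p n : ℤ} {ξ : ℤ →₀ T4 R M} (h : ξ ∈ TN R M) : ξ ∈ TFN R M p n :=
  Submodule.mem_sup_right h
theorem TFN_mono {p p' n : ℤ} (h : p ≤ p') : TFN R M p n ≤ TFN R M p' n :=
  sup_le_sup_right (TF_mono R M h) _
theorem TFN_apply {p n : ℤ} {ξ : ℤ →₀ T4 R M} (hξ : ξ ∈ TFN R M p n) {c : ℤ} (hc : p < n - c) :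
    ξ c ∈ rel4 R M := by
  obtain ⟨a, ha, b, hb, rfl⟩ := Submodule.mem_sup.1 hξ
  rw [Finsupp.add_apply, TF_apply_zero R M ha hc, zero_add]
  exact (TN_mem R M).1 hb c

/-- `D F(p', n+1) + F(p-1, n) + N`. -/
def TB (p' p n : ℤ) : Submodule (ZMod 2) (ℤ →₀ T4 R M) :=
  (TF R M p' (n + 1)).map (TD R M) ⊔ TFN R M (p - 1) n

theorem TB_mono {p' p'' p n : ℤ} (h : p' ≤ p'') : TB R M p' p n ≤ TB R M p'' p n :=
  sup_le_sup_right (Submodule.map_mono (TF_mono R M h)) _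

theorem TB_N {p' p n : ℤ} {ξ : ℤ →₀ T4 R M} (h : ξ ∈ TN R M) : ξ ∈ TB R M p' p n :=
  Submodule.mem_sup_right (TN_le_TFN R M h)

theorem TB_F {p' p n : ℤ} {ξ : ℤ →₀ T4 R M} (h : ξ ∈ TF R M (p - 1) n) : ξ ∈ TB R M p' p n :=
  Submodule.mem_sup_right (TF_le_TFN R M h)

theorem TB_D {p' p n : ℤ} {ξ : ℤ →₀ T4 R M} (h : ξ ∈ TF R M p' (n + 1)) :
    TD R M ξ ∈ TB R M p' p n :=
  Submodule.mem_sup_left ⟨ξ, h, rfl⟩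

theorem TB_tau {p n : ℤ} {v : T4 R M} (hv : v ∈ gr4 R M p) :
    Finsupp.single (n - p) (v + tau4 R M v) ∈ TB R M p p n := by
  have h1 : TD R M (Finsupp.single (n - p + 1) v) ∈ TB R M p p n :=
    TB_D R M (TF_single R M hv (by ring) le_rfl)
  have h2 : Finsupp.single (n - p + 1) (d4 R M v) ∈ TB R M p p n :=
    TB_F R M (TF_single R M (d4_gr R M hv) (by ring) le_rfl)
  have := Submodule.add_mem _ h1 h2
  rw [TD_single, add_assoc, ZModModule.add_self, add_zero, add_sub_cancel_right] at this
  exact this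

theorem S_facts {p n : ℤ} {ξ : ℤ →₀ T4 R M} (hξ : ξ ∈ TF R M p n)
    (hD : TD R M ξ ∈ TFN R M (p - 3) (n - 1)) :
    (ξ (n - p) + tau4 R M (ξ (n - p)) ∈ rel4 R M) ∧
    (d4 R M (ξ (n - p)) + (ξ (n - p + 1) + tau4 R M (ξ (n - p + 1))) ∈ rel4 R M) ∧
    (d4 R M (ξ (n - p + 1)) + (ξ (n - p + 2) + tau4 R M (ξ (n - p + 2))) ∈ rel4 R M) := by
  refine ⟨?_, ?_, ?_⟩
  · have := TFN_apply R M hD (c := n - p - 1) (by omega)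
    rwa [TD_apply, sub_add_cancel, TF_apply_zero R M hξ (c := n - p - 1) (by omega), map_zero,
      zero_add] at this
  · have := TFN_apply R M hD (c := n - p) (by omega)
    rwa [TD_apply] at this
  · have := TFN_apply R M hD (c := n - p + 1) (by omega)
    rwa [TD_apply, add_assoc (n - p)] at this

theorem S_odd (hR : IsCellRetract R) {p n : ℤ} (hp : ∀ m, p ≠ 2 * m) {ξ : ℤ →₀ T4 R M}
    (hξ : ξ ∈ TFN R M p n) (hD : TD R M ξ ∈ TFN R M (p - 3) (n - 1)) : ξ ∈ TB R M p p n := by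
  obtain ⟨ξ, h1, ν, hν, rfl⟩ := Submodule.mem_sup.1 hξ
  refine Submodule.add_mem _ ?_ (TB_N R M hν)
  rw [map_add] at hD
  replace hD := (Submodule.add_mem_iff_left _ (TN_le_TFN R M (TD_N R M hν))).1 hD
  obtain ⟨f1, f2, f3⟩ := S_facts R M h1 hD
  obtain ⟨v, hv, hy⟩ := tate_odd M hR hp (TF_apply R M h1 (c := n - p) (by ring)) f1
  have a1 := TB_F (p' := p) R M (TF_top R M h1)
  have a2 := TB_tau R M (n := n) hv
  have a3 := TB_N (p' := p) (p := p) (n := n) R M (TN_single R M (c := n - p) hy)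
  have := Submodule.add_mem _ a1 (Submodule.add_mem _ a2 a3)
  rw [Finsupp.single_add (n - p) (ξ (n - p))] at this
  convert this using 1
  rw [← sub_eq_zero]; abel_nf; simp [nsmul2, zsmul2]

theorem S_even (hR : IsCellRetract R) {p m n : ℤ} (hp : p = 2 * m) {ξ : ℤ →₀ T4 R M}
    (hξ : ξ ∈ TFN R M p n) (hD : TD R M ξ ∈ TFN R M (p - 3) (n - 1)) :
    ∃ z ∈ gr2 R M m, d2 R M z ∈ rel2 R M ∧
      ξ + Finsupp.single (n - p) (tt R M z z) ∈ TB R M p p n := by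
  obtain ⟨ξ, h1, ν, hν, rfl⟩ := Submodule.mem_sup.1 hξ
  rw [map_add] at hD
  replace hD := (Submodule.add_mem_iff_left _ (TN_le_TFN R M (TD_N R M hν))).1 hD
  obtain ⟨f1, f2, f3⟩ := S_facts R M h1 hD
  have hg0 := TF_apply R M h1 (c := n - p) (q := p) (by ring)
  have hg1 := TF_apply R M h1 (c := n - p + 1) (q := p - 1) (by ring)
  obtain ⟨z, hz, v, hv, hy⟩ := tate_even M hR hp hg0 f1
  refine ⟨z, hz, ?_, ?_⟩
  · have hu : tt R M (d2 R M z) z + d4 R M v + ξ (n - p + 1) ∈ gr4 R M (p - 1) :=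
      Submodule.add_mem _ (Submodule.add_mem _
        (tt_gr R M (d2_gr R M hz) hz (by rw [hp]; ring)) (d4_gr R M hv)) hg1
    have hu' : (tt R M (d2 R M z) z + d4 R M v + ξ (n - p + 1)) +
        tau4 R M (tt R M (d2 R M z) z + d4 R M v + ξ (n - p + 1)) ∈ rel4 R M := by
      have := Submodule.add_mem _ f2 (d4_rel R M hy)
      convert this using 1
      simp only [map_add, d4_tt, tau4_tt, d4_tau]
      rw [← sub_eq_zero]; abel_nf; simp [nsmul2, zsmul2]
    obtain ⟨v1, hv1, h⟩ := tate_odd M hR (by intro m'; omega) hu hu'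
    refine tate_R'' M hR (v := d4 R M v1 + ξ (n - p + 2)) ?_
    have := Submodule.add_mem _ f3 (d4_rel R M h)
    convert this using 1
    simp only [map_add, d4_tt, tau4_tt, d4_tau, d2_d2, d4_d4, map_zero, LinearMap.zero_apply]
    rw [← sub_eq_zero]; abel_nf; simp [nsmul2, zsmul2]
  · have a1 := TB_F (p' := p) R M (TF_top R M h1)
    have a2 := TB_tau R M (n := n) hv
    have a3 := TB_N (p' := p) (p := p) (n := n) R M (TN_single R M (c := n - p) hy)
    have a4 := TB_N (p' := p) (p := p) (n := n) R M hν
    have := Submodule.add_mem _ a4 (Submodule.add_mem _ a1 (Submodule.add_mem _ a2 a3))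
    rw [Finsupp.single_add (n - p) (ξ (n - p)), Finsupp.single_add (n - p) (tt R M z z)] at this
    convert this using 1
    rw [← sub_eq_zero]; abel_nf; simp [nsmul2, zsmul2]

theorem B_rel (hR : IsCellRetract R) {p m n : ℤ} (hp : p = 2 * m) {z : T2 R M}
    (hz : z ∈ gr2 R M m) (hr : z ∈ rel2 R M) :
    Finsupp.single (n - p) (tt R M z z) ∈ TB R M p p n := by
  obtain ⟨v, hv, h⟩ := tate_even' M hR hp hz hr
  have a2 := TB_tau R M (n := n) hv
  have a3 := TB_N (p' := p) (p := p) (n := n) R M (TN_single R M (c := n - p) h)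
  have := Submodule.add_mem _ a2 a3
  rw [Finsupp.single_add (n - p) (tt R M z z)] at this
  convert this using 1
  rw [← sub_eq_zero]; abel_nf; simp [nsmul2, zsmul2]

theorem B_d {p m n : ℤ} (hp : p = 2 * m) {w : T2 R M} (hw : w ∈ gr2 R M (m + 1)) :
    Finsupp.single (n - p) (tt R M (d2 R M w) (d2 R M w)) ∈ TB R M (p + 2) p n := by
  have hdw := d2_gr R M hw
  have a := TB_D (p := p) R M (TF_single R M (p := p + 2) (n := n + 1)
    (tt_gr R M hw hw (n := p + 2) (by rw [hp]; ring)) (c := n - p - 1) (by ring) le_rfl)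
  have b := TB_D (p := p) R M (TF_single R M (p := p + 2) (n := n + 1)
    (tt_gr R M hw hdw (n := p + 1) (by rw [hp]; ring)) (c := n - p) (by ring) (by omega))
  have := Submodule.add_mem _ a b
  rw [TD_single, TD_single] at this
  convert this using 1
  simp only [d4_tt, tau4_tt, d2_d2, map_zero, LinearMap.zero_apply, add_zero,
    ZModModule.add_self, Finsupp.single_zero, zero_add, Finsupp.single_add]
  rw [← sub_eq_zero]; abel_nf; simp [nsmul2, zsmul2]

theorem B_add {p' p m n : ℤ} (hp : p = 2 * m) (hpp : p ≤ p')
    {K : Submodule (ZMod 2) (ℤ →₀ T4 R M)} (hK : TB R M p' p n ≤ K) {z z' : T2 R M}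
    (hz : z ∈ gr2 R M m) (hz' : z' ∈ gr2 R M m)
    (h : Finsupp.single (n - p) (tt R M z z) ∈ K)
    (h' : Finsupp.single (n - p) (tt R M z' z') ∈ K) :
    Finsupp.single (n - p) (tt R M (z + z') (z + z')) ∈ K := by
  rw [Q_add, Finsupp.single_add, Finsupp.single_add]
  exact Submodule.add_mem _ (Submodule.add_mem _ h h')
    (hK (TB_mono R M hpp (TB_tau R M (tt_gr R M hz hz' (by rw [hp]; ring)))))

theorem B_bdry (hR : IsCellRetract R) {p m n : ℤ} (hp : p = 2 * m) {z w : T2 R M}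
    (hz : z ∈ gr2 R M m) (hw : w ∈ gr2 R M (m + 1)) (h : z + d2 R M w ∈ rel2 R M) :
    Finsupp.single (n - p) (tt R M z z) ∈ TB R M (p + 2) p n := by
  have hdw := d2_gr R M hw
  rw [add_sub_cancel_right] at hdw
  have := B_add R M hp (p' := p + 2) (by omega) (le_refl (TB R M (p + 2) p n)) hdw
    (Submodule.add_mem _ hz hdw)
    (B_d R M hp hw) (TB_mono R M (by omega) (B_rel R M hR hp (Submodule.add_mem _ hz hdw) h))
  have e : d2 R M w + (z + d2 R M w) = z := by
    rw [← sub_eq_zero]; abel_nf; simp [nsmul2, zsmul2]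
  rwa [e] at this

/-- Elements whose top component survives up to page `L`. -/
def TG (L p n : ℤ) : Submodule (ZMod 2) (ℤ →₀ T4 R M) :=
  (TFN R M (p - L) (n - 1)).comap (TD R M) ⊔ TFN R M (p - 1) n

theorem TB_le_TG (L p' p n : ℤ) : TB R M p' p n ≤ TG R M L p n := by
  refine sup_le_sup_right ?_ _
  rintro _ ⟨x, hx, rfl⟩
  rw [Submodule.mem_comap, TD_TD]; exact Submodule.zero_mem _

theorem TG_iff {L p n : ℤ} {ξ : ℤ →₀ T4 R M} : ξ ∈ TG R M L p n ↔
    ∃ ζ ∈ TFN R M (p - 1) n, TD R M (ξ + ζ) ∈ TFN R M (p - L) (n - 1) := by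
  constructor
  · intro h
    obtain ⟨a, ha, b, hb, rfl⟩ := Submodule.mem_sup.1 h
    refine ⟨b, hb, ?_⟩
    rwa [add_assoc, ZModModule.add_self, add_zero]
  · rintro ⟨ζ, h1, h2⟩
    refine Submodule.mem_sup.2 ⟨ξ + ζ, h2, ζ, h1, ?_⟩
    rw [add_assoc, ZModModule.add_self, add_zero]

theorem TD_FN {p n : ℤ} {ξ : ℤ →₀ T4 R M} (hξ : ξ ∈ TFN R M p n) : TD R M ξ ∈ TFN R M p (n - 1) := by
  obtain ⟨a, ha, b, hb, rfl⟩ := Submodule.mem_sup.1 hξ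
  rw [map_add]
  exact Submodule.add_mem _ (TF_le_TFN R M (TD_F R M ha)) (TN_le_TFN R M (TD_N R M hb))

theorem collapse_aux {r p n : ℤ} (ξ : ℤ →₀ T4 R M)
    (hD' : TD R M ξ ∈ TFN R M (p - r) (n - 1)) (h : ξ ∈ TG R M (r + 1) p n) :
    TD R M ξ ∈ (TFN R M (p - 1) n ⊓
      (TFN R M (p - 1 - (r - 1)) (n - 1)).comap (TD R M)).map (TD R M) ⊔
      (TFN R M (p - r - 1) (n - 1) ⊓
      (TFN R M (p - r - 1 - (r - 1)) (n - 1 - 1)).comap (TD R M)) ⊔ TN R M := by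
  obtain ⟨ζ, h1, h2⟩ := (TG_iff R M).1 h
  have e : TD R M ξ = TD R M ζ + TD R M (ξ + ζ) := by
    rw [map_add]; rw [← sub_eq_zero]; abel_nf; simp [nsmul2, zsmul2]
  have e2 : TD R M ζ = TD R M ξ + TD R M (ξ + ζ) := by
    rw [map_add]; rw [← sub_eq_zero]; abel_nf; simp [nsmul2, zsmul2]
  have g1 : ζ ∈ TFN R M (p - 1) n ⊓ (TFN R M (p - 1 - (r - 1)) (n - 1)).comap (TD R M) := by
    refine Submodule.mem_inf.2 ⟨h1, ?_⟩
    rw [show p - 1 - (r - 1) = p - r by ring, Submodule.mem_comap, e2]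
    exact Submodule.add_mem _ hD' (TFN_mono R M (by omega) h2)
  have g2 : TD R M (ξ + ζ) ∈ TFN R M (p - r - 1) (n - 1) ⊓
      (TFN R M (p - r - 1 - (r - 1)) (n - 1 - 1)).comap (TD R M) := by
    refine Submodule.mem_inf.2 ⟨?_, ?_⟩
    · rw [show p - r - 1 = p - (r + 1) by ring]; exact h2
    · rw [Submodule.mem_comap, TD_TD]; exact Submodule.zero_mem _
  rw [e]
  exact Submodule.mem_sup_left (Submodule.add_mem_sup ⟨ζ, g1, rfl⟩ g2)

/-- From survival of all cycles to collapse. -/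
theorem collapse_of (h : ∀ r p n : ℤ, 3 ≤ r → ∀ ξ ∈ TFN R M p n,
    TD R M ξ ∈ TFN R M (p - 3) (n - 1) → ξ ∈ TG R M (r + 1) p n) : PiFormalBimod R M := by
  intro r hr p n
  rintro _ ⟨ξ, ⟨hξ, hD⟩, rfl⟩
  have hD' : TD R M ξ ∈ TFN R M (p - r) (n - 1) := hD
  exact collapse_aux R M ξ hD' (h r p n hr ξ hξ (TFN_mono R M (by omega) hD'))

end T15
end Part15

section Part16
set_option linter.unusedVariables false
set_option linter.unusedSimpArgs false
section T16
variable {A : DGA (ZMod 2)}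

/-- Survival of `Q x` for `x` a cycle of `R ⊗ R`, when `HH` vanishes below. -/
theorem survive_base {R : DGBimod A} (M : DGBimod A) (hR : IsCellRetract R) {j p n : ℤ} (hp : p = 2 * j) {x : T2 R M}
    (hx : x ∈ gr2 R M j) (hd : d2 R M x ∈ rel2 R M) :
    Finsupp.single (n - p) (tt R M x x) ∈ TG R M 3 p n := by
  have hdx := d2_gr R M hx
  obtain ⟨w, hw, h⟩ := tate_even' M hR (p := p - 2) (m := j - 1) (by rw [hp]; ring) hdx hd
  rw [TG_iff]
  refine ⟨Finsupp.single (n - p + 1) (tt R M x (d2 R M x)) + Finsupp.single (n - p + 2) w,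
    TF_le_TFN R M (Submodule.add_mem _
      (TF_single R M (tt_gr R M hx hdx (n := p - 1) (by rw [hp]; ring)) (by ring) le_rfl)
      (TF_single R M hw (by ring) (by omega))), ?_⟩
  have a1 : Finsupp.single (n - p + 2) (d4 R M w) ∈ TFN R M (p - 3) (n - 1) :=
    TF_le_TFN R M (TF_single R M (d4_gr R M hw) (by ring) (by omega))
  have a2 := TN_le_TFN (p := p - 3) (n := n - 1) R M (TN_single R M (c := n - p + 1) h)
  have := Submodule.add_mem _ a1 a2
  convert this using 1
  rw [map_add, map_add, TD_single, TD_single, TD_single, add_sub_cancel_right,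
    show n - p + 2 - 1 = n - p + 1 by ring]
  simp only [d4_tt, tau4_tt, d2_d2, map_zero, LinearMap.zero_apply, add_zero,
    ZModModule.add_self, Finsupp.single_zero, zero_add, Finsupp.single_add]
  rw [← sub_eq_zero]; abel_nf; simp [nsmul2, zsmul2]

theorem survive_RR {R : DGBimod A} {ρ : R.V →ₗ[ZMod 2] A.diag.V} (hres : IsResolution R A.diag ρ)
    {j p n : ℤ} (hj : ∀ m < j, Subsingleton (HH R A.diag m)) (hp : p = 2 * j) {x : T2 R R}
    (hx : x ∈ gr2 R R j) (hd : d2 R R x ∈ rel2 R R) (l : ℕ) :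
    Finsupp.single (n - p) (tt R R x x) ∈ TG R R (3 + l) p n := by
  have hR := hres.1
  induction l with
  | zero => simpa using survive_base R hR hp hx hd
  | succ l ih =>
    rw [TG_iff] at ih ⊢
    obtain ⟨ζ, hζ, hD⟩ := ih
    set η := TD R R (Finsupp.single (n - p) (tt R R x x) + ζ) with hη
    have hDη : TD R R η ∈ TFN R R (p - (3 + l) - 3) (n - 1 - 1) := by
      rw [hη, TD_TD]; exact Submodule.zero_mem _
    have key : η ∈ TB R R (p - 1) (p - (3 + l)) (n - 1) := by
      by_cases ho : ∃ m, p - (3 + l) = 2 * m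
      · obtain ⟨m, hm⟩ := ho
        obtain ⟨z, hz, hdz, h⟩ := S_even R R hR hm hD hDη
        obtain ⟨w, hw, hzw⟩ := HH_RR_zero hres (hj m (by omega)) hz hdz
        have h2 := B_bdry R R hR (n := n - 1) hm hz hw hzw
        have := Submodule.add_mem _ (TB_mono R R (by omega) h)
          (TB_mono R R (p'' := p - 1) (by omega) h2)
        rwa [add_assoc, ZModModule.add_self, add_zero] at this
      · push Not at ho
        exact TB_mono R R (by omega) (S_odd R R hR ho hD hDη)
    obtain ⟨_, ⟨θ, hθ, rfl⟩, κ, hκ, hs⟩ := Submodule.mem_sup.1 key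
    rw [sub_add_cancel] at hθ
    refine ⟨ζ + θ, Submodule.add_mem _ hζ (TF_le_TFN R R hθ), ?_⟩
    have e : TD R R (Finsupp.single (n - p) (tt R R x x) + (ζ + θ)) = κ := by
      rw [← add_assoc, map_add, ← hη, ← hs]
      rw [← sub_eq_zero]; abel_nf; simp [nsmul2, zsmul2]
    rw [e]
    convert hκ using 2
    push_cast; ring

theorem survive_RR' {R : DGBimod A} {ρ : R.V →ₗ[ZMod 2] A.diag.V} (hres : IsResolution R A.diag ρ)
    {k₀ : ℤ} (hk : ∀ m, m ≠ k₀ → Subsingleton (HH R A.diag m)) {j p n : ℤ} (hp : p = 2 * j)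
    {x : T2 R R} (hx : x ∈ gr2 R R j) (hd : d2 R R x ∈ rel2 R R) (l : ℕ) :
    Finsupp.single (n - p) (tt R R x x) ∈ TG R R (3 + l) p n := by
  by_cases h : j = k₀
  · exact survive_RR hres (fun m hm => hk m (by omega)) hp hx hd l
  · obtain ⟨w, hw, hzw⟩ := HH_RR_zero hres (hk j h) hx hd
    exact TB_le_TG R R _ _ _ _ (B_bdry R R hres.1 hp hx hw hzw)

section push
variable {R M : DGBimod A} {s : ℤ} {g : R.V →ₗ[ZMod 2] M.V}

/-- The map on Tate bicomplexes induced by `g`. -/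
def TP (R : DGBimod A) {M : DGBimod A} (g : R.V →ₗ[ZMod 2] M.V) :
    (ℤ →₀ T4 R R) →ₗ[ZMod 2] (ℤ →₀ T4 R M) :=
  Finsupp.mapRange.linearMap (m4 LinearMap.id g)

theorem TP_apply (g : R.V →ₗ[ZMod 2] M.V) (ξ : ℤ →₀ T4 R R) (c : ℤ) :
    TP R g ξ c = m4 LinearMap.id g (ξ c) := by
  simp [TP]

theorem TP_single (g : R.V →ₗ[ZMod 2] M.V) (c : ℤ) (y : T4 R R) :
    TP R g (Finsupp.single c y) = Finsupp.single c (m4 LinearMap.id g y) := by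
  simp [TP]

theorem TP_D (hg : IsBHom R M s g) (ξ : ℤ →₀ T4 R R) : TP R g (TD R R ξ) = TD R M (TP R g ξ) := by
  ext1 c
  rw [TP_apply, TD_apply, TD_apply, map_add, map_add, m4_tau, m4_d (S := R) (LinearMap.id) g (fun _ => rfl) hg.2.1,
    TP_apply, TP_apply]

theorem TP_FN (hg : IsBHom R M s g) {p n : ℤ} {ξ : ℤ →₀ T4 R R} (hξ : ξ ∈ TFN R R p n) :
    TP R g ξ ∈ TFN R M (p + 2 * s) (n + 2 * s) := by
  obtain ⟨a, ha, b, hb, rfl⟩ := Submodule.mem_sup.1 hξ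
  rw [map_add]
  refine Submodule.add_mem _ (TF_le_TFN R M ?_) (TN_le_TFN R M ?_)
  · have : TF R R p n ≤ (TF R M (p + 2 * s) (n + 2 * s)).comap (TP R g) := by
      refine TF_le R R fun q hq y hy => ?_
      rw [Submodule.mem_comap, TP_single]
      exact TF_single R M (m4_gr (id_grHom R) hg.grHom (n' := q + 2 * s) (by ring) hy)
        (by ring) (by omega)
    exact this ha
  · rw [TN_mem] at hb ⊢
    intro c
    rw [TP_apply]
    exact m4_rel (id_grHom R) hg.grHom (hb c)

theorem TP_G (hg : IsBHom R M s g) {L p n : ℤ} {ξ : ℤ →₀ T4 R R} (hξ : ξ ∈ TG R R L p n) :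
    TP R g ξ ∈ TG R M L (p + 2 * s) (n + 2 * s) := by
  rw [TG_iff] at hξ ⊢
  obtain ⟨ζ, h1, h2⟩ := hξ
  refine ⟨TP R g ζ, ?_, ?_⟩
  · convert TP_FN hg h1 using 2; ring
  · rw [← map_add, ← TP_D hg]
    convert TP_FN hg h2 using 2 <;> ring
end push

theorem survive_M {R Ab M : DGBimod A} {ρ : R.V →ₗ[ZMod 2] A.diag.V}
    (hres : IsResolution R A.diag ρ)
    (hsmooth : HomSmooth A) (hproper : HomProper A)
    (e : ∀ (M : DGBimod A) (s : ℤ), Nonempty (HtpyHom Ab M s ≃ₗ[ZMod 2] HH R M s))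
    {k₀ : ℤ} (hk : ∀ m, m ≠ k₀ → Subsingleton (HH R A.diag m))
    {d : ℤ} (hM : IsDNeutral R Ab M d) {m p n : ℤ} (hp : p = 2 * m) {z : T2 R M}
    (hz : z ∈ gr2 R M m) (hdz : d2 R M z ∈ rel2 R M) (l : ℕ) :
    Finsupp.single (n - p) (tt R M z z) ∈ TG R M (3 + l) p n := by
  have hR := hres.1
  obtain ⟨u, hu, r, hr, hzr⟩ := Submodule.mem_sup.1
    (generation hres hsmooth hproper e hM hz hdz)
  obtain ⟨s, hs, _, ⟨w, hw, rfl⟩, hsw⟩ := Submodule.mem_sup.1 hu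
  have hdw := d2_gr R M hw
  rw [add_sub_cancel_right] at hdw
  have hK := TB_le_TG R M (3 + l) (p + 2) p n
  have hs' : s ∈ gr2 R M m ∧ Finsupp.single (n - p) (tt R M s s) ∈ TG R M (3 + l) p n := by
    refine Submodule.span_induction ?_ ?_ ?_ ?_ hs
    · rintro _ ⟨s', j, g, x, hg, hj, hx, hdx, rfl⟩
      refine ⟨lT_gr hg.grHom hj hx, ?_⟩
      have := TP_G hg (survive_RR' hres hk (n := n - 2 * s') (p := 2 * j) rfl hx hdx l)
      rw [TP_single, m4_tt] at this
      have e1 : n - 2 * s' - 2 * j = n - p := by rw [hp, ← hj]; ring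
      have e2 : 2 * j + 2 * s' = p := by rw [hp, ← hj]; ring
      rw [e1, e2, sub_add_cancel] at this
      exact this
    · refine ⟨Submodule.zero_mem _, ?_⟩
      simp
    · rintro a b _ _ ⟨ha, ha'⟩ ⟨hb, hb'⟩
      exact ⟨Submodule.add_mem _ ha hb, B_add R M hp (p' := p + 2) (by omega) hK ha hb ha' hb'⟩
    · rintro c a _ ⟨ha, ha'⟩
      refine ⟨Submodule.smul_mem _ _ ha, ?_⟩
      rw [map_smul, map_smul, LinearMap.smul_apply, ← Finsupp.smul_single, ← Finsupp.smul_single]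
      exact Submodule.smul_mem _ _ (Submodule.smul_mem _ _ ha')
  have hu' : u ∈ gr2 R M m := by rw [← hsw]; exact Submodule.add_mem _ hs'.1 hdw
  have hu'' : Finsupp.single (n - p) (tt R M u u) ∈ TG R M (3 + l) p n := by
    rw [← hsw]
    exact B_add R M hp (p' := p + 2) (by omega) hK hs'.1 hdw hs'.2 (hK (B_d R M hp hw))
  have hr' : r ∈ gr2 R M m := by
    rw [← hzr] at hz
    exact (Submodule.add_mem_iff_right _ hu').1 hz
  rw [← hzr]
  exact B_add R M hp (p' := p + 2) (by omega) hK hu' hr' hu''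
    (TB_le_TG R M _ _ _ _ (B_rel R M hR hp hr' hr))

theorem main_collapse {R Ab M : DGBimod A} {ρ : R.V →ₗ[ZMod 2] A.diag.V}
    (hres : IsResolution R A.diag ρ)
    (hsmooth : HomSmooth A) (hproper : HomProper A)
    (e : ∀ (M : DGBimod A) (s : ℤ), Nonempty (HtpyHom Ab M s ≃ₗ[ZMod 2] HH R M s))
    {k₀ : ℤ} (hk : ∀ m, m ≠ k₀ → Subsingleton (HH R A.diag m))
    {d : ℤ} (hM : IsDNeutral R Ab M d) : PiFormalBimod R M := by
  refine collapse_of R M fun r p n hr ξ hξ hD => ?_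
  obtain ⟨l, hl⟩ : ∃ l : ℕ, r + 1 = 3 + l := ⟨(r - 2).toNat, by omega⟩
  rw [hl]
  by_cases ho : ∃ m, p = 2 * m
  · obtain ⟨m, hm⟩ := ho
    obtain ⟨z, hz, hdz, h⟩ := S_even R M hres.1 hm hξ hD
    have := Submodule.add_mem _ (TB_le_TG R M (3 + l) _ _ _ h)
      (survive_M hres hsmooth hproper e hk hM (n := n) hm hz hdz l)
    rwa [add_assoc, ZModModule.add_self, add_zero] at this
  · push Not at ho
    exact TB_le_TG R M _ _ _ _ (S_odd R M hres.1 ho hξ hD)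

end T16
end Part16

/-- **Corollary 3.22.** Let `A` be homologically smooth and proper over `𝔽₂`. If `HH_*(A)`
is supported in a single grading, then every neutral dg `(A,A)`-bimodule is `π`-formal. -/
theorem neutral_pi_formal_of_concentrated
    (A : DGA (ZMod 2)) (R : DGBimod A) (ρ : R.V →ₗ[ZMod 2] A.diag.V)
    (hres : IsResolution R A.diag ρ)
    (hsmooth : HomSmooth A) (hproper : HomProper A)
    (Ab : DGBimod A)
    (e : ∀ (M : DGBimod A) (s : ℤ), Nonempty (HtpyHom Ab M s ≃ₗ[ZMod 2] HH R M s))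
    (hconc : ∃ k₀ : ℤ, ∀ n : ℤ, n ≠ k₀ → Subsingleton (HH R A.diag n)) :
    ∀ M : DGBimod A, IsNeutral R Ab M → PiFormalBimod R M := by
  obtain ⟨k₀, hk⟩ := hconc
  rintro M ⟨d, hM⟩
  exact main_collapse hres hsmooth hproper e hk hM

end LT
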